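/- (Global Hölder estimate with Hölder boundary data) There exist a universal exponent α ∈ (0,1) and a universal constant C > 0, depending only on n, Λ, M and C₀, such that the following holds. Let η be continuous on K̄₁ and a viscosity solution of the linearized oblique problem on K₁⁺, with η = ψ on ∂_bK₁ where ‖ψ‖_{C^{0,α}_{x,t}(∂_bK₁)} < ∞. Then ‖η‖_{C^{0,α}_{x,t}(K̄₁)} ≤ C·‖ψ‖_{C^{0,α}_{x,t}(∂_bK₁)}. -/

import Mathlib

open Set MeasureTheory Metric
open scoped RealInnerProductSpace

noncomputable section

abbrev Eucl (n : ℕ) : Type := EuclideanSpace ℝ (Fin n)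
abbrev SpaceTime (n : ℕ) : Type := Eucl n × ℝ

/-- The operator norm of an `n × n` real matrix, acting on Euclidean space. -/
noncomputable def matOpNorm {n : ℕ} (A : Matrix (Fin n) (Fin n) ℝ) : ℝ :=
  ‖(LinearMap.toContinuousLinearMap (Matrix.toEuclideanLin A))‖

/-- `F` is uniformly elliptic with ellipticity constant `Λ`. -/
def UniformlyElliptic {n : ℕ} (Λ : ℝ) (F : Matrix (Fin n) (Fin n) ℝ → ℝ) : Prop :=
  ∀ M N : Matrix (Fin n) (Fin n) ℝ, M.IsSymm → N.IsSymm → N.PosSemidef →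
    Λ⁻¹ * matOpNorm N ≤ F (M + N) - F M ∧ F (M + N) - F M ≤ Λ * matOpNorm N

/-- Pucci minimal operator `P⁻(R, a, b) = a ∑_{eᵢ>0} eᵢ + b ∑_{eᵢ<0} eᵢ`. -/
noncomputable def pucciMinus {n : ℕ} (R : Matrix (Fin n) (Fin n) ℝ) (a b : ℝ) : ℝ :=
  if h : R.IsHermitian then
    a * ∑ i, max (h.eigenvalues i) 0 + b * ∑ i, min (h.eigenvalues i) 0
  else 0

/-- Pucci maximal operator `P⁺(R, a, b) = a ∑_{eᵢ<0} eᵢ + b ∑_{eᵢ>0} eᵢ`. -/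
noncomputable def pucciPlus {n : ℕ} (R : Matrix (Fin n) (Fin n) ℝ) (a b : ℝ) : ℝ :=
  if h : R.IsHermitian then
    a * ∑ i, min (h.eigenvalues i) 0 + b * ∑ i, max (h.eigenvalues i) 0
  else 0

/-- Parabolic cylinder `E_ρ(x₀,t₀) = B_ρ(x₀) × (t₀ − ρ², t₀]`. -/
def cylE {n : ℕ} (x₀ : Eucl n) (t₀ ρ : ℝ) : Set (SpaceTime n) :=
  (ball x₀ ρ) ×ˢ (Ioc (t₀ - ρ ^ 2) t₀)

/-- `φ` is C² in `x` and C¹ in `t` on `D`, with time derivative `φt`,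
spatial gradient `gφ` and spatial Hessian `Hφ`. -/
structure ParabolicTest {n : ℕ} (φ : SpaceTime n → ℝ) (D : Set (SpaceTime n))
    (φt : SpaceTime n → ℝ) (gφ : SpaceTime n → Eucl n)
    (Hφ : SpaceTime n → Matrix (Fin n) (Fin n) ℝ) : Prop where
  contPhi : ContinuousOn φ D
  contPhit : ContinuousOn φt D
  contGrad : ContinuousOn gφ D
  contHess : ContinuousOn Hφ D
  symmHess : ∀ p ∈ D, (Hφ p).IsSymm
  timeDeriv : ∀ p ∈ D, HasDerivWithinAt (fun s : ℝ => φ (p.1, s)) (φt p) {s : ℝ | (p.1, s) ∈ D} p.2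
  spaceGrad : ∀ p ∈ D, HasGradientWithinAt (fun y => φ (y, p.2)) (gφ p) {y | (y, p.2) ∈ D} p.1
  spaceHess : ∀ p ∈ D, HasFDerivWithinAt (fun y => gφ (y, p.2))
      (LinearMap.toContinuousLinearMap (Matrix.toEuclideanLin (Hφ p))) {y | (y, p.2) ∈ D} p.1

/-- `φ` touches `u` from above at `p₀` in the set `E`. -/
def TouchesAbove {n : ℕ} (φ u : SpaceTime n → ℝ) (E : Set (SpaceTime n)) (p₀ : SpaceTime n) :
    Prop :=
  p₀ ∈ E ∧ φ p₀ = u p₀ ∧ ∀ p ∈ E, u p ≤ φ p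

/-- `φ` touches `u` from below at `p₀` in the set `E`. -/
def TouchesBelow {n : ℕ} (φ u : SpaceTime n → ℝ) (E : Set (SpaceTime n)) (p₀ : SpaceTime n) :
    Prop :=
  p₀ ∈ E ∧ φ p₀ = u p₀ ∧ ∀ p ∈ E, φ p ≤ u p

/-- `u` is a viscosity subsolution of `u_t = F(D²u)` in `D`. -/
def ViscSub {n : ℕ} (F : Matrix (Fin n) (Fin n) ℝ → ℝ) (u : SpaceTime n → ℝ)
    (D : Set (SpaceTime n)) : Prop :=
  ∀ (φ φt : SpaceTime n → ℝ) (gφ : SpaceTime n → Eucl n)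
    (Hφ : SpaceTime n → Matrix (Fin n) (Fin n) ℝ) (p₀ : SpaceTime n) (ρ : ℝ),
    0 < ρ → p₀ ∈ D → cylE p₀.1 p₀.2 ρ ⊆ D →
    ParabolicTest φ (cylE p₀.1 p₀.2 ρ) φt gφ Hφ →
    TouchesAbove φ u (cylE p₀.1 p₀.2 ρ) p₀ →
    φt p₀ ≤ F (Hφ p₀)

/-- `u` is a viscosity supersolution of `u_t = F(D²u)` in `D`. -/
def ViscSup {n : ℕ} (F : Matrix (Fin n) (Fin n) ℝ → ℝ) (u : SpaceTime n → ℝ)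
    (D : Set (SpaceTime n)) : Prop :=
  ∀ (φ φt : SpaceTime n → ℝ) (gφ : SpaceTime n → Eucl n)
    (Hφ : SpaceTime n → Matrix (Fin n) (Fin n) ℝ) (p₀ : SpaceTime n) (ρ : ℝ),
    0 < ρ → p₀ ∈ D → cylE p₀.1 p₀.2 ρ ⊆ D →
    ParabolicTest φ (cylE p₀.1 p₀.2 ρ) φt gφ Hφ →
    TouchesBelow φ u (cylE p₀.1 p₀.2 ρ) p₀ →
    F (Hφ p₀) ≤ φt p₀

end

/-- The last ("vertical") coordinate `xₙ` of a point in `ℝⁿ = ℝ^{d+1}`. -/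
def lastC {d : ℕ} (x : Eucl (d + 1)) : ℝ := x (Fin.last d)

/-- `K_r = (B_r ∩ {xₙ > 0}) × (−r, 0]`. -/
def Kc (d : ℕ) (r : ℝ) : Set (SpaceTime (d + 1)) :=
  {p | p.1 ∈ ball 0 r ∧ 0 < lastC p.1 ∧ p.2 ∈ Ioc (-r) 0}

/-- `F_r = (B_r ∩ {xₙ = 0}) × (−r, 0]`. -/
def Fc (d : ℕ) (r : ℝ) : Set (SpaceTime (d + 1)) :=
  {p | p.1 ∈ ball 0 r ∧ lastC p.1 = 0 ∧ p.2 ∈ Ioc (-r) 0}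

/-- `K_r⁺ = K_r ∪ F_r`. -/
def KcP (d : ℕ) (r : ℝ) : Set (SpaceTime (d + 1)) := Kc d r ∪ Fc d r

/-- The Dirichlet part `∂_b K₁` of the boundary of `K₁`: the part of the topological
boundary not contained in `F₁ ∪ ((B₁ ∩ {xₙ>0}) × {0})`. -/
def bdryK (d : ℕ) : Set (SpaceTime (d + 1)) :=
  frontier (Kc d 1) \
    (Fc d 1 ∪ {p | p.1 ∈ ball 0 1 ∧ 0 < lastC p.1 ∧ p.2 = 0})

/-- Coefficient data for the linearized oblique problem: `Q` is symmetric, uniformly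
elliptic, differentiable (entrywise, with derivative `Q'`) with `‖Q'‖ ≤ C₀/λ`, and the
oblique vector `v` is differentiable with `vₙ ≥ M⁻¹`, `|v| ≤ M`, `|v'| ≤ λ⁻¹`. -/
structure ObliqueData (d : ℕ) (lam Λ M C₀ : ℝ)
    (Q Q' : ℝ → Matrix (Fin (d + 1)) (Fin (d + 1)) ℝ)
    (v v' : ℝ → Eucl (d + 1)) : Prop where
  lam_pos : 0 < lam
  lam_le_one : lam ≤ 1
  Lam_ge_one : 1 ≤ Λ
  M_ge_one : 1 ≤ M
  C0_pos : 0 < C₀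
  Qsymm : ∀ t ∈ Icc (-1 : ℝ) 0, (Q t).IsSymm
  Qlower : ∀ t ∈ Icc (-1 : ℝ) 0,
    (Q t - (Λ * M ^ 2)⁻¹ • (1 : Matrix (Fin (d + 1)) (Fin (d + 1)) ℝ)).PosSemidef
  Qupper : ∀ t ∈ Icc (-1 : ℝ) 0,
    ((Λ * M ^ 2) • (1 : Matrix (Fin (d + 1)) (Fin (d + 1)) ℝ) - Q t).PosSemidef
  Qderiv : ∀ t ∈ Icc (-1 : ℝ) 0, ∀ i j,
    HasDerivWithinAt (fun s => Q s i j) (Q' t i j) (Icc (-1 : ℝ) 0) t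
  Qderiv_bound : ∀ t ∈ Icc (-1 : ℝ) 0, matOpNorm (Q' t) ≤ C₀ / lam
  vderiv : ∀ t ∈ Icc (-1 : ℝ) 0, HasDerivWithinAt v (v' t) (Icc (-1 : ℝ) 0) t
  vlast : ∀ t ∈ Icc (-1 : ℝ) 0, M⁻¹ ≤ lastC (v t)
  vbound : ∀ t ∈ Icc (-1 : ℝ) 0, ‖v t‖ ≤ M
  vderiv_bound : ∀ t ∈ Icc (-1 : ℝ) 0, ‖v' t‖ ≤ lam⁻¹

/-- `η` is a viscosity subsolution of the linearized oblique problem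
`λ η_t = tr(Q(t) D²η)` in `K₁`, `η_t = v(t)·∇η` on `F₁`. -/
def ObliqueSub (d : ℕ) (lam : ℝ) (Q : ℝ → Matrix (Fin (d + 1)) (Fin (d + 1)) ℝ)
    (v : ℝ → Eucl (d + 1)) (η : SpaceTime (d + 1) → ℝ) : Prop :=
  ContinuousOn η (KcP d 1) ∧
  ∀ (φ φt : SpaceTime (d + 1) → ℝ) (gφ : SpaceTime (d + 1) → Eucl (d + 1))
    (Hφ : SpaceTime (d + 1) → Matrix (Fin (d + 1)) (Fin (d + 1)) ℝ)
    (p₀ : SpaceTime (d + 1)) (ρ : ℝ),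
    0 < ρ →
    ParabolicTest φ (cylE p₀.1 p₀.2 ρ ∩ closure (Kc d 1)) φt gφ Hφ →
    TouchesAbove φ η (cylE p₀.1 p₀.2 ρ ∩ closure (Kc d 1)) p₀ →
    (p₀ ∈ Kc d 1 → lam * φt p₀ ≤ (Q p₀.2 * Hφ p₀).trace) ∧
    (p₀ ∈ Fc d 1 → φt p₀ ≤ ⟪v p₀.2, gφ p₀⟫)

/-- `η` is a viscosity supersolution of the linearized oblique problem. -/
def ObliqueSup (d : ℕ) (lam : ℝ) (Q : ℝ → Matrix (Fin (d + 1)) (Fin (d + 1)) ℝ)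
    (v : ℝ → Eucl (d + 1)) (η : SpaceTime (d + 1) → ℝ) : Prop :=
  ContinuousOn η (KcP d 1) ∧
  ∀ (φ φt : SpaceTime (d + 1) → ℝ) (gφ : SpaceTime (d + 1) → Eucl (d + 1))
    (Hφ : SpaceTime (d + 1) → Matrix (Fin (d + 1)) (Fin (d + 1)) ℝ)
    (p₀ : SpaceTime (d + 1)) (ρ : ℝ),
    0 < ρ →
    ParabolicTest φ (cylE p₀.1 p₀.2 ρ ∩ closure (Kc d 1)) φt gφ Hφ →
    TouchesBelow φ η (cylE p₀.1 p₀.2 ρ ∩ closure (Kc d 1)) p₀ →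
    (p₀ ∈ Kc d 1 → (Q p₀.2 * Hφ p₀).trace ≤ lam * φt p₀) ∧
    (p₀ ∈ Fc d 1 → ⟪v p₀.2, gφ p₀⟫ ≤ φt p₀)

/-- `η` is a viscosity solution of the linearized oblique problem on `K₁⁺`. -/
def ObliqueSolution (d : ℕ) (lam : ℝ) (Q : ℝ → Matrix (Fin (d + 1)) (Fin (d + 1)) ℝ)
    (v : ℝ → Eucl (d + 1)) (η : SpaceTime (d + 1) → ℝ) : Prop :=
  ObliqueSub d lam Q v η ∧ ObliqueSup d lam Q v η

/-- The distance `|x' − y'|` between the horizontal projections. -/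
noncomputable def primeDist {d : ℕ} (x y : Eucl (d + 1)) : ℝ :=
  Real.sqrt (∑ i : Fin d, (x i.castSucc - y i.castSucc) ^ 2)

/-- The boundary-adapted parabolic distance `d(·,·)`. -/
noncomputable def pdist {d : ℕ} (P₁ P₂ : SpaceTime (d + 1)) : ℝ :=
  primeDist P₁.1 P₂.1 +
    min (|lastC P₁.1| + |lastC P₂.1| + |P₁.2 - P₂.2|)
      (|lastC P₁.1 - lastC P₂.1| + Real.sqrt |P₁.2 - P₂.2|)

/-- The rescaled distance `d_λ(P₁,P₂) = λ⁻¹ d(λP₁, λP₂)`. -/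
noncomputable def pdistL {d : ℕ} (lam : ℝ) (P₁ P₂ : SpaceTime (d + 1)) : ℝ :=
  lam⁻¹ * pdist (lam • P₁.1, lam * P₁.2) (lam • P₂.1, lam * P₂.2)

open Filter Topology Asymptotics

noncomputable section GH

/-- quadratic form -/
def qf {n : ℕ} (A : Matrix (Fin n) (Fin n) ℝ) (y : Eucl n) : ℝ := ⟪Matrix.toEuclideanLin A y, y⟫

lemma qf_add {n : ℕ} (A B : Matrix (Fin n) (Fin n) ℝ) (y : Eucl n) :
    qf (A + B) y = qf A y + qf B y := by
  simp [qf, inner_add_left]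

lemma qf_smul {n : ℕ} (c : ℝ) (A : Matrix (Fin n) (Fin n) ℝ) (y : Eucl n) :
    qf (c • A) y = c * qf A y := by
  simp [qf, inner_smul_left]

lemma qf_zero {n : ℕ} (y : Eucl n) : qf 0 y = 0 := by simp [qf]

lemma qf_one {n : ℕ} (y : Eucl n) : qf 1 y = ‖y‖ ^ 2 := by
  simp [qf]

/-- rank one matrix -/
def vv {n : ℕ} (p : Eucl n) : Matrix (Fin n) (Fin n) ℝ := Matrix.vecMulVec p.ofLp p.ofLp

lemma toE_vv {n : ℕ} (p y : Eucl n) : Matrix.toEuclideanLin (vv p) y = ⟪p, y⟫ • p := by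
  ext i
  simp only [vv, Matrix.ofLp_toLpLin, Matrix.toLin'_apply, Matrix.mulVec, PiLp.smul_apply, smul_eq_mul,
    Matrix.vecMulVec, Matrix.of_apply, dotProduct, PiLp.inner_apply, Finset.sum_mul]
  refine Finset.sum_congr rfl fun j _ => ?_
  simp
  ring

lemma qf_vv {n : ℕ} (p y : Eucl n) : qf (vv p) y = ⟪p, y⟫ ^ 2 := by
  rw [qf, toE_vv, inner_smul_left]; simp [sq]

lemma vv_symm {n : ℕ} (p : Eucl n) : (vv p).IsSymm := by
  ext i j; simp [vv, Matrix.vecMulVec, mul_comm]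

lemma trace_mul_vv {n : ℕ} (Q : Matrix (Fin n) (Fin n) ℝ) (p : Eucl n) :
    (Q * vv p).trace = qf Q p := by
  simp only [qf, vv, Matrix.trace, Matrix.diag, Matrix.mul_apply, Matrix.vecMulVec, Matrix.of_apply,
    PiLp.inner_apply, Matrix.ofLp_toLpLin, Matrix.toLin'_apply, Matrix.mulVec, dotProduct]
  refine Finset.sum_congr rfl fun i _ => ?_
  simp [Finset.mul_sum]
  refine Finset.sum_congr rfl fun j _ => ?_
  ring

lemma qf_continuous {n : ℕ} (A : Matrix (Fin n) (Fin n) ℝ) : Continuous (qf A) := by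
  have h : Continuous (Matrix.toEuclideanLin A : Eucl n → Eucl n) :=
    LinearMap.continuous_of_finiteDimensional _
  exact h.inner continuous_id

lemma toE_symm {n : ℕ} {A : Matrix (Fin n) (Fin n) ℝ} (hA : A.IsSymm) (x y : Eucl n) :
    ⟪Matrix.toEuclideanLin A x, y⟫ = ⟪x, Matrix.toEuclideanLin A y⟫ := by
  have : (Matrix.toEuclideanLin A).IsSymmetric :=
    Matrix.isSymmetric_toEuclideanLin_iff.2 (by
      rw [Matrix.IsHermitian, Matrix.conjTranspose_eq_transpose_of_trivial]; exact hA)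
  exact this x y

lemma qf_bound {n : ℕ} (A : Matrix (Fin n) (Fin n) ℝ) (y : Eucl n) :
    |qf A y| ≤ matOpNorm A * ‖y‖ ^ 2 := by
  have h1 := abs_real_inner_le_norm (Matrix.toEuclideanLin A y) y
  have h2 := (LinearMap.toContinuousLinearMap (Matrix.toEuclideanLin A)).le_opNorm y
  simp only [LinearMap.coe_toContinuousLinearMap'] at h2
  rw [qf, matOpNorm]
  calc _ ≤ _ := h1
    _ ≤ _ := by rw [sq, ← mul_assoc]; exact mul_le_mul_of_nonneg_right h2 (norm_nonneg _)

/-! ### geometry -/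

lemma lastC_continuous {d : ℕ} : Continuous (lastC : Eucl (d + 1) → ℝ) := by
  unfold lastC; fun_prop

lemma lastC_add {d : ℕ} (x y : Eucl (d + 1)) : lastC (x + y) = lastC x + lastC y := by simp [lastC]
lemma lastC_sub {d : ℕ} (x y : Eucl (d + 1)) : lastC (x - y) = lastC x - lastC y := by simp [lastC]
lemma lastC_smul {d : ℕ} (c : ℝ) (x : Eucl (d + 1)) : lastC (c • x) = c * lastC x := by
  simp [lastC]

/-- last basis vector -/
def eN (d : ℕ) : Eucl (d + 1) := EuclideanSpace.single (Fin.last d) 1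

lemma norm_eN (d : ℕ) : ‖eN d‖ = 1 := by simp [eN]
lemma lastC_eN (d : ℕ) : lastC (eN d) = 1 := by simp [eN, lastC]
lemma inner_eN {d : ℕ} (x : Eucl (d + 1)) : ⟪eN d, x⟫ = lastC x := by
  simp [eN, lastC, EuclideanSpace.inner_single_left]
lemma abs_lastC_le {d : ℕ} (x : Eucl (d + 1)) : |lastC x| ≤ ‖x‖ := by
  have := abs_real_inner_le_norm (eN d) x
  rwa [inner_eN, norm_eN, one_mul] at this

lemma mem_closure_Kc {d : ℕ} {p : SpaceTime (d + 1)} :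
    p ∈ closure (Kc d 1) ↔ ‖p.1‖ ≤ 1 ∧ 0 ≤ lastC p.1 ∧ -1 ≤ p.2 ∧ p.2 ≤ 0 := by
  constructor
  · intro h
    have hc : IsClosed {p : SpaceTime (d + 1) | ‖p.1‖ ≤ 1 ∧ 0 ≤ lastC p.1 ∧ -1 ≤ p.2 ∧ p.2 ≤ 0} := by
      refine (isClosed_le (continuous_fst.norm) continuous_const).inter
        ((isClosed_le continuous_const (lastC_continuous.comp continuous_fst)).inter
        ((isClosed_le continuous_const continuous_snd).inter
          (isClosed_le continuous_snd continuous_const)))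
    refine closure_minimal ?_ hc h
    rintro q ⟨h1, h2, h3, h4⟩
    exact ⟨(mem_ball_zero_iff.1 h1).le, h2.le, h3.le, h4⟩
  · rintro ⟨h1, h2, h3, h4⟩
    let g : ℝ → SpaceTime (d + 1) := fun s => ((1 - s) • p.1 + s • ((1 / 2 : ℝ) • eN d),
      (1 - s) * p.2 + s * (-1 / 2))
    have hg : Tendsto g (𝓝[>] 0) (𝓝 p) := by
      have : ContinuousAt g 0 := by fun_prop
      have h0 : g 0 = p := by simp [g]
      rw [ContinuousAt, h0] at this
      exact this.mono_left nhdsWithin_le_nhds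
    refine mem_closure_of_tendsto hg ?_
    filter_upwards [Ioo_mem_nhdsGT (show (0 : ℝ) < 1 by norm_num)] with s hs
    have hs0 := hs.1
    have hs1 := hs.2
    refine ⟨?_, ?_, ?_, ?_⟩
    · simp only [g, mem_ball_zero_iff]
      calc _ ≤ ‖(1 - s) • p.1‖ + ‖s • ((1 / 2 : ℝ) • eN d)‖ := norm_add_le _ _
        _ = (1 - s) * ‖p.1‖ + s * (1 / 2) := by
          rw [norm_smul, norm_smul, norm_smul, norm_eN, Real.norm_of_nonneg (by linarith),
            Real.norm_of_nonneg hs0.le]; norm_num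
        _ < 1 := by nlinarith [norm_nonneg p.1]
    · simp only [g, lastC_add, lastC_smul, lastC_eN]
      have : 0 ≤ (1 - s) * lastC p.1 := mul_nonneg (by linarith) h2
      linarith
    · simp only [g]; nlinarith
    · simp only [g]; nlinarith

lemma isCompact_closure_Kc (d : ℕ) : IsCompact (closure (Kc d 1)) := by
  have : closure (Kc d 1) ⊆ (closedBall 0 1) ×ˢ (Icc (-1 : ℝ) 0) := by
    intro p hp
    obtain ⟨h1, -, h3, h4⟩ := mem_closure_Kc.1 hp
    exact ⟨by simpa using h1, h3, h4⟩
  exact ((isCompact_closedBall _ _).prod isCompact_Icc).of_isClosed_subset isClosed_closure this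

lemma mem_bdryK {d : ℕ} {p : SpaceTime (d + 1)} (hp : p ∈ closure (Kc d 1))
    (h : ‖p.1‖ = 1 ∨ p.2 = -1) : p ∈ bdryK d := by
  have key : ¬ (p.1 ∈ ball (0 : Eucl (d + 1)) 1 ∧ p.2 ∈ Ioc (-1 : ℝ) 0) := by
    rintro ⟨h1, h2⟩
    rw [mem_ball_zero_iff] at h1
    rcases h with h | h
    · linarith
    · have := h2.1; linarith
  refine ⟨⟨hp, fun hi => ?_⟩, ?_⟩
  · have := interior_subset hi
    exact key ⟨this.1, this.2.2⟩
  · rintro (hF | hT)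
    · exact key ⟨hF.1, hF.2.2⟩
    · exact key ⟨hT.1, by rw [hT.2.2]; constructor <;> norm_num⟩

lemma trichotomy {d : ℕ} {p : SpaceTime (d + 1)} (hp : p ∈ closure (Kc d 1)) :
    (‖p.1‖ = 1 ∨ p.2 = -1) ∨ (p ∈ Kc d 1 ∨ p ∈ Fc d 1) := by
  obtain ⟨h1, h2, h3, h4⟩ := mem_closure_Kc.1 hp
  rcases eq_or_lt_of_le h1 with h | h
  · exact Or.inl (Or.inl h)
  rcases eq_or_lt_of_le h3 with h' | h'
  · exact Or.inl (Or.inr h'.symm)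
  right
  rcases eq_or_lt_of_le h2 with h'' | h''
  · exact Or.inr ⟨by simpa using h, h''.symm, h', h4⟩
  · exact Or.inl ⟨by simpa using h, h'', h', h4⟩

/-- past filter -/
def PF {d : ℕ} (p₀ : SpaceTime (d + 1)) : Filter (SpaceTime (d + 1)) :=
  𝓝[closure (Kc d 1) ∩ {q | q.2 ≤ p₀.2}] p₀

lemma PF_cyl {d : ℕ} {p₀ : SpaceTime (d + 1)} {S : SpaceTime (d + 1) → Prop}
    (h : ∀ᶠ q in PF p₀, S q) : ∃ ρ > 0, ∀ q ∈ cylE p₀.1 p₀.2 ρ ∩ closure (Kc d 1), S q := by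
  rw [PF, eventually_nhdsWithin_iff, Metric.eventually_nhds_iff] at h
  obtain ⟨δ, hδ, h⟩ := h
  refine ⟨min δ 1, lt_min hδ one_pos, ?_⟩
  rintro q ⟨⟨h1, h2⟩, h3⟩
  have hr0 : 0 < min δ 1 := lt_min hδ one_pos
  have hr1 : min δ 1 ≤ 1 := min_le_right _ _
  have hrd : min δ 1 ≤ δ := min_le_left _ _
  refine h ?_ ⟨h3, h2.2⟩
  rw [Prod.dist_eq, max_lt_iff]
  refine ⟨lt_of_lt_of_le h1 hrd, ?_⟩
  rw [Real.dist_eq, abs_lt]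
  have := h2.1
  have := h2.2
  constructor <;> nlinarith

/-- the test polynomial lemma -/
lemma jet_sub {d : ℕ} {lam : ℝ} {Q : ℝ → Matrix (Fin (d + 1)) (Fin (d + 1)) ℝ}
    {v : ℝ → Eucl (d + 1)} {u : SpaceTime (d + 1) → ℝ} (hu : ObliqueSub d lam Q v u)
    {p₀ : SpaceTime (d + 1)} (hp₀ : p₀ ∈ closure (Kc d 1)) {b : ℝ} {p : Eucl (d + 1)}
    {A : Matrix (Fin (d + 1)) (Fin (d + 1)) ℝ} (hA : A.IsSymm)
    (h : ∀ ε > 0, ∀ᶠ q in PF p₀, u q ≤ u p₀ + b * (q.2 - p₀.2) + ⟪p, q.1 - p₀.1⟫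
      + 1 / 2 * qf A (q.1 - p₀.1) + ε * (‖q.1 - p₀.1‖ ^ 2 + |q.2 - p₀.2|)) :
    (p₀ ∈ Kc d 1 → lam * b ≤ (Q p₀.2 * A).trace) ∧ (p₀ ∈ Fc d 1 → b ≤ ⟪v p₀.2, p⟫) := by
  have main : ∀ ε > 0, (p₀ ∈ Kc d 1 → lam * (b - ε) ≤ (Q p₀.2 * (A + (2 * ε) • 1)).trace) ∧
      (p₀ ∈ Fc d 1 → b - ε ≤ ⟪v p₀.2, p⟫) := by
    intro ε hε
    obtain ⟨ρ, hρ, hS⟩ := PF_cyl (h ε hε)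
    set A' : Matrix (Fin (d + 1)) (Fin (d + 1)) ℝ := A + (2 * ε) • 1 with hA'
    have hA's : A'.IsSymm := hA.add (by
      rw [Matrix.IsSymm, Matrix.transpose_smul, Matrix.transpose_one])
    set L := LinearMap.toContinuousLinearMap (Matrix.toEuclideanLin A') with hL
    have hLs : ∀ x y, ⟪L x, y⟫ = ⟪x, L y⟫ := toE_symm hA's
    let φ : SpaceTime (d + 1) → ℝ := fun q => u p₀ + (b - ε) * (q.2 - p₀.2) + ⟪p, q.1 - p₀.1⟫
      + 1 / 2 * ⟪L (q.1 - p₀.1), q.1 - p₀.1⟫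
    have key := hu.2 φ (fun _ => b - ε) (fun q => p + L (q.1 - p₀.1)) (fun _ => A') p₀ ρ hρ
      { contPhi := by fun_prop
        contPhit := by fun_prop
        contGrad := by fun_prop
        contHess := by fun_prop
        symmHess := fun _ _ => hA's
        timeDeriv := by
          intro q _
          apply HasDerivAt.hasDerivWithinAt
          have : HasDerivAt (fun s : ℝ => (b - ε) * (s - p₀.2)) ((b - ε) * 1) q.2 :=
            ((hasDerivAt_id q.2).sub_const _).const_mul _
          rw [mul_one] at this
          exact (((this.const_add (u p₀)).add_const (⟪p, q.1 - p₀.1⟫)).add_const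
            (1 / 2 * ⟪L (q.1 - p₀.1), q.1 - p₀.1⟫))
        spaceGrad := by
          intro q _
          rw [hasGradientWithinAt_iff_hasFDerivWithinAt]
          apply HasFDerivAt.hasFDerivWithinAt
          have h1 : HasFDerivAt (fun y : Eucl (d + 1) => y - p₀.1)
            (ContinuousLinearMap.id ℝ _) q.1 := (hasFDerivAt_id q.1).sub_const _
          have h2 : HasFDerivAt (fun y : Eucl (d + 1) => L (y - p₀.1)) L q.1 :=
            (L.hasFDerivAt.comp q.1 h1).congr_fderiv (by ext; simp)
          have h3 := (h2.inner ℝ h1).const_mul (1 / 2 : ℝ)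
          have h4 := ((hasFDerivAt_const p q.1).inner ℝ h1).const_add
            (u p₀ + (b - ε) * (q.2 - p₀.2))
          refine (h4.add h3).congr_fderiv ?_
          ext y
          simp [fderivInnerCLM_apply, inner_add_left]
          rw [hLs y, real_inner_comm _ y]
          simp only [map_sub, inner_sub_left]
          ring
        spaceHess := by
          intro q _
          apply HasFDerivAt.hasFDerivWithinAt
          have h1 : HasFDerivAt (fun y : Eucl (d + 1) => y - p₀.1)
            (ContinuousLinearMap.id ℝ _) q.1 := (hasFDerivAt_id q.1).sub_const _
          have h2 : HasFDerivAt (fun y : Eucl (d + 1) => L (y - p₀.1)) L q.1 :=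
            (L.hasFDerivAt.comp q.1 h1).congr_fderiv (by ext; simp)
          exact h2.const_add p }
      ⟨⟨⟨mem_ball_self hρ, by constructor <;> nlinarith [sq_pos_of_pos hρ]⟩, hp₀⟩, by simp [φ], by
        intro q hq
        refine (hS q hq).trans ?_
        have ht : q.2 - p₀.2 ≤ 0 := by have := hq.1.2.2; linarith
        rw [abs_of_nonpos ht]
        have : ⟪L (q.1 - p₀.1), q.1 - p₀.1⟫ = qf A (q.1 - p₀.1) + 2 * ε * ‖q.1 - p₀.1‖ ^ 2 := by
          rw [← qf_one, ← qf_smul, ← qf_add]; rfl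
        simp only [φ]
        rw [this]
        apply le_of_eq
        ring⟩
    refine ⟨key.1, fun hF => ?_⟩
    have := key.2 hF
    simpa using this
  constructor
  · intro hK
    have h1 : Tendsto (fun ε : ℝ => lam * (b - ε)) (𝓝[>] 0) (𝓝 (lam * (b - 0))) := by
      apply Tendsto.mono_left _ nhdsWithin_le_nhds
      exact (by fun_prop : Continuous fun ε : ℝ => lam * (b - ε)).tendsto 0
    have h2 : Tendsto (fun ε : ℝ => (Q p₀.2 * (A + (2 * ε) • 1)).trace) (𝓝[>] 0)
        (𝓝 ((Q p₀.2 * (A + (2 * (0 : ℝ)) • 1)).trace)) := by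
      apply Tendsto.mono_left _ nhdsWithin_le_nhds
      refine Continuous.tendsto ?_ 0
      simp only [mul_add, Matrix.trace_add, Matrix.mul_smul, Matrix.trace_smul]
      fun_prop
    have := le_of_tendsto_of_tendsto h1 h2 (by
      filter_upwards [self_mem_nhdsWithin] with ε hε
      exact (main ε hε).1 hK)
    simpa using this
  · intro hF
    refine le_of_forall_pos_le_add fun ε hε => ?_
    have := (main ε hε).2 hF
    linarith

lemma sub_of_neg {d : ℕ} {lam : ℝ} {Q : ℝ → Matrix (Fin (d + 1)) (Fin (d + 1)) ℝ}
    {v : ℝ → Eucl (d + 1)} {u : SpaceTime (d + 1) → ℝ} (hu : ObliqueSup d lam Q v u) :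
    ObliqueSub d lam Q v (fun q => - u q) := by
  refine ⟨hu.1.neg, ?_⟩
  intro φ φt gφ Hφ p₀ ρ hρ hT hA
  have := hu.2 (fun q => - φ q) (fun q => - φt q) (fun q => - gφ q) (fun q => - Hφ q) p₀ ρ hρ
    { contPhi := hT.contPhi.neg
      contPhit := hT.contPhit.neg
      contGrad := hT.contGrad.neg
      contHess := hT.contHess.neg
      symmHess := fun p hp => (hT.symmHess p hp).neg
      timeDeriv := fun p hp => (hT.timeDeriv p hp).neg
      spaceGrad := fun p hp => by
        have := (hT.spaceGrad p hp)
        rw [hasGradientWithinAt_iff_hasFDerivWithinAt] at this ⊢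
        refine this.neg.congr_fderiv ?_
        simp
      spaceHess := fun p hp => by
        refine (hT.spaceHess p hp).neg.congr_fderiv ?_
        ext; simp }
    ⟨hA.1, by simp [hA.2.1], fun q hq => by
      have := hA.2.2 q hq
      simp only at this ⊢
      linarith⟩
  refine ⟨fun h => ?_, fun h => ?_⟩
  · have := this.1 h
    simp at this
    exact this
  · have := this.2 h
    simp at this
    exact this

end GH

noncomputable section GH

/-- parabolic gauge -/
def prho {n : ℕ} (p₀ q : SpaceTime n) : ℝ := ‖q.1 - p₀.1‖ ^ 2 + |q.2 - p₀.2|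

lemma prho_nonneg {n : ℕ} (p₀ q : SpaceTime n) : 0 ≤ prho p₀ q := by unfold prho; positivity

lemma prho_tendsto {n : ℕ} {l : Filter (SpaceTime n)} {p₀ : SpaceTime n} (hl : l ≤ 𝓝 p₀) :
    Tendsto (prho p₀) l (𝓝 0) := by
  have : Continuous (prho p₀) := by unfold prho; fun_prop
  have h := (this.tendsto p₀).mono_left hl
  simpa [prho] using h

/-- parabolic second order jets -/
def Jet {n : ℕ} (l : Filter (SpaceTime n)) (f : SpaceTime n → ℝ) (p₀ : SpaceTime n) (b : ℝ)
    (p : Eucl n) (A : Matrix (Fin n) (Fin n) ℝ) : Prop :=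
  A.IsSymm ∧ (fun q => f q - f p₀ - b * (q.2 - p₀.2) - ⟪p, q.1 - p₀.1⟫
    - 1 / 2 * qf A (q.1 - p₀.1)) =o[l] prho p₀

lemma Jet.congr {n : ℕ} {l : Filter (SpaceTime n)} {f : SpaceTime n → ℝ} {p₀ : SpaceTime n}
    {b b' : ℝ} {p p' : Eucl n} {A A' : Matrix (Fin n) (Fin n) ℝ} (h : Jet l f p₀ b p A)
    (hb : b = b') (hp : p = p') (hA : A = A') : Jet l f p₀ b' p' A' := by
  subst hb hp hA; exact h

lemma Jet.add {n : ℕ} {l : Filter (SpaceTime n)} {f g : SpaceTime n → ℝ} {p₀ : SpaceTime n}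
    {b b' : ℝ} {p p' : Eucl n} {A A' : Matrix (Fin n) (Fin n) ℝ} (h : Jet l f p₀ b p A)
    (h' : Jet l g p₀ b' p' A') : Jet l (fun q => f q + g q) p₀ (b + b') (p + p') (A + A') := by
  refine ⟨h.1.add h'.1, (h.2.add h'.2).congr_left fun q => ?_⟩
  rw [qf_add, inner_add_left]; ring

lemma Jet.const_mul {n : ℕ} {l : Filter (SpaceTime n)} {f : SpaceTime n → ℝ} {p₀ : SpaceTime n}
    {b : ℝ} {p : Eucl n} {A : Matrix (Fin n) (Fin n) ℝ} (c : ℝ) (h : Jet l f p₀ b p A) :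
    Jet l (fun q => c * f q) p₀ (c * b) (c • p) (c • A) := by
  refine ⟨h.1.smul c, (h.2.const_mul_left c).congr_left fun q => ?_⟩
  rw [qf_smul, real_inner_smul_left]; ring

lemma Jet.const {n : ℕ} {l : Filter (SpaceTime n)} (p₀ : SpaceTime n) (c : ℝ) :
    Jet l (fun _ => c) p₀ 0 0 0 := by
  refine ⟨Matrix.isSymm_zero, (isLittleO_zero _ _).congr_left fun q => ?_⟩
  simp [qf_zero]

lemma Jet.poly {n : ℕ} {l : Filter (SpaceTime n)} {f : SpaceTime n → ℝ} {p₀ : SpaceTime n}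
    (hl : l ≤ 𝓝 p₀) {b : ℝ} {p : Eucl n} {A : Matrix (Fin n) (Fin n) ℝ} (c : ℝ) (hA : A.IsSymm)
    (h : ∀ q, f q = f p₀ + b * (q.2 - p₀.2) + ⟪p, q.1 - p₀.1⟫
    + 1 / 2 * qf A (q.1 - p₀.1) + c * (q.2 - p₀.2) ^ 2) : Jet l f p₀ b p A := by
  refine ⟨hA, ?_⟩
  have h1 : (fun q : SpaceTime n => c * (q.2 - p₀.2) ^ 2) =o[l] prho p₀ := by
    apply IsLittleO.const_mul_left
    have e1 : (fun q : SpaceTime n => q.2 - p₀.2) =o[l] (fun _ => (1 : ℝ)) := by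
      rw [isLittleO_one_iff]
      have : Continuous fun q : SpaceTime n => q.2 - p₀.2 := by fun_prop
      simpa using (this.tendsto p₀).mono_left hl
    have e2 : (fun q : SpaceTime n => q.2 - p₀.2) =O[l] prho p₀ := by
      refine IsBigO.of_bound 1 (Eventually.of_forall fun q => ?_)
      rw [one_mul, Real.norm_of_nonneg (prho_nonneg _ _), Real.norm_eq_abs, prho]
      nlinarith [sq_nonneg ‖q.1 - p₀.1‖]
    simpa [sq] using e1.mul_isBigO e2
  refine h1.congr_left fun q => ?_
  rw [h q]; ring

/-- The function minus its value is linear part plus O(prho) -/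
lemma Jet.bigO {n : ℕ} {l : Filter (SpaceTime n)} {f : SpaceTime n → ℝ} {p₀ : SpaceTime n}
    {b : ℝ} {p : Eucl n} {A : Matrix (Fin n) (Fin n) ℝ} (h : Jet l f p₀ b p A) :
    (fun q => f q - f p₀ - ⟪p, q.1 - p₀.1⟫) =O[l] prho p₀ := by
  have e1 : (fun q : SpaceTime n => b * (q.2 - p₀.2)) =O[l] prho p₀ := by
    apply IsBigO.const_mul_left
    refine IsBigO.of_bound 1 (Eventually.of_forall fun q => ?_)
    rw [one_mul, Real.norm_of_nonneg (prho_nonneg _ _), Real.norm_eq_abs, prho]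
    nlinarith [sq_nonneg ‖q.1 - p₀.1‖]
  have e2 : (fun q : SpaceTime n => 1 / 2 * qf A (q.1 - p₀.1)) =O[l] prho p₀ := by
    apply IsBigO.const_mul_left
    refine IsBigO.of_bound (matOpNorm A) (Eventually.of_forall fun q => ?_)
    rw [Real.norm_of_nonneg (prho_nonneg _ _), Real.norm_eq_abs, prho]
    refine (qf_bound A _).trans ?_
    have : 0 ≤ matOpNorm A := norm_nonneg _
    exact mul_le_mul_of_nonneg_left (by linarith [abs_nonneg (q.2 - p₀.2)]) this
  refine ((h.2.isBigO.add e1).add e2).congr_left fun q => ?_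
  ring

lemma inner_sub_tendsto {n : ℕ} {l : Filter (SpaceTime n)} {p₀ : SpaceTime n} (hl : l ≤ 𝓝 p₀)
    (p : Eucl n) : Tendsto (fun q : SpaceTime n => ⟪p, q.1 - p₀.1⟫) l (𝓝 0) := by
  have : Continuous fun q : SpaceTime n => ⟪p, q.1 - p₀.1⟫ := by fun_prop
  simpa using (this.tendsto p₀).mono_left hl

lemma Jet.tendsto {n : ℕ} {l : Filter (SpaceTime n)} {f : SpaceTime n → ℝ} {p₀ : SpaceTime n}
    (hl : l ≤ 𝓝 p₀)
    {b : ℝ} {p : Eucl n} {A : Matrix (Fin n) (Fin n) ℝ} (h : Jet l f p₀ b p A) :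
    Tendsto f l (𝓝 (f p₀)) := by
  have e1 := h.bigO.trans_tendsto (prho_tendsto hl)
  have := (e1.add (inner_sub_tendsto hl p)).add_const (f p₀)
  simpa using this

/-- sq of increments -/
lemma Jet.sq_incr {n : ℕ} {l : Filter (SpaceTime n)} {f : SpaceTime n → ℝ} {p₀ : SpaceTime n}
    (hl : l ≤ 𝓝 p₀) {b : ℝ} {p : Eucl n} {A : Matrix (Fin n) (Fin n) ℝ} (h : Jet l f p₀ b p A) :
    (fun q => (f q - f p₀) ^ 2 - ⟪p, q.1 - p₀.1⟫ ^ 2) =o[l] prho p₀ := by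
  have e1 := h.bigO
  have e2 : (fun q => f q - f p₀ + ⟪p, q.1 - p₀.1⟫) =o[l] (fun _ => (1 : ℝ)) := by
    rw [isLittleO_one_iff]
    have := ((h.tendsto hl).sub_const (f p₀)).add (inner_sub_tendsto hl p)
    simpa using this
  have := e1.mul_isLittleO e2
  simp only [mul_one] at this
  refine this.congr_left fun q => ?_
  ring

lemma Jet.comp {n : ℕ} {l : Filter (SpaceTime n)} {f : SpaceTime n → ℝ} {p₀ : SpaceTime n}
    (hl : l ≤ 𝓝 p₀) {b : ℝ} {p : Eucl n} {A : Matrix (Fin n) (Fin n) ℝ} (h : Jet l f p₀ b p A)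
    {F : ℝ → ℝ} {F1 F2 : ℝ}
    (hF : (fun s => F s - F (f p₀) - F1 * (s - f p₀) - 1 / 2 * F2 * (s - f p₀) ^ 2)
      =o[𝓝 (f p₀)] (fun s => (s - f p₀) ^ 2)) :
    Jet l (fun q => F (f q)) p₀ (F1 * b) (F1 • p) (F1 • A + F2 • vv p) := by
  refine ⟨(h.1.smul F1).add ((vv_symm p).smul F2), ?_⟩
  have e1 := hF.comp_tendsto (h.tendsto hl)
  have e2 : (fun q => (f q - f p₀) ^ 2) =O[l] prho p₀ := by
    have a1 := (h.sq_incr hl).isBigO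
    have a2 : (fun q : SpaceTime n => ⟪p, q.1 - p₀.1⟫ ^ 2) =O[l] prho p₀ := by
      refine IsBigO.of_bound (‖p‖ ^ 2) (Eventually.of_forall fun q => ?_)
      rw [Real.norm_of_nonneg (prho_nonneg _ _), Real.norm_of_nonneg (sq_nonneg _), prho]
      have := abs_real_inner_le_norm p (q.1 - p₀.1)
      have h3 : ⟪p, q.1 - p₀.1⟫ ^ 2 ≤ (‖p‖ * ‖q.1 - p₀.1‖) ^ 2 := by
        rw [← sq_abs]; gcongr
      rw [mul_pow] at h3
      nlinarith [abs_nonneg (q.2 - p₀.2), sq_nonneg ‖p‖, mul_nonneg (sq_nonneg ‖p‖) (abs_nonneg (q.2 - p₀.2))]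
    exact (a1.add a2).congr_left fun q => by ring
  have e3 := e1.trans_isBigO e2
  have e4 := h.2.const_mul_left F1
  have e5 := (h.sq_incr hl).const_mul_left (1 / 2 * F2)
  refine ((e3.add e4).add e5).congr_left fun q => ?_
  simp only [Function.comp, qf_add, qf_smul, qf_vv, real_inner_smul_left]
  ring

/-- second order Taylor little-o -/
lemma taylor2 {F F' : ℝ → ℝ} {s0 F2 : ℝ} (h1 : ∀ᶠ s in 𝓝 s0, HasDerivAt F (F' s) s)
    (h2 : HasDerivAt F' F2 s0) :
    (fun s => F s - F s0 - F' s0 * (s - s0) - 1 / 2 * F2 * (s - s0) ^ 2)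
      =o[𝓝 s0] (fun s => (s - s0) ^ 2) := by
  rw [isLittleO_iff]
  intro c hc
  have h2' := (hasDerivAt_iff_isLittleO.1 h2)
  rw [isLittleO_iff] at h2'
  have h3 := h1.and (h2' hc)
  rw [Metric.eventually_nhds_iff_ball] at h3
  obtain ⟨δ, hδ, h3⟩ := h3
  filter_upwards [ball_mem_nhds s0 hδ] with s hs
  let G : ℝ → ℝ := fun s => F s - F s0 - F' s0 * (s - s0) - 1 / 2 * F2 * (s - s0) ^ 2
  have hseg : segment ℝ s0 s ⊆ ball s0 δ := (convex_ball s0 δ).segment_subset (mem_ball_self hδ) hs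
  have key := (convex_segment s0 s).norm_image_sub_le_of_norm_hasDerivWithin_le (f := G)
    (f' := fun r => F' r - F' s0 - F2 * (r - s0)) (C := c * ‖s - s0‖) (x := s0) (y := s) ?_ ?_
    (left_mem_segment ℝ _ _) (right_mem_segment ℝ _ _)
  · have hG0 : G s0 = 0 := by simp [G]
    rw [hG0, sub_zero] at key
    refine key.trans (le_of_eq ?_)
    rw [norm_pow]; ring
  · intro r hr
    have hd := (h3 r (hseg hr)).1
    have : HasDerivAt G (F' r - F' s0 * 1 - 1 / 2 * F2 * (2 * (r - s0) ^ (2 - 1) * 1)) r := by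
      exact ((hd.sub_const _).sub (((hasDerivAt_id r).sub_const s0).const_mul _)).sub
        ((((hasDerivAt_id r).sub_const s0).pow 2).const_mul _)
    refine (this.congr_deriv ?_).hasDerivWithinAt
    simp; ring
  · intro r hr
    have := (h3 r (hseg hr)).2
    have e : F' r - F' s0 - F2 * (r - s0) = F' r - F' s0 - (r - s0) • F2 := by
      rw [smul_eq_mul]; ring
    rw [e]
    refine this.trans ?_
    gcongr
    rw [segment_eq_uIcc] at hr
    simpa [Real.norm_eq_abs] using abs_sub_left_of_mem_uIcc hr

lemma taylor_rpow {s0 q : ℝ} (h : 0 < s0) :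
    (fun s => s ^ q - s0 ^ q - (q * s0 ^ (q - 1)) * (s - s0)
      - 1 / 2 * (q * ((q - 1) * s0 ^ (q - 2))) * (s - s0) ^ 2)
      =o[𝓝 s0] (fun s : ℝ => (s - s0) ^ 2) := by
  have := taylor2 (F := fun s => s ^ q) (F' := fun s => q * s ^ (q - 1)) (s0 := s0)
    (F2 := q * ((q - 1) * s0 ^ (q - 2))) ?_ ?_
  · exact this
  · filter_upwards [lt_mem_nhds h] with s hs
    exact Real.hasDerivAt_rpow_const (Or.inl hs.ne')
  · have := (Real.hasDerivAt_rpow_const (x := s0) (p := q - 1) (Or.inl h.ne')).const_mul q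
    have e : q - 1 - 1 = q - 2 := by ring
    rw [e] at this
    exact this

lemma Jet.rpow {n : ℕ} {l : Filter (SpaceTime n)} {f : SpaceTime n → ℝ} {p₀ : SpaceTime n}
    (hl : l ≤ 𝓝 p₀) {b : ℝ} {p : Eucl n} {A : Matrix (Fin n) (Fin n) ℝ} (h : Jet l f p₀ b p A)
    (hf : 0 < f p₀) (q : ℝ) :
    Jet l (fun x => f x ^ q) p₀ (q * f p₀ ^ (q - 1) * b) ((q * f p₀ ^ (q - 1)) • p)
      ((q * f p₀ ^ (q - 1)) • A + (q * ((q - 1) * f p₀ ^ (q - 2))) • vv p) :=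
  h.comp hl (taylor_rpow hf)

lemma PF_le {d : ℕ} (p₀ : SpaceTime (d + 1)) : PF p₀ ≤ 𝓝 p₀ := nhdsWithin_le_nhds

/-- touching by a function with a jet -/
lemma jet_touch {d : ℕ} {lam : ℝ} {Q : ℝ → Matrix (Fin (d + 1)) (Fin (d + 1)) ℝ}
    {v : ℝ → Eucl (d + 1)} {u : SpaceTime (d + 1) → ℝ} (hu : ObliqueSub d lam Q v u)
    {p₀ : SpaceTime (d + 1)} (hp₀ : p₀ ∈ closure (Kc d 1)) {W : SpaceTime (d + 1) → ℝ} {b : ℝ}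
    {p : Eucl (d + 1)} {A : Matrix (Fin (d + 1)) (Fin (d + 1)) ℝ} (hW : Jet (PF p₀) W p₀ b p A)
    (h : ∀ᶠ q in PF p₀, u q - u p₀ ≤ W q - W p₀) :
    (p₀ ∈ Kc d 1 → lam * b ≤ (Q p₀.2 * A).trace) ∧ (p₀ ∈ Fc d 1 → b ≤ ⟪v p₀.2, p⟫) := by
  refine jet_sub hu hp₀ hW.1 fun ε hε => ?_
  filter_upwards [h, (isLittleO_iff.1 hW.2) hε] with q h1 h2
  rw [Real.norm_of_nonneg (prho_nonneg _ _), Real.norm_eq_abs, prho] at h2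
  have := (abs_le.1 h2).2
  linarith

/-- comparison -/
lemma comparison {d : ℕ} {lam : ℝ} {Q : ℝ → Matrix (Fin (d + 1)) (Fin (d + 1)) ℝ}
    {v : ℝ → Eucl (d + 1)} {u : SpaceTime (d + 1) → ℝ} (hu : ObliqueSub d lam Q v u)
    (huc : ContinuousOn u (closure (Kc d 1))) {G : Set (SpaceTime (d + 1))} (hG : IsCompact G)
    (hGs : G ⊆ closure (Kc d 1)) {W : SpaceTime (d + 1) → ℝ} (hW : ContinuousOn W G)
    (h : ∀ p₀ ∈ G, W p₀ < u p₀ → (∀ᶠ q in PF p₀, q ∈ G) ∧ (p₀ ∈ Kc d 1 ∨ p₀ ∈ Fc d 1) ∧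
      ∃ b p A, Jet (PF p₀) W p₀ b p A ∧ (p₀ ∈ Kc d 1 → (Q p₀.2 * A).trace < lam * b) ∧
        (p₀ ∈ Fc d 1 → ⟪v p₀.2, p⟫ < b)) : ∀ q ∈ G, u q ≤ W q := by
  intro q hq
  obtain ⟨p₀, hp₀, hmax⟩ := hG.exists_isMaxOn ⟨q, hq⟩ ((huc.mono hGs).sub hW)
  by_contra! hcon
  have h1 : W p₀ < u p₀ := by
    have := hmax hq
    simp only [mem_ofPred_eq, Pi.sub_apply] at this
    linarith
  obtain ⟨h2, h3, b, p, A, hJ, hK, hF⟩ := h p₀ hp₀ h1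
  have := jet_touch hu (hGs hp₀) hJ (by
    filter_upwards [h2] with r hr
    have := hmax hr
    simp only [mem_ofPred_eq, Pi.sub_apply] at this
    linarith)
  rcases h3 with h3 | h3
  · exact absurd (this.1 h3) (not_le.2 (hK h3))
  · exact absurd (this.2 h3) (not_le.2 (hF h3))

/-! ### ellipticity -/

lemma posSemidef_qf {n : ℕ} {A : Matrix (Fin n) (Fin n) ℝ} (hA : A.PosSemidef) (y : Eucl n) :
    0 ≤ qf A y := by
  have := hA.dotProduct_mulVec_nonneg y.ofLp
  have e : qf A y = star y.ofLp ⬝ᵥ A.mulVec y.ofLp := by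
    simp [qf, PiLp.inner_apply, Matrix.ofLp_toLpLin, Matrix.toLin'_apply, dotProduct]
  rw [e]; exact this

section
variable {d : ℕ} {lam Λ M C₀ : ℝ} {Q Q' : ℝ → Matrix (Fin (d + 1)) (Fin (d + 1)) ℝ}
  {v v' : ℝ → Eucl (d + 1)}

lemma qf_sub {n : ℕ} (A B : Matrix (Fin n) (Fin n) ℝ) (y : Eucl n) :
    qf (A - B) y = qf A y - qf B y := by
  simp [qf, inner_sub_left]

lemma Q_lower (D : ObliqueData d lam Λ M C₀ Q Q' v v') {t : ℝ} (ht : t ∈ Icc (-1 : ℝ) 0)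
    (y : Eucl (d + 1)) : (Λ * M ^ 2)⁻¹ * ‖y‖ ^ 2 ≤ qf (Q t) y := by
  have := posSemidef_qf (D.Qlower t ht) y
  rw [qf_sub, qf_smul, qf_one] at this
  linarith

lemma Q_upper (D : ObliqueData d lam Λ M C₀ Q Q' v v') {t : ℝ} (ht : t ∈ Icc (-1 : ℝ) 0)
    (y : Eucl (d + 1)) : qf (Q t) y ≤ (Λ * M ^ 2) * ‖y‖ ^ 2 := by
  have := posSemidef_qf (D.Qupper t ht) y
  rw [qf_sub, qf_smul, qf_one] at this
  linarith

lemma diag_qf {n : ℕ} (A : Matrix (Fin n) (Fin n) ℝ) (i : Fin n) :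
    A i i = qf A (EuclideanSpace.single i 1) := by
  simp [qf, EuclideanSpace.inner_single_right, Matrix.ofLp_toLpLin, Matrix.toLin'_apply]

lemma Q_trace (D : ObliqueData d lam Λ M C₀ Q Q' v v') {t : ℝ} (ht : t ∈ Icc (-1 : ℝ) 0) :
    (Q t).trace ≤ (Λ * M ^ 2) * (d + 1) := by
  have : ∀ i, Q t i i ≤ Λ * M ^ 2 := fun i => by
    have := Q_upper D ht (EuclideanSpace.single i 1)
    rw [← diag_qf] at this
    simpa using this
  calc (Q t).trace = ∑ i, Q t i i := rfl
    _ ≤ ∑ _i : Fin (d + 1), Λ * M ^ 2 := Finset.sum_le_sum fun i _ => this i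
    _ = _ := by simp; ring

lemma kap_ge_one (D : ObliqueData d lam Λ M C₀ Q Q' v v') : 1 ≤ Λ * M ^ 2 := by
  have h1 := D.Lam_ge_one
  have h2 := D.M_ge_one
  nlinarith

lemma mem_time {p : SpaceTime (d + 1)} (hp : p ∈ closure (Kc d 1)) : p.2 ∈ Icc (-1 : ℝ) 0 :=
  ⟨(mem_closure_Kc.1 hp).2.2.1, (mem_closure_Kc.1 hp).2.2.2⟩

lemma jet_time {l : Filter (SpaceTime (d + 1))} {p₀ : SpaceTime (d + 1)} (hl : l ≤ 𝓝 p₀)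
    (c s : ℝ) : Jet l (fun q => c * (q.2 - s)) p₀ c 0 0 :=
  Jet.poly hl 0 Matrix.isSymm_zero fun q => by simp [qf_zero]; ring

lemma Q_trace_nonneg (D : ObliqueData d lam Λ M C₀ Q Q' v v') {t : ℝ} (ht : t ∈ Icc (-1 : ℝ) 0) :
    0 < (Q t).trace := by
  have : ∀ i, 0 < Q t i i := fun i => by
    have := Q_lower D ht (EuclideanSpace.single i 1)
    rw [← diag_qf] at this
    have hk : 0 < (Λ * M ^ 2)⁻¹ := inv_pos.2 (by linarith [kap_ge_one D])
    simp only [EuclideanSpace.norm_single, norm_one, one_pow, mul_one] at this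
    linarith
  exact Finset.sum_pos (fun i _ => this i) Finset.univ_nonempty

/-- maximum principle -/
lemma max_principle (D : ObliqueData d lam Λ M C₀ Q Q' v v') {u : SpaceTime (d + 1) → ℝ}
    (hu : ObliqueSub d lam Q v u)
    (huc : ContinuousOn u (closure (Kc d 1))) {N : ℝ} (hb : ∀ X ∈ bdryK d, u X ≤ N) :
    ∀ X ∈ closure (Kc d 1), u X ≤ N := by
  intro X hX
  refine le_of_forall_pos_le_add fun ε hε => ?_
  have hl := D.lam_pos
  have key := comparison hu huc (isCompact_closure_Kc d) subset_rfl
    (W := fun q => N + ε * (q.2 - (-1))) (by fun_prop) ?_ X hX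
  · have h1 := (mem_time hX).2
    have : ε * (X.2 - (-1)) ≤ ε * 1 := by gcongr; linarith
    linarith
  · intro p₀ hp₀ hlt
    refine ⟨eventually_nhdsWithin_of_forall fun q hq => hq.1, ?_, ε, 0, 0,
      ((Jet.const _ N).add (jet_time (PF_le p₀) ε (-1))).congr (by ring) (by simp) (by simp), ?_, ?_⟩
    · rcases trichotomy hp₀ with h | h
      · exfalso
        have := hb p₀ (mem_bdryK hp₀ h)
        have h1 := (mem_time hp₀).1
        have : 0 ≤ ε * (p₀.2 - (-1)) := mul_nonneg hε.le (by linarith)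
        linarith
      · exact h
    · intro _; simp; positivity
    · intro _; simpa using hε

end
end GH

noncomputable section GH

lemma Jet.mul_time {n : ℕ} {l : Filter (SpaceTime n)} {f : SpaceTime n → ℝ} {p₀ : SpaceTime n}
    (hl : l ≤ 𝓝 p₀) {b : ℝ} {p : Eucl n} {A : Matrix (Fin n) (Fin n) ℝ} (h : Jet l f p₀ b p A)
    {g : ℝ → ℝ} {g' : ℝ} (hg : HasDerivAt g g' p₀.2) :
    Jet l (fun q => f q * g q.2) p₀ (f p₀ * g' + b * g p₀.2) (g p₀.2 • p) (g p₀.2 • A) := by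
  refine ⟨h.1.smul _, ?_⟩
  have ht : Tendsto (fun q : SpaceTime n => q.2) l (𝓝 p₀.2) :=
    (continuous_snd.tendsto p₀).mono_left hl
  have e0 : (fun q : SpaceTime n => q.2 - p₀.2) =O[l] prho p₀ := by
    refine IsBigO.of_bound 1 (Eventually.of_forall fun q => ?_)
    rw [one_mul, Real.norm_of_nonneg (prho_nonneg _ _), Real.norm_eq_abs, prho]
    nlinarith [sq_nonneg ‖q.1 - p₀.1‖]
  have e1 := ((hasDerivAt_iff_isLittleO.1 hg).comp_tendsto ht).trans_isBigO e0
  have e2 : (fun q : SpaceTime n => g q.2 - g p₀.2) =O[l] prho p₀ :=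
    (hg.isBigO_sub.comp_tendsto ht).trans e0
  have e3 : (fun q : SpaceTime n => f q - f p₀) =o[l] (fun _ => (1 : ℝ)) := by
    rw [isLittleO_one_iff]
    simpa using (h.tendsto hl).sub_const (f p₀)
  have e4 := e3.mul_isBigO e2
  simp only [one_mul] at e4
  refine (((h.2.const_mul_left (g p₀.2)).add (e1.const_mul_left (f p₀))).add e4).congr_left
    fun q => ?_
  simp only [Function.comp, smul_eq_mul, qf_smul, real_inner_smul_left]
  ring

lemma Jet.shift {n : ℕ} {f : SpaceTime n → ℝ} {p₀ c : SpaceTime n}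
    {b : ℝ} {p : Eucl n} {A : Matrix (Fin n) (Fin n) ℝ} (h : Jet (𝓝 (p₀ - c)) f (p₀ - c) b p A) :
    Jet (𝓝 p₀) (fun q => f (q - c)) p₀ b p A := by
  refine ⟨h.1, ?_⟩
  have ht : Tendsto (fun q : SpaceTime n => q - c) (𝓝 p₀) (𝓝 (p₀ - c)) :=
    (by fun_prop : Continuous fun q : SpaceTime n => q - c).tendsto p₀
  have := h.2.comp_tendsto ht
  refine (this.congr_left fun q => ?_).congr_right fun q => ?_
  · simp
  · simp [prho]

lemma Jet.mono {n : ℕ} {l l' : Filter (SpaceTime n)} {f : SpaceTime n → ℝ} {p₀ : SpaceTime n}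
    {b : ℝ} {p : Eucl n} {A : Matrix (Fin n) (Fin n) ℝ} (h : Jet l f p₀ b p A) (hl : l' ≤ l) :
    Jet l' f p₀ b p A := ⟨h.1, h.2.mono hl⟩

/-- bounded classical solution on the whole space -/
def Sol {n : ℕ} (lam : ℝ) (Qf : ℝ → Matrix (Fin n) (Fin n) ℝ) (f : SpaceTime n → ℝ) : Prop :=
  Continuous f ∧ (∃ C, ∀ x t, 0 ≤ t → |f (x, t)| ≤ C) ∧
    ∀ p₀, ∃ b p A, Jet (𝓝 p₀) f p₀ b p A ∧ lam * b = (Qf p₀.2 * A).trace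

lemma Sol.add {n : ℕ} {lam : ℝ} {Qf : ℝ → Matrix (Fin n) (Fin n) ℝ} {f g : SpaceTime n → ℝ}
    (hf : Sol lam Qf f) (hg : Sol lam Qf g) : Sol lam Qf (fun q => f q + g q) := by
  obtain ⟨h1, ⟨C, hC⟩, h2⟩ := hf
  obtain ⟨g1, ⟨C', hC'⟩, g2⟩ := hg
  refine ⟨h1.add g1, ⟨C + C', fun x t ht => (abs_add_le _ _).trans (add_le_add (hC x t ht) (hC' x t ht))⟩, ?_⟩
  intro p₀
  obtain ⟨b, p, A, hJ, e⟩ := h2 p₀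
  obtain ⟨b', p', A', hJ', e'⟩ := g2 p₀
  exact ⟨_, _, _, hJ.add hJ', by rw [mul_add, mul_add, Matrix.trace_add, e, e']⟩

lemma Sol.zero {n : ℕ} (lam : ℝ) (Qf : ℝ → Matrix (Fin n) (Fin n) ℝ) :
    Sol lam Qf (fun _ => (0 : ℝ)) :=
  ⟨continuous_const, ⟨0, by simp⟩, fun p₀ => ⟨0, 0, 0, Jet.const p₀ 0, by simp⟩⟩

lemma Sol.wave {n : ℕ} {lam : ℝ} (hlam : 0 < lam) {Qf : ℝ → Matrix (Fin n) (Fin n) ℝ}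
    (hQc : ∀ ξ : Eucl n, Continuous fun t => qf (Qf t) ξ) (hQ0 : ∀ t ξ, 0 ≤ qf (Qf t) ξ)
    (ξ : Eucl n) (a c : ℝ) :
    Sol lam Qf (fun q => (a * Real.cos ⟪ξ, q.1⟫ + c * Real.sin ⟪ξ, q.1⟫) *
      Real.exp (-(lam⁻¹ * ∫ s in (0 : ℝ)..q.2, qf (Qf s) ξ))) := by
  have hI : ∀ t, HasDerivAt (fun t => ∫ s in (0 : ℝ)..t, qf (Qf s) ξ) (qf (Qf t) ξ) t := fun t =>
    (hQc ξ).integral_hasStrictDerivAt 0 t |>.hasDerivAt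
  have hIc : Continuous (fun t => ∫ s in (0 : ℝ)..t, qf (Qf s) ξ) :=
    continuous_iff_continuousAt.2 fun t => (hI t).continuousAt
  refine ⟨?_, ⟨|a| + |c|, ?_⟩, ?_⟩
  · have := hIc.comp (continuous_snd : Continuous (Prod.snd : SpaceTime n → ℝ))
    simp only [Function.comp_def] at this
    fun_prop
  · intro x t ht
    rw [abs_mul, abs_of_pos (Real.exp_pos _)]
    have h1 : Real.exp (-(lam⁻¹ * ∫ s in (0 : ℝ)..t, qf (Qf s) ξ)) ≤ 1 := by
      rw [Real.exp_le_one_iff]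
      have : 0 ≤ ∫ s in (0 : ℝ)..t, qf (Qf s) ξ :=
        intervalIntegral.integral_nonneg ht fun s _ => hQ0 s ξ
      have : 0 ≤ lam⁻¹ * ∫ s in (0 : ℝ)..t, qf (Qf s) ξ := by positivity
      linarith
    have h2 : |a * Real.cos ⟪ξ, x⟫ + c * Real.sin ⟪ξ, x⟫| ≤ |a| + |c| := by
      refine (abs_add_le _ _).trans ?_
      rw [abs_mul, abs_mul]
      have := Real.abs_cos_le_one ⟪ξ, x⟫
      have := Real.abs_sin_le_one ⟪ξ, x⟫
      gcongr <;> nlinarith [abs_nonneg a, abs_nonneg c]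
    calc _ ≤ (|a| + |c|) * 1 := by gcongr
      _ = _ := mul_one _
  · intro p₀
    have j1 : Jet (𝓝 p₀) (fun q : SpaceTime n => ⟪ξ, q.1⟫) p₀ 0 ξ 0 :=
      Jet.poly le_rfl 0 Matrix.isSymm_zero fun q => by simp [qf_zero, inner_sub_right]
    have j2 := j1.comp le_rfl (F := fun s => a * Real.cos s + c * Real.sin s)
      (taylor2 (F := fun s => a * Real.cos s + c * Real.sin s)
        (F' := fun s => a * (- Real.sin s) + c * Real.cos s)
        (F2 := a * (- Real.cos ⟪ξ, p₀.1⟫) + c * (- Real.sin ⟪ξ, p₀.1⟫))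
        (Eventually.of_forall fun s => ((Real.hasDerivAt_cos s).const_mul a).add
          ((Real.hasDerivAt_sin s).const_mul c))
        (((Real.hasDerivAt_sin _).neg.const_mul a).add ((Real.hasDerivAt_cos _).const_mul c)))
    have hE : HasDerivAt (fun t => Real.exp (-(lam⁻¹ * ∫ s in (0 : ℝ)..t, qf (Qf s) ξ)))
      (Real.exp (-(lam⁻¹ * ∫ s in (0 : ℝ)..p₀.2, qf (Qf s) ξ)) * (-(lam⁻¹ * qf (Qf p₀.2) ξ))) p₀.2 :=
      (((hI p₀.2).const_mul lam⁻¹).neg).exp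
    refine ⟨_, _, _, j2.mul_time le_rfl hE, ?_⟩
    simp only [smul_zero, zero_add, Matrix.mul_smul, Matrix.trace_smul, trace_mul_vv, smul_eq_mul]
    field_simp
    ring

/-- scaled torus map -/
def torMap {n : ℕ} (R : ℝ) (x : Eucl n) : UnitAddTorus (Fin n) :=
  fun i => ((x i / (4 * R) : ℝ) : UnitAddCircle)

lemma torMap_continuous {n : ℕ} (R : ℝ) : Continuous (torMap R : Eucl n → _) := by
  refine continuous_pi fun i => ?_
  exact (AddCircle.continuous_mk' 1).comp (by fun_prop)

lemma torMap_inj {n : ℕ} {R : ℝ} (hR : 0 < R) :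
    Function.Injective (fun x : closedBall (0 : Eucl n) R => torMap R x.1) := by
  rintro ⟨x, hx⟩ ⟨y, hy⟩ hxy
  rw [mem_closedBall_zero_iff] at hx hy
  have hm : ∀ z : Eucl n, ‖z‖ ≤ R → ∀ i, z i / (4 * R) ∈ Ico (-1 / 2 : ℝ) (-1 / 2 + 1) := by
    intro z hz i
    have := (PiLp.norm_apply_le z i).trans hz
    rw [Real.norm_eq_abs, abs_le] at this
    constructor
    · rw [le_div_iff₀ (by positivity)]; linarith
    · rw [div_lt_iff₀ (by positivity)]; linarith
  ext i
  have h1 := congrFun hxy i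
  simp only [torMap] at h1
  have hp : Fact ((0 : ℝ) < 1) := ⟨one_pos⟩
  have := (AddCircle.coe_eq_coe_iff_of_mem_Ico (p := (1 : ℝ)) (a := -1 / 2) (hm x hx i) (hm y hy i)).1 h1
  field_simp at this
  exact this

lemma exists_sol_trig {n : ℕ} {lam : ℝ} (hlam : 0 < lam) {Qf : ℝ → Matrix (Fin n) (Fin n) ℝ}
    (hQc : ∀ ξ : Eucl n, Continuous fun t => qf (Qf t) ξ) (hQ0 : ∀ t ξ, 0 ≤ qf (Qf t) ξ)
    (R : ℝ) (P : C(UnitAddTorus (Fin n), ℂ))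
    (hP : P ∈ Submodule.span ℂ (range (UnitAddTorus.mFourier (d := Fin n)))) :
    ∀ c : ℂ, ∃ f, Sol lam Qf f ∧ ∀ x, f (x, 0) = (c * P (torMap R x)).re := by
  induction hP using Submodule.span_induction with
  | mem P hP =>
    obtain ⟨k, rfl⟩ := hP
    intro c
    let ξ : Eucl n := WithLp.toLp 2 fun i => 2 * Real.pi * k i / (4 * R)
    refine ⟨_, Sol.wave hlam hQc hQ0 ξ c.re (-c.im), fun x => ?_⟩
    have e1 : UnitAddTorus.mFourier k (torMap R x) = Complex.exp ((⟪ξ, x⟫ : ℝ) * Complex.I) := by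
      simp only [UnitAddTorus.mFourier, ContinuousMap.coe_mk, torMap, fourier_coe_apply]
      rw [← Complex.exp_sum]
      congr 1
      simp only [PiLp.inner_apply, ξ]
      push_cast
      rw [Finset.sum_mul]
      refine Finset.sum_congr rfl fun i _ => ?_
      simp
      ring
    rw [e1, Complex.mul_re, Complex.exp_ofReal_mul_I_re, Complex.exp_ofReal_mul_I_im]
    simp
    ring
  | zero => exact fun c => ⟨_, Sol.zero lam Qf, by simp⟩
  | add P P' _ _ h h' =>
    intro c
    obtain ⟨f, hf, e⟩ := h c
    obtain ⟨f', hf', e'⟩ := h' c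
    exact ⟨_, hf.add hf', fun x => by simp [e, e', mul_add]⟩
  | smul a P _ h =>
    intro c
    obtain ⟨f, hf, e⟩ := h (c * a)
    exact ⟨f, hf, fun x => by rw [e]; simp [mul_assoc]⟩

lemma exists_sol {n : ℕ} {lam : ℝ} (hlam : 0 < lam) {Qf : ℝ → Matrix (Fin n) (Fin n) ℝ}
    (hQc : ∀ ξ : Eucl n, Continuous fun t => qf (Qf t) ξ) (hQ0 : ∀ t ξ, 0 ≤ qf (Qf t) ξ)
    {R : ℝ} (hR : 0 < R) {g : Eucl n → ℝ} (hg : ContinuousOn g (closedBall 0 R)) {M0 : ℝ}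
    (hM0 : ∀ x ∈ closedBall (0 : Eucl n) R, |g x| ≤ M0) {ε : ℝ} (hε : 0 < ε) :
    ∃ f, Sol lam Qf f ∧ (∀ x, |f (x, 0)| ≤ M0 + ε) ∧
      ∀ x ∈ closedBall (0 : Eucl n) R, |f (x, 0) - g x| ≤ ε := by
  have : CompactSpace (closedBall (0 : Eucl n) R) := isCompact_iff_compactSpace.1 (isCompact_closedBall _ _)
  have hemb : IsClosedEmbedding (fun x : closedBall (0 : Eucl n) R => torMap R x.1) :=
    ((torMap_continuous R).comp continuous_subtype_val).isClosedEmbedding (torMap_inj hR)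
  have hM : 0 ≤ M0 := (abs_nonneg _).trans (hM0 0 (mem_closedBall_self hR.le))
  let g0 : C(closedBall (0 : Eucl n) R, ℝ) := ⟨_, hg.domRestrict⟩
  obtain ⟨F, hF, hFe⟩ := BoundedContinuousFunction.exists_extension_forall_mem_Icc_of_isClosedEmbedding
    (BoundedContinuousFunction.mkOfCompact g0) (a := -M0) (b := M0)
    (fun x => abs_le.1 (hM0 x.1 x.2)) (by linarith) hemb
  let Fc : C(UnitAddTorus (Fin n), ℂ) := ⟨fun z => (F z : ℂ), by fun_prop⟩
  have hd : Fc ∈ closure ((Submodule.span ℂ (range (UnitAddTorus.mFourier (d := Fin n)))) :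
      Set C(UnitAddTorus (Fin n), ℂ)) := by
    rw [← Submodule.topologicalClosure_coe, UnitAddTorus.span_mFourier_closure_eq_top]
    trivial
  obtain ⟨P, hP, hPd⟩ := Metric.mem_closure_iff.1 hd ε hε
  obtain ⟨f, hf, e⟩ := exists_sol_trig hlam hQc hQ0 R P hP 1
  have key : ∀ x, |f (x, 0) - F (torMap R x)| ≤ ε := by
    intro x
    rw [e, one_mul]
    have h1 : (P (torMap R x)).re - F (torMap R x) = (P (torMap R x) - Fc (torMap R x)).re := by
      simp [Fc]
    rw [h1]
    refine (Complex.abs_re_le_norm _).trans ?_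
    rw [← dist_eq_norm, dist_comm]
    exact (ContinuousMap.dist_apply_le_dist _).trans hPd.le
  refine ⟨f, hf, fun x => ?_, fun x hx => ?_⟩
  · have h1 := abs_le.1 (key x)
    have h2 := hF (torMap R x)
    rw [abs_le]
    constructor <;> linarith [h2.1, h2.2]
  · have h2 := congrFun hFe ⟨x, hx⟩
    have h3 := key x
    simp only [Function.comp] at h2
    rw [h2] at h3
    exact h3

end GH

noncomputable section GH

lemma qf_wsmul {n : ℕ} (A : Matrix (Fin n) (Fin n) ℝ) (s : ℝ) (y : Eucl n) :
    qf A (s • y) = s ^ 2 * qf A y := by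
  simp [qf, real_inner_smul_left, real_inner_smul_right]; ring

lemma Jet.second_diff {n : ℕ} {f : SpaceTime n → ℝ} {x : Eucl n} {t : ℝ}
    {b : ℝ} {p : Eucl n} {A : Matrix (Fin n) (Fin n) ℝ} (h : Jet (𝓝 (x, t)) f (x, t) b p A)
    (w : Eucl n) :
    Tendsto (fun s : ℝ => (f (x + s • w, t) + f (x - s • w, t) - 2 * f (x, t)) / s ^ 2) (𝓝[>] 0)
      (𝓝 (qf A w)) := by
  have t1 : Tendsto (fun s : ℝ => ((x + s • w, t) : SpaceTime n)) (𝓝[>] 0) (𝓝 (x, t)) := by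
    have : Continuous (fun s : ℝ => ((x + s • w, t) : SpaceTime n)) := by fun_prop
    simpa using (this.tendsto 0).mono_left nhdsWithin_le_nhds
  have t2 : Tendsto (fun s : ℝ => ((x - s • w, t) : SpaceTime n)) (𝓝[>] 0) (𝓝 (x, t)) := by
    have : Continuous (fun s : ℝ => ((x - s • w, t) : SpaceTime n)) := by fun_prop
    simpa using (this.tendsto 0).mono_left nhdsWithin_le_nhds
  have hO : ∀ c : ℝ, c = 1 ∨ c = -1 → (fun s : ℝ => prho (x, t) (x + c • s • w, t)) =O[𝓝[>] 0] (fun s : ℝ => s ^ 2) := by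
    intro c hc
    refine IsBigO.of_bound (‖w‖ ^ 2) (Eventually.of_forall fun s => ?_)
    rcases hc with rfl | rfl <;>
    · simp [prho, norm_smul, mul_pow]
      rw [mul_comm]
  have e1 := (h.2.comp_tendsto t1).trans_isBigO (by simpa [Function.comp_def] using hO 1 (Or.inl rfl))
  have e2 := (h.2.comp_tendsto t2).trans_isBigO (show ((prho (x, t)) ∘ fun s : ℝ => ((x - s • w, t) : SpaceTime n)) =O[𝓝[>] 0] (fun s : ℝ => s ^ 2) by
    have := hO (-1) (Or.inr rfl)
    simp only [Function.comp_def, sub_eq_add_neg]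
    simpa using this)
  have e3 := (e1.add e2).tendsto_div_nhds_zero
  have e4 := e3.add_const (qf A w)
  rw [zero_add] at e4
  refine e4.congr' ?_
  filter_upwards [self_mem_nhdsWithin] with s hs
  have hs : (s : ℝ) ≠ 0 := (ne_of_gt hs)
  have q1 : qf A (-(s • w)) = s ^ 2 * qf A w := by
    rw [← neg_smul, qf_wsmul]; ring
  simp only [Function.comp, add_sub_cancel_left, sub_self, mul_zero, qf_wsmul, sub_sub_cancel_left,
    q1, inner_neg_right]
  field_simp
  ring

lemma Jet.time_diff {n : ℕ} {f : SpaceTime n → ℝ} {x : Eucl n} {t : ℝ}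
    {b : ℝ} {p : Eucl n} {A : Matrix (Fin n) (Fin n) ℝ} (h : Jet (𝓝 (x, t)) f (x, t) b p A) :
    Tendsto (fun s : ℝ => (f (x, t) - f (x, t - s)) / s) (𝓝[>] 0) (𝓝 b) := by
  have t1 : Tendsto (fun s : ℝ => ((x, t - s) : SpaceTime n)) (𝓝[>] 0) (𝓝 (x, t)) := by
    have : Continuous (fun s : ℝ => ((x, t - s) : SpaceTime n)) := by fun_prop
    simpa using (this.tendsto 0).mono_left nhdsWithin_le_nhds
  have hO : (fun s : ℝ => prho (x, t) (x, t - s)) =O[𝓝[>] 0] (fun s : ℝ => s) := by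
    refine IsBigO.of_bound 1 (Eventually.of_forall fun s => ?_)
    simp [prho]
  have e1 := ((h.2.comp_tendsto t1).trans_isBigO hO).tendsto_div_nhds_zero
  have e4 := e1.neg.add_const b
  rw [neg_zero, zero_add] at e4
  refine e4.congr' ?_
  filter_upwards [self_mem_nhdsWithin] with s hs
  have hs : (s : ℝ) ≠ 0 := (ne_of_gt hs)
  have q0 : qf A (0 : Eucl n) = 0 := by simp [qf]
  simp only [Function.comp, sub_self, q0, inner_zero_right, mul_zero, sub_zero]
  field_simp
  ring

/-- quartic barrier -/
def ell {n : ℕ} (a b : ℝ) (ξ : Eucl n) (r : ℝ) : ℝ := ‖ξ‖ ^ 4 + a * r * ‖ξ‖ ^ 2 + b * r ^ 2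

lemma ell_second {n : ℕ} {a b : ℝ} (ξ w : Eucl n) (r s : ℝ) :
    ell a b (ξ + s • w) r + ell a b (ξ - s • w) r - 2 * ell a b ξ r ≤
      s ^ 2 * (12 * ‖ξ‖ ^ 2 * ‖w‖ ^ 2 + 2 * a * r * ‖w‖ ^ 2) + 2 * s ^ 4 * ‖w‖ ^ 4 := by
  have h1 : ‖ξ + s • w‖ ^ 2 = ‖ξ‖ ^ 2 + 2 * s * ⟪ξ, w⟫ + s ^ 2 * ‖w‖ ^ 2 := by
    rw [norm_add_sq_real, real_inner_smul_right, norm_smul, mul_pow, Real.norm_eq_abs, sq_abs]; ring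
  have h2 : ‖ξ - s • w‖ ^ 2 = ‖ξ‖ ^ 2 - 2 * s * ⟪ξ, w⟫ + s ^ 2 * ‖w‖ ^ 2 := by
    rw [norm_sub_sq_real, real_inner_smul_right, norm_smul, mul_pow, Real.norm_eq_abs, sq_abs]; ring
  have h3 : ∀ z : Eucl n, ‖z‖ ^ 4 = (‖z‖ ^ 2) ^ 2 := fun z => by ring
  have h4 : ⟪ξ, w⟫ ^ 2 ≤ ‖ξ‖ ^ 2 * ‖w‖ ^ 2 := by
    rw [← mul_pow, ← sq_abs]
    exact pow_le_pow_left₀ (abs_nonneg _) (abs_real_inner_le_norm ξ w) 2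
  unfold ell
  rw [h3, h3 (ξ - s • w), h1, h2]
  nlinarith [mul_le_mul_of_nonneg_left h4 (sq_nonneg s)]

lemma ell_nonneg {n : ℕ} {a b : ℝ} (ha : 0 ≤ a) (hb : 0 ≤ b) (ξ : Eucl n) {r : ℝ} (hr : 0 ≤ r) :
    ‖ξ‖ ^ 4 ≤ ell a b ξ r := by
  unfold ell
  have : 0 ≤ a * r * ‖ξ‖ ^ 2 := by positivity
  have : 0 ≤ b * r ^ 2 := by positivity
  linarith

lemma trace_sum_vv {n N : ℕ} (A : Matrix (Fin n) (Fin n) ℝ) (b : Fin N → Eucl n) :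
    ((∑ j, vv (b j)) * A).trace = ∑ j, qf A (b j) := by
  rw [Matrix.trace_mul_comm, Matrix.mul_sum, Matrix.trace_sum]
  exact Finset.sum_congr rfl fun j _ => trace_mul_vv A (b j)

lemma trace_sum_vv_one {n N : ℕ} (b : Fin N → Eucl n) :
    (∑ j, vv (b j)).trace = ∑ j, ‖b j‖ ^ 2 := by
  have := trace_sum_vv 1 b
  rw [mul_one] at this
  rw [this]
  exact Finset.sum_congr rfl fun j _ => qf_one _

lemma mpPsi {n : ℕ} {lam : ℝ} {Q1 Q2 : ℝ → Matrix (Fin n) (Fin n) ℝ} {f g : SpaceTime n → ℝ}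
    (hlam : 0 < lam) (hf : Sol lam Q1 f) (hg : Sol lam Q2 g) {τ ρ T a b G K Lq c : ℝ} {p : Eucl n}
    (hfac : ∀ r ∈ Icc 0 τ, ∃ (N : ℕ) (w w' : Fin N → Eucl n), Q1 r = ∑ j, vv (w j) ∧
      Q2 r = ∑ j, vv (w' j) ∧ ∑ j, ‖w j - w' j‖ ^ 2 ≤ ρ ∧ ∑ j, ‖w j‖ ^ 2 ≤ T ∧ ∑ j, ‖w' j‖ ^ 2 ≤ T)
    (hG : 0 ≤ G) (hLq : 0 < Lq) (ha : 0 ≤ a) (hb : 0 ≤ b) (hK : 2 * G * ρ < lam * K)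
    (hK0 : 0 ≤ K)
    (h1 : 12 * T ≤ lam * a) (h2 : a * T ≤ lam * b)
    (h0 : ∀ ξ ζ, f (ξ, 0) + g (ζ, 0) ≤ c + ⟪p, ξ - ζ⟫ + G * ‖ξ - ζ‖ ^ 2
      + Lq * (ell a b ξ 0 + ell a b ζ 0)) :
    ∀ ξ ζ, ∀ r ∈ Icc 0 τ, f (ξ, r) + g (ζ, r) ≤ c + ⟪p, ξ - ζ⟫ + G * ‖ξ - ζ‖ ^ 2 + K * r
      + Lq * (ell a b ξ r + ell a b ζ r) := by
  let Ψ : Eucl n × Eucl n × ℝ → ℝ := fun z => c + ⟪p, z.1 - z.2.1⟫ + G * ‖z.1 - z.2.1‖ ^ 2 + K * z.2.2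
      + Lq * (ell a b z.1 z.2.2 + ell a b z.2.1 z.2.2)
  let H : Eucl n × Eucl n × ℝ → ℝ := fun z => f (z.1, z.2.2) + g (z.2.1, z.2.2) - Ψ z
  have hfc := hf.1
  have hgc := hg.1
  have hH : Continuous H := by
    simp only [H, Ψ, ell]
    fun_prop
  obtain ⟨Cf, hCf⟩ := hf.2.1
  obtain ⟨Cg, hCg⟩ := hg.2.1
  -- coercivity
  obtain ⟨R, hR⟩ : ∃ R : ℝ, ∀ ξ ζ r, r ∈ Icc 0 τ → (R < ‖ξ‖ ∨ R < ‖ζ‖) → H (ξ, ζ, r) ≤ 0 := by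
    let B := Cf + Cg - c
    have hnn : ∀ x : ℝ, 0 ≤ x → ‖p‖ * x ≤ Lq / 2 * x ^ 4 + (‖p‖ + ‖p‖ ^ 2 / Lq + 1) := by
      intro x hx
      have i1 : x ≤ 1 + x ^ 2 := by nlinarith [sq_nonneg (x - 1)]
      have i2 : ‖p‖ * x ^ 2 ≤ Lq / 2 * x ^ 4 + ‖p‖ ^ 2 / Lq := by
        have : 0 ≤ (Lq * x ^ 2 - ‖p‖) ^ 2 / (2 * Lq) := by positivity
        have e : (Lq * x ^ 2 - ‖p‖) ^ 2 / (2 * Lq) = Lq / 2 * x ^ 4 - ‖p‖ * x ^ 2 + ‖p‖ ^ 2 / Lq / 2 := by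
          field_simp
          ring
        have : 0 ≤ ‖p‖ ^ 2 / Lq := by positivity
        linarith
      nlinarith [norm_nonneg p, mul_le_mul_of_nonneg_left i1 (norm_nonneg p)]
    let B2 := |B| + 2 * (‖p‖ + ‖p‖ ^ 2 / Lq + 1)
    have hB2 : 0 ≤ B2 := by positivity
    refine ⟨1 + 2 * B2 / Lq, fun ξ ζ r hr hx => ?_⟩
    have i1 := (abs_le.1 (hCf ξ r hr.1)).2
    have i2 := (abs_le.1 (hCg ζ r hr.1)).2
    have i3 := ell_nonneg ha hb ξ hr.1
    have i4 := ell_nonneg ha hb ζ hr.1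
    have i5 : -(‖p‖ * ‖ξ‖ + ‖p‖ * ‖ζ‖) ≤ ⟪p, ξ - ζ⟫ := by
      have := (abs_le.1 (abs_real_inner_le_norm p (ξ - ζ))).1
      have : ‖p‖ * ‖ξ - ζ‖ ≤ ‖p‖ * (‖ξ‖ + ‖ζ‖) := by gcongr; exact norm_sub_le _ _
      linarith
    have i6 := hnn ‖ξ‖ (norm_nonneg _)
    have i7 := hnn ‖ζ‖ (norm_nonneg _)
    have i8 : 0 ≤ G * ‖ξ - ζ‖ ^ 2 := by positivity
    have i9 : 0 ≤ K * r := mul_nonneg hK0 hr.1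
    have big : ∀ x : ℝ, 1 + 2 * B2 / Lq < x → B2 ≤ Lq / 2 * x ^ 4 := by
      intro x hx
      have q0 : 0 ≤ 2 * B2 / Lq := by positivity
      have q1 : 1 ≤ x := by linarith
      have q2 : x ≤ x ^ 4 := le_self_pow₀ q1 (by norm_num)
      have q3 : 2 * B2 / Lq ≤ x ^ 4 := by linarith
      rw [div_le_iff₀ hLq] at q3
      linarith
    have i10 : B2 ≤ Lq / 2 * ‖ξ‖ ^ 4 + Lq / 2 * ‖ζ‖ ^ 4 := by
      have z1 : 0 ≤ Lq / 2 * ‖ξ‖ ^ 4 := by positivity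
      have z2 : 0 ≤ Lq / 2 * ‖ζ‖ ^ 4 := by positivity
      rcases hx with hx | hx
      · linarith [big _ hx]
      · linarith [big _ hx]
    have i11 : B ≤ |B| := le_abs_self _
    have i12 := mul_le_mul_of_nonneg_left i3 hLq.le
    have i13 := mul_le_mul_of_nonneg_left i4 hLq.le
    simp only [H, Ψ]
    simp only [B, B2] at *
    linarith
  intro ξ ζ r hr
  by_contra! hcon
  have hpos : 0 < H (ξ, ζ, r) := by simp only [H, Ψ]; linarith
  let S : Set (Eucl n × Eucl n × ℝ) := closedBall 0 R ×ˢ closedBall 0 R ×ˢ Icc 0 τ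
  have hS : IsCompact S := (isCompact_closedBall _ _).prod ((isCompact_closedBall _ _).prod isCompact_Icc)
  have hmem : ∀ z : Eucl n × Eucl n × ℝ, z.2.2 ∈ Icc 0 τ → 0 < H z → z ∈ S := by
    rintro ⟨x, y, s⟩ hs hz
    refine ⟨?_, ?_, hs⟩
    · rw [mem_closedBall_zero_iff]; by_contra! h
      exact absurd (hR x y s hs (Or.inl h)) (not_le.2 hz)
    · rw [mem_closedBall_zero_iff]; by_contra! h
      exact absurd (hR x y s hs (Or.inr h)) (not_le.2 hz)
  obtain ⟨⟨x, y, s⟩, hzS, hmax⟩ := hS.exists_isMaxOn ⟨_, hmem _ hr hpos⟩ hH.continuousOn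
  have hz0 : 0 < H (x, y, s) := hpos.trans_le (hmax (hmem _ hr hpos))
  have hglob : ∀ x' y' s', s' ∈ Icc 0 τ → H (x', y', s') ≤ H (x, y, s) := by
    intro x' y' s' hs'
    by_cases h : 0 < H (x', y', s')
    · exact hmax (hmem _ hs' h)
    · linarith
  have hs : s ∈ Icc 0 τ := hzS.2.2
  have hs0 : 0 < s := by
    rcases eq_or_lt_of_le hs.1 with h | h
    · exfalso
      have := h0 x y
      simp only [H, Ψ] at hz0
      rw [← h] at hz0
      simp at hz0
      linarith
    · exact h
  obtain ⟨bf, pf, Af, jf, ef⟩ := hf.2.2 (x, s)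
  obtain ⟨bg, pg, Ag, jg, eg⟩ := hg.2.2 (y, s)
  obtain ⟨N, w, w', e1, e2, hρ, hT1, hT2⟩ := hfac s hs
  -- time derivative
  have time : K + Lq * (a * (‖x‖ ^ 2 + ‖y‖ ^ 2) + 4 * b * s) ≤ bf + bg := by
    have l1 := jf.time_diff.add jg.time_diff
    have l2 : Tendsto (fun h : ℝ => K + Lq * (a * (‖x‖ ^ 2 + ‖y‖ ^ 2) + 4 * b * s) - 2 * Lq * b * h)
        (𝓝[>] 0) (𝓝 (K + Lq * (a * (‖x‖ ^ 2 + ‖y‖ ^ 2) + 4 * b * s) - 2 * Lq * b * 0)) :=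
      ((by fun_prop : Continuous (fun h : ℝ => K + Lq * (a * (‖x‖ ^ 2 + ‖y‖ ^ 2) + 4 * b * s)
        - 2 * Lq * b * h)).tendsto 0).mono_left nhdsWithin_le_nhds
    rw [mul_zero, sub_zero] at l2
    refine le_of_tendsto_of_tendsto l2 l1 ?_
    filter_upwards [Ioo_mem_nhdsGT hs0] with h hh
    have := hglob x y (s - h) ⟨by linarith [hh.2], by linarith [hh.1, hs.2]⟩
    rw [← add_div, le_div_iff₀ hh.1]
    simp only [H, Ψ, ell] at this
    nlinarith only [this]
  have space : lam * bf + lam * bg ≤ 2 * G * ρ + Lq * (12 * T * (‖x‖ ^ 2 + ‖y‖ ^ 2) + 4 * a * s * T) := by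
    rw [ef, eg]
    simp only
    rw [e1, e2, trace_sum_vv, trace_sum_vv, ← Finset.sum_add_distrib]
    have l1 := tendsto_finsetSum (Finset.univ : Finset (Fin N)) fun j _ =>
      (jf.second_diff (w j)).add (jg.second_diff (w' j))
    let C := ∑ j, (2 * Lq * (‖w j‖ ^ 4 + ‖w' j‖ ^ 4))
    have l2 : Tendsto (fun h : ℝ => 2 * G * ρ + Lq * (12 * T * (‖x‖ ^ 2 + ‖y‖ ^ 2) + 4 * a * s * T)
        + C * h ^ 2) (𝓝[>] 0) (𝓝 (2 * G * ρ + Lq * (12 * T * (‖x‖ ^ 2 + ‖y‖ ^ 2) + 4 * a * s * T)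
        + C * 0 ^ 2)) :=
      ((by fun_prop : Continuous (fun h : ℝ => 2 * G * ρ + Lq * (12 * T * (‖x‖ ^ 2 + ‖y‖ ^ 2)
        + 4 * a * s * T) + C * h ^ 2)).tendsto 0).mono_left nhdsWithin_le_nhds
    rw [zero_pow two_ne_zero, mul_zero, add_zero] at l2
    refine le_of_tendsto_of_tendsto l1 l2 ?_
    filter_upwards [self_mem_nhdsWithin] with h hh
    have hh : 0 < h := hh
    have each : ∀ j, (f (x + h • w j, s) + f (x - h • w j, s) - 2 * f (x, s)) / h ^ 2 +
        (g (y + h • w' j, s) + g (y - h • w' j, s) - 2 * g (y, s)) / h ^ 2 ≤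
        2 * G * ‖w j - w' j‖ ^ 2 + Lq * (12 * (‖x‖ ^ 2 * ‖w j‖ ^ 2 + ‖y‖ ^ 2 * ‖w' j‖ ^ 2) +
          2 * a * s * (‖w j‖ ^ 2 + ‖w' j‖ ^ 2)) + 2 * Lq * (‖w j‖ ^ 4 + ‖w' j‖ ^ 4) * h ^ 2 := by
      intro j
      rw [← add_div, div_le_iff₀ (by positivity)]
      have a1 := hglob (x + h • w j) (y + h • w' j) s hs
      have a2 := hglob (x - h • w j) (y - h • w' j) s hs
      have a3 := mul_le_mul_of_nonneg_left (ell_second (a := a) (b := b) x (w j) s h) hLq.le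
      have a4 := mul_le_mul_of_nonneg_left (ell_second (a := a) (b := b) y (w' j) s h) hLq.le
      have d1 : x + h • w j - (y + h • w' j) = (x - y) + h • (w j - w' j) := by module
      have d2 : x - h • w j - (y - h • w' j) = (x - y) - h • (w j - w' j) := by module
      have n1 : ‖(x - y) + h • (w j - w' j)‖ ^ 2 = ‖x - y‖ ^ 2 + 2 * (h * ⟪x - y, w j - w' j⟫)
          + h ^ 2 * ‖w j - w' j‖ ^ 2 := by
        rw [norm_add_sq_real, real_inner_smul_right, norm_smul, mul_pow, Real.norm_eq_abs, sq_abs]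
      have n2 : ‖(x - y) - h • (w j - w' j)‖ ^ 2 = ‖x - y‖ ^ 2 - 2 * (h * ⟪x - y, w j - w' j⟫)
          + h ^ 2 * ‖w j - w' j‖ ^ 2 := by
        rw [norm_sub_sq_real, real_inner_smul_right, norm_smul, mul_pow, Real.norm_eq_abs, sq_abs]
      simp only [H, Ψ] at a1 a2
      rw [d1, n1, inner_add_right] at a1
      rw [d2, n2, inner_sub_right] at a2
      linarith
    refine (Finset.sum_le_sum fun j _ => each j).trans ?_
    rw [Finset.sum_add_distrib, Finset.sum_add_distrib, ← Finset.mul_sum, ← Finset.mul_sum,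
      ← Finset.sum_mul, Finset.sum_add_distrib, ← Finset.mul_sum, ← Finset.mul_sum, Finset.sum_add_distrib,
      Finset.sum_add_distrib, ← Finset.mul_sum, ← Finset.mul_sum]
    have c1 : 2 * G * ∑ j, ‖w j - w' j‖ ^ 2 ≤ 2 * G * ρ := by gcongr
    have c2 : ‖x‖ ^ 2 * ∑ j, ‖w j‖ ^ 2 ≤ ‖x‖ ^ 2 * T := by gcongr
    have c3 : ‖y‖ ^ 2 * ∑ j, ‖w' j‖ ^ 2 ≤ ‖y‖ ^ 2 * T := by gcongr
    have c4 : 2 * a * s * (∑ j, ‖w j‖ ^ 2 + ∑ j, ‖w' j‖ ^ 2) ≤ 2 * a * s * (T + T) := by gcongr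
    have c5 : Lq * (12 * (‖x‖ ^ 2 * ∑ j, ‖w j‖ ^ 2 + ‖y‖ ^ 2 * ∑ j, ‖w' j‖ ^ 2) +
        2 * a * s * (∑ j, ‖w j‖ ^ 2 + ∑ j, ‖w' j‖ ^ 2)) ≤
        Lq * (12 * T * (‖x‖ ^ 2 + ‖y‖ ^ 2) + 4 * a * s * T) := by
      apply mul_le_mul_of_nonneg_left _ hLq.le
      linarith
    simp only [C]
    linarith
  have t1 := mul_le_mul_of_nonneg_left time hlam.le
  have t2 : 12 * T * (‖x‖ ^ 2 + ‖y‖ ^ 2) ≤ lam * a * (‖x‖ ^ 2 + ‖y‖ ^ 2) := by gcongr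
  have t3 : a * T * s ≤ lam * b * s := by gcongr
  have t4 : Lq * (12 * T * (‖x‖ ^ 2 + ‖y‖ ^ 2) + 4 * a * s * T) ≤
      Lq * (lam * a * (‖x‖ ^ 2 + ‖y‖ ^ 2) + 4 * (lam * b * s)) :=
    mul_le_mul_of_nonneg_left (by linarith) hLq.le
  nlinarith only [t1, t4, space, hK]

end GH

noncomputable section GH

lemma jet_nsq {n : ℕ} {l : Filter (SpaceTime n)} {p₀ : SpaceTime n} (hl : l ≤ 𝓝 p₀) (c : Eucl n) :
    Jet l (fun q => ‖q.1 - c‖ ^ 2) p₀ 0 ((2 : ℝ) • (p₀.1 - c)) ((2 : ℝ) • 1) :=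
  Jet.poly hl 0 (by simp [Matrix.IsSymm]) fun q => by
    have : q.1 - c = (p₀.1 - c) + (q.1 - p₀.1) := by abel
    rw [this, norm_add_sq_real, qf_smul, qf_one, real_inner_smul_left]; ring

lemma jet_sq {n : ℕ} {l : Filter (SpaceTime n)} {f : SpaceTime n → ℝ} {p₀ : SpaceTime n}
    (hl : l ≤ 𝓝 p₀) {b : ℝ} {p : Eucl n} {A : Matrix (Fin n) (Fin n) ℝ} (h : Jet l f p₀ b p A) :
    Jet l (fun q => f q ^ 2) p₀ (2 * f p₀ * b) ((2 * f p₀) • p)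
      ((2 * f p₀) • A + (2 : ℝ) • vv p) :=
  h.comp hl (F := fun s => s ^ 2) (by
    refine IsLittleO.congr_left (isLittleO_zero _ _) fun s => ?_
    ring)

lemma jet_timesq {n : ℕ} {l : Filter (SpaceTime n)} {p₀ : SpaceTime n} (hl : l ≤ 𝓝 p₀)
    (c s : ℝ) : Jet l (fun q => c * (q.2 - s) ^ 2) p₀ (2 * c * (p₀.2 - s)) 0 0 :=
  Jet.poly hl c Matrix.isSymm_zero fun q => by simp [qf_zero]; ring

lemma jet_ell {n : ℕ} {l : Filter (SpaceTime n)} {p₀ : SpaceTime n} (hl : l ≤ 𝓝 p₀)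
    (a b : ℝ) (x : Eucl n) (c : ℝ) :
    ∃ p, Jet l (fun q => ell a b (q.1 - x) (q.2 - c)) p₀
      (a * ‖p₀.1 - x‖ ^ 2 + 2 * b * (p₀.2 - c)) p
      ((4 * ‖p₀.1 - x‖ ^ 2 + 2 * a * (p₀.2 - c)) • 1 + (8 : ℝ) • vv (p₀.1 - x)) := by
  have h1 := jet_nsq hl x
  have h2 := jet_sq hl h1
  have h3 := h1.mul_time hl (g := fun t => a * (t - c)) (g' := a) (by
    simpa using ((hasDerivAt_id p₀.2).sub_const c).const_mul a)
  have h4 := (h2.add h3).add (jet_timesq hl b c)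
  have h5 := h4.congr (b' := a * ‖p₀.1 - x‖ ^ 2 + 2 * b * (p₀.2 - c)) (by ring) rfl
      (A' := (4 * ‖p₀.1 - x‖ ^ 2 + 2 * a * (p₀.2 - c)) • 1 + (8 : ℝ) • vv (p₀.1 - x)) (by
        have : vv ((2 : ℝ) • (p₀.1 - x)) = (4 : ℝ) • vv (p₀.1 - x) := by
          ext i j; simp [vv, Matrix.vecMulVec]; ring
        rw [this]
        module)
  have e : (fun q : SpaceTime n => ell a b (q.1 - x) (q.2 - c)) = fun q =>
      (‖q.1 - x‖ ^ 2) ^ 2 + ‖q.1 - x‖ ^ 2 * (a * (q.2 - c)) + b * (q.2 - c) ^ 2 := by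
    funext q; unfold ell; ring
  rw [e]
  exact ⟨_, h5⟩

def clampT (t : ℝ) : ℝ := max (-1) (min t 0)

lemma clampT_mem (t : ℝ) : clampT t ∈ Icc (-1 : ℝ) 0 :=
  ⟨le_max_left _ _, max_le (by norm_num) (min_le_right _ _)⟩

lemma clampT_eq {t : ℝ} (h : t ∈ Icc (-1 : ℝ) 0) : clampT t = t := by
  simp [clampT, h.1, h.2]

lemma qf_entries {n : ℕ} (A : Matrix (Fin n) (Fin n) ℝ) (y : Eucl n) :
    qf A y = ∑ i, ∑ j, A i j * y j * y i := by
  simp only [qf, PiLp.inner_apply, Matrix.ofLp_toLpLin, Matrix.toLin'_apply, Matrix.mulVec,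
    dotProduct, RCLike.inner_apply, conj_trivial]
  refine Finset.sum_congr rfl fun i _ => ?_
  rw [Finset.mul_sum]
  exact Finset.sum_congr rfl fun j _ => by ring

section
variable {d : ℕ} {lam Λ M C₀ : ℝ} {Q Q' : ℝ → Matrix (Fin (d + 1)) (Fin (d + 1)) ℝ}
  {v v' : ℝ → Eucl (d + 1)}

lemma Q_qf_cont (D : ObliqueData d lam Λ M C₀ Q Q' v v') (c : ℝ) (ξ : Eucl (d + 1)) :
    Continuous fun t => qf (Q (clampT (c + t))) ξ := by
  simp only [qf_entries]
  refine continuous_finsetSum _ fun i _ => continuous_finsetSum _ fun j _ => ?_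
  have h : ContinuousOn (fun s => Q s i j) (Icc (-1) 0) := fun t ht => (D.Qderiv t ht i j).continuousWithinAt
  have h2 : Continuous fun t => Q (clampT (c + t)) i j :=
    h.comp_continuous (by unfold clampT; fun_prop) fun t => clampT_mem _
  exact (h2.mul continuous_const).mul continuous_const

lemma Q_qf_nonneg (D : ObliqueData d lam Λ M C₀ Q Q' v v') {t : ℝ} (ht : t ∈ Icc (-1 : ℝ) 0)
    (ξ : Eucl (d + 1)) : 0 ≤ qf (Q t) ξ := by
  have := Q_lower D ht ξ
  have := kap_ge_one D
  have : 0 ≤ (Λ * M ^ 2)⁻¹ * ‖ξ‖ ^ 2 := by positivity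
  linarith

lemma claimA (D : ObliqueData d lam Λ M C₀ Q Q' v v') {u : SpaceTime (d + 1) → ℝ}
    (hu : ObliqueSub d lam Q v u) (huc : ContinuousOn u (closure (Kc d 1)))
    {x0 : Eucl (d + 1)} {t0 τ R M0 ε0 a b Lq δ1 : ℝ} {f : SpaceTime (d + 1) → ℝ}
    (hf : Sol lam (fun r => Q (clampT (t0 - τ + r))) f) (hτ : 0 < τ) (hR : 0 < R)
    (hδ1 : 0 < δ1) (ha : 0 ≤ a) (hb : 0 ≤ b) (hLq : 0 < Lq)
    (hball : ∀ x ∈ closedBall x0 R, ∀ t ∈ Icc (t0 - τ) t0, (x, t) ∈ Kc d 1)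
    (hub : ∀ X ∈ closure (Kc d 1), u X ≤ M0)
    (hf0 : ∀ ξ ∈ closedBall (0 : Eucl (d + 1)) R, u (x0 + ξ, t0 - τ) ≤ f (ξ, 0) + ε0)
    (hfl : ∀ ξ, ∀ r ∈ Icc 0 τ, -(M0 + ε0 + 1) ≤ f (ξ, r))
    (hLR : 2 * M0 + 2 ≤ Lq * R ^ 4)
    (h1 : 12 * ((Λ * M ^ 2) * (d + 1)) ≤ lam * a) (h2 : a * ((Λ * M ^ 2) * (d + 1)) ≤ lam * b) :
    u (x0, t0) ≤ f (0, τ) + ε0 + Lq * ell a b (0 : Eucl (d + 1)) τ + δ1 * τ := by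
  have hl0 := D.lam_pos
  have key := comparison hu huc (G := closedBall x0 R ×ˢ Icc (t0 - τ) t0)
    (W := fun q => f (q - (x0, t0 - τ)) + ε0 + Lq * ell a b (q.1 - x0) (q.2 - (t0 - τ))
      + δ1 * (q.2 - (t0 - τ))) ((isCompact_closedBall _ _).prod isCompact_Icc)
    (fun q hq => subset_closure (hball q.1 hq.1 q.2 hq.2))
    (by
      have := hf.1
      unfold ell
      fun_prop) ?_ (x0, t0) ⟨by simp [hR.le], by simp [hτ.le]⟩
  · simpa using key
  rintro ⟨x, t⟩ ⟨hx, ht⟩ hlt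
  simp only at hx ht hlt
  have hK := hball x hx t ht
  have hr : 0 ≤ t - (t0 - τ) := by linarith [ht.1]
  have hsub : ((x, t) : SpaceTime (d + 1)) - (x0, t0 - τ) = (x - x0, t - (t0 - τ)) := rfl
  have hell := ell_nonneg ha hb (x - x0) hr
  have hxR : ‖x - x0‖ < R := by
    by_contra! hcon
    have e1 := hfl (x - x0) (t - (t0 - τ)) ⟨hr, by linarith [ht.2]⟩
    have e2 := hub _ (subset_closure hK)
    have e3 : R ^ 4 ≤ ‖x - x0‖ ^ 4 := pow_le_pow_left₀ hR.le hcon 4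
    have e4 : Lq * R ^ 4 ≤ Lq * ell a b (x - x0) (t - (t0 - τ)) :=
      mul_le_mul_of_nonneg_left (e3.trans hell) hLq.le
    have e5 : 0 ≤ δ1 * (t - (t0 - τ)) := by positivity
    rw [hsub] at hlt
    linarith
  have htt : t0 - τ < t := by
    rcases eq_or_lt_of_le ht.1 with h | h
    · exfalso
      have e1 := hf0 (x - x0) (by simpa using hxR.le)
      rw [add_sub_cancel] at e1
      subst h
      have e4 : 0 ≤ Lq * ell a b (x - x0) (t0 - τ - (t0 - τ)) :=
        mul_nonneg hLq.le (le_trans (by positivity) hell)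
      rw [hsub] at hlt
      simp only [sub_self, mul_zero] at hlt e4
      linarith
    · exact h
  refine ⟨?_, Or.inl hK, ?_⟩
  · have o1 : ∀ᶠ q : SpaceTime (d + 1) in 𝓝 (x, t), q.1 ∈ ball x0 R ∧ t0 - τ < q.2 := by
      have : IsOpen {q : SpaceTime (d + 1) | q.1 ∈ ball x0 R ∧ t0 - τ < q.2} :=
        (isOpen_ball.preimage continuous_fst).inter (isOpen_lt continuous_const continuous_snd)
      exact this.mem_nhds ⟨by simpa [dist_eq_norm] using hxR, htt⟩
    have o2 : ∀ᶠ q : SpaceTime (d + 1) in PF (x, t), q.2 ≤ t := by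
      filter_upwards [self_mem_nhdsWithin] with q hq using hq.2
    filter_upwards [o1.filter_mono (PF_le _), o2] with q hq hq2
    exact ⟨ball_subset_closedBall hq.1, hq.2.le, hq2.trans ht.2⟩
  obtain ⟨bf, pf, Af, Jf, ef⟩ := hf.2.2 ((x, t) - (x0, t0 - τ))
  obtain ⟨pe, Je⟩ := jet_ell (PF_le (x, t)) a b x0 (t0 - τ)
  have J := (((Jf.shift.mono (PF_le (x, t))).add (Jet.const (x, t) ε0)).add (Je.const_mul Lq)).add
    (jet_time (PF_le (x, t)) δ1 (t0 - τ))
  refine ⟨_, _, _, J, ?_, ?_⟩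
  · intro _
    have htm : t ∈ Icc (-1 : ℝ) 0 := mem_time (subset_closure hK)
    have e1 : clampT (t0 - τ + ((x, t) - (x0, t0 - τ) : SpaceTime (d + 1)).2) = t := by
      rw [hsub]; simp only [add_sub_cancel]; exact clampT_eq htm
    simp only [e1] at ef
    have e2 := Q_trace D htm
    have e3 := Q_upper D htm (x - x0)
    have e0 := Q_trace_nonneg D htm
    have hk := kap_ge_one D
    set T := (Λ * M ^ 2) * (d + 1) with hT
    have e4 : qf (Q t) (x - x0) ≤ T * ‖x - x0‖ ^ 2 := by
      refine e3.trans (mul_le_mul_of_nonneg_right ?_ (by positivity))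
      rw [hT]
      have : (0 : ℝ) ≤ d := by positivity
      nlinarith only [this, hk]
    simp only [add_zero, Matrix.mul_add, Matrix.trace_add, Matrix.mul_smul, Matrix.trace_smul,
      smul_eq_mul, mul_one, trace_mul_vv]
    have e5 : (4 * ‖x - x0‖ ^ 2 + 2 * a * (t - (t0 - τ))) * (Q t).trace ≤
        (4 * ‖x - x0‖ ^ 2 + 2 * a * (t - (t0 - τ))) * T :=
      mul_le_mul_of_nonneg_left e2 (by positivity)
    have e6 : ‖x - x0‖ ^ 2 * (12 * T) ≤ ‖x - x0‖ ^ 2 * (lam * a) :=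
      mul_le_mul_of_nonneg_left h1 (by positivity)
    have e7 : (t - (t0 - τ)) * (a * T) ≤ (t - (t0 - τ)) * (lam * b) :=
      mul_le_mul_of_nonneg_left h2 hr
    have e8 : (4 * ‖x - x0‖ ^ 2 + 2 * a * (t - (t0 - τ))) * (Q t).trace
        + 8 * qf (Q t) (x - x0) ≤ lam * (a * ‖x - x0‖ ^ 2 + 2 * b * (t - (t0 - τ))) := by
      nlinarith only [e4, e5, e6, e7]
    have e9 := mul_le_mul_of_nonneg_left e8 hLq.le
    have e10 : 0 < lam * δ1 := by positivity
    nlinarith only [e9, e10, ef]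
  · rintro ⟨-, h, -⟩
    exact absurd h hK.2.1.ne'

lemma Sol.neg {n : ℕ} {lam : ℝ} {Qf : ℝ → Matrix (Fin n) (Fin n) ℝ} {f : SpaceTime n → ℝ}
    (hf : Sol lam Qf f) : Sol lam Qf (fun q => (-1) * f q) := by
  obtain ⟨h1, ⟨C, hC⟩, h2⟩ := hf
  refine ⟨by fun_prop, ⟨C, fun x t ht => by simpa using hC x t ht⟩, fun p₀ => ?_⟩
  obtain ⟨b, p, A, hJ, e⟩ := h2 p₀
  refine ⟨_, _, _, hJ.const_mul (-1), ?_⟩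
  simp; exact e

lemma sol_lower {n : ℕ} {lam : ℝ} {Q1 : ℝ → Matrix (Fin n) (Fin n) ℝ} {f : SpaceTime n → ℝ}
    (hlam : 0 < lam) (hf : Sol lam Q1 f) {τ T a b m : ℝ}
    (hfac : ∀ r ∈ Icc 0 τ, ∃ (N : ℕ) (w : Fin N → Eucl n), Q1 r = ∑ j, vv (w j) ∧ ∑ j, ‖w j‖ ^ 2 ≤ T)
    (ha : 0 ≤ a) (hb : 0 ≤ b) 
    (h1 : 12 * T ≤ lam * a) (h2 : a * T ≤ lam * b) (h0 : ∀ ξ, |f (ξ, 0)| ≤ m) :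
    ∀ ξ, ∀ r ∈ Icc 0 τ, -(m + 1) ≤ f (ξ, r) := by
  intro ξ r hr
  have hr0 := hr.1
  have l1 : 0 ≤ ell a b ξ r := le_trans (by positivity) (ell_nonneg ha hb ξ hr.1)
  have l2 : 0 ≤ ell a b (0 : Eucl n) r := le_trans (by positivity) (ell_nonneg ha hb 0 hr.1)
  set ε := (1 + r + (ell a b ξ r + ell a b (0 : Eucl n) r))⁻¹ with hε
  have hε0 : 0 < ε := by positivity
  have key := mpPsi hlam hf.neg (Sol.zero lam Q1) (τ := τ) (ρ := 0) (T := T) (a := a) (b := b) (G := 0)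
    (K := ε) (Lq := ε) (c := m) (p := 0) (by
      intro r hr
      obtain ⟨N, w, e1, e2⟩ := hfac r hr
      exact ⟨N, w, w, e1, e1, by simp, e2, e2⟩) le_rfl hε0 ha hb (by simp; positivity) hε0.le h1 h2
    (by
      intro ξ ζ
      have := neg_abs_le (f (ξ, 0))
      have := h0 ξ
      have : 0 ≤ ell a b ξ 0 := le_trans (by positivity) (ell_nonneg ha hb ξ le_rfl)
      have : 0 ≤ ell a b ζ 0 := le_trans (by positivity) (ell_nonneg ha hb ζ le_rfl)
      have : 0 ≤ ε * (ell a b ξ 0 + ell a b ζ 0) := by positivity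
      simp; linarith) ξ 0 r hr
  have h4 : ε * (1 + r + (ell a b ξ r + ell a b (0 : Eucl n) r)) = 1 := by
    rw [hε]; exact inv_mul_cancel₀ (by positivity)
  simp at key
  nlinarith

end
end GH

noncomputable section GH

lemma qf_eq_dot {n : ℕ} (A : Matrix (Fin n) (Fin n) ℝ) (x y : Eucl n) :
    ⟪Matrix.toEuclideanLin A x, y⟫ = y.ofLp ⬝ᵥ A.mulVec x.ofLp := by
  simp [PiLp.inner_apply, Matrix.ofLp_toLpLin, Matrix.toLin'_apply, dotProduct]

lemma exists_factors {n : ℕ} {A B : Matrix (Fin n) (Fin n) ℝ} (hA : A.IsSymm) (hB : B.IsSymm)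
    {k e : ℝ} (hk : 1 ≤ k) (he : 0 ≤ e) (hAl : ∀ y : Eucl n, k⁻¹ * ‖y‖ ^ 2 ≤ qf A y)
    (hBl : ∀ y : Eucl n, k⁻¹ * ‖y‖ ^ 2 ≤ qf B y)
    (hD : ∀ x y : Eucl n, |⟪Matrix.toEuclideanLin (A - B) x, y⟫| ≤ e * ‖x‖ * ‖y‖)
    (hs : k * e ≤ 2) :
    ∃ (N : ℕ) (w w' : Fin N → Eucl n), A = ∑ j, vv (w j) ∧ B = ∑ j, vv (w' j) ∧
      ∑ j, ‖w j - w' j‖ ^ 2 ≤ n * (k * e ^ 2 / 2) := by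
  set c := k * e ^ 2 / 4 with hc
  set P : Matrix (Fin n) (Fin n) ℝ := (1 / 2 : ℝ) • (A + B) - c • 1 with hP
  have hPs : P.IsSymm := by
    simp [Matrix.IsSymm, hP, hA.eq, hB.eq]
  have hPSD : (Matrix.fromBlocks A P P B).PosSemidef := by
    refine Matrix.PosSemidef.of_dotProduct_mulVec_nonneg ?_ fun z => ?_
    · simp [Matrix.IsHermitian, Matrix.fromBlocks_transpose, Matrix.conjTranspose_eq_transpose_of_trivial,
        hA.eq, hB.eq, hPs.eq]
    · rw [star_trivial, Matrix.fromBlocks_mulVec, Matrix.dotProduct_block]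
      set x : Eucl n := WithLp.toLp 2 (z ∘ Sum.inl) with hx
      set y : Eucl n := WithLp.toLp 2 (z ∘ Sum.inr) with hy
      have e1 : (z ∘ Sum.inl) = x.ofLp := rfl
      have e2 : (z ∘ Sum.inr) = y.ofLp := rfl
      simp only [Sum.elim_comp_inl, Sum.elim_comp_inr]
      rw [e1, e2]
      simp only [dotProduct_add, ← qf_eq_dot]
      have hsym := toE_symm hA x y
      have hsymB := toE_symm hB x y
      have u1 := hAl (x + y)
      have u2 := hBl (x + y)
      have u3 := hD (x + y) (x - y)
      have u4 := norm_add_sq_real x y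
      have u5 := norm_sub_sq_real x y
      rw [abs_le] at u3
      simp only [qf, map_add, map_sub, LinearMap.sub_apply, inner_add_left, inner_add_right,
        inner_sub_left, inner_sub_right, hP, map_smul, LinearMap.add_apply, LinearMap.smul_apply,
        real_inner_smul_left, Matrix.toLpLin_one, LinearMap.id_apply] at u1 u2 u3 ⊢
      set p := ‖x + y‖
      set m := ‖x - y‖
      have hp : 0 ≤ p := norm_nonneg _
      have hm : 0 ≤ m := norm_nonneg _
      rw [real_inner_comm x (Matrix.toEuclideanLin A y), ← hsym] at *
      rw [real_inner_comm x (Matrix.toEuclideanLin B y), ← hsymB] at *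
      rw [real_inner_comm x y]
      have k0 : 0 < k := by linarith
      have hc2 : c ≤ k⁻¹ := by
        rw [hc, inv_eq_one_div, le_div_iff₀ k0]
        nlinarith only [hs, mul_nonneg k0.le he]
      have hq : 0 ≤ (k⁻¹ / 2) * p ^ 2 - 1 / 2 * e * p * m + c / 2 * m ^ 2 := by
        have : (k⁻¹ / 2) * p ^ 2 - 1 / 2 * e * p * m + c / 2 * m ^ 2 =
          k⁻¹ / 2 * (p - k * e * m / 2) ^ 2 := by
          rw [hc]; field_simp; ring
        rw [this]; positivity
      have hq2 : c * p ^ 2 ≤ k⁻¹ * p ^ 2 := mul_le_mul_of_nonneg_right hc2 (by positivity)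
      have u6 : c * (p ^ 2) - c * m ^ 2 = c * (4 * ⟪x, y⟫) := by rw [u4, u5]; ring
      linarith [u3.1, u3.2]
  obtain ⟨N, z, hz⟩ := Matrix.posSemidef_iff_eq_sum_vecMulVec.1 hPSD
  let w : Fin N → Eucl n := fun j => WithLp.toLp 2 fun i => z j (Sum.inl i)
  let w' : Fin N → Eucl n := fun j => WithLp.toLp 2 fun i => z j (Sum.inr i)
  have entry : ∀ a b, (Matrix.fromBlocks A P P B) a b = ∑ j, z j a * z j b := by
    intro a b
    rw [hz]; simp [Matrix.sum_apply, Matrix.vecMulVec]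
  have hAw : A = ∑ j, vv (w j) := by
    ext a b
    have := entry (Sum.inl a) (Sum.inl b)
    simp only [Matrix.fromBlocks_apply₁₁] at this
    rw [this]; simp [Matrix.sum_apply, vv, Matrix.vecMulVec, w]
  have hBw : B = ∑ j, vv (w' j) := by
    ext a b
    have := entry (Sum.inr a) (Sum.inr b)
    simp only [Matrix.fromBlocks_apply₂₂] at this
    rw [this]; simp [Matrix.sum_apply, vv, Matrix.vecMulVec, w']
  refine ⟨N, w, w', hAw, hBw, ?_⟩
  have t1 := trace_sum_vv_one w
  have t2 := trace_sum_vv_one w'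
  rw [← hAw] at t1
  rw [← hBw] at t2
  have t3 : ∑ j, ⟪w j, w' j⟫ = P.trace := by
    simp only [PiLp.inner_apply, Matrix.trace, Matrix.diag]
    rw [Finset.sum_comm]
    refine Finset.sum_congr rfl fun i _ => ?_
    have := entry (Sum.inl i) (Sum.inr i)
    simp only [Matrix.fromBlocks_apply₁₂] at this
    rw [this]
    simp [w, w', mul_comm]
  have t4 : ∑ j, ‖w j - w' j‖ ^ 2 = A.trace + B.trace - 2 * P.trace := by
    rw [t1, t2, ← t3, Finset.mul_sum, ← Finset.sum_add_distrib, ← Finset.sum_sub_distrib]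
    refine Finset.sum_congr rfl fun i _ => ?_
    rw [norm_sub_sq_real]; ring
  rw [t4]
  simp only [hP, Matrix.trace_sub, Matrix.trace_smul, Matrix.trace_add, Matrix.trace_one,
    Fintype.card_fin, smul_eq_mul]
  rw [hc]
  apply le_of_eq; ring

section
variable {d : ℕ} {lam Λ M C₀ : ℝ} {Q Q' : ℝ → Matrix (Fin (d + 1)) (Fin (d + 1)) ℝ}
  {v v' : ℝ → Eucl (d + 1)}

lemma v_lip (D : ObliqueData d lam Λ M C₀ Q Q' v v') {t s : ℝ} (ht : t ∈ Icc (-1 : ℝ) 0)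
    (hs : s ∈ Icc (-1 : ℝ) 0) : ‖v t - v s‖ ≤ lam⁻¹ * |t - s| :=
  Convex.norm_image_sub_le_of_norm_hasDerivWithin_le D.vderiv D.vderiv_bound (convex_Icc _ _) hs ht

lemma Q_lip (D : ObliqueData d lam Λ M C₀ Q Q' v v') {t s : ℝ} (ht : t ∈ Icc (-1 : ℝ) 0)
    (hs : s ∈ Icc (-1 : ℝ) 0) (x y : Eucl (d + 1)) :
    |⟪Matrix.toEuclideanLin (Q t - Q s) x, y⟫| ≤ (C₀ / lam * |t - s|) * ‖x‖ * ‖y‖ := by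
  have ent : ∀ A : Matrix (Fin (d + 1)) (Fin (d + 1)) ℝ, ⟪Matrix.toEuclideanLin A x, y⟫ =
      ∑ i, ∑ j, A i j * (x j * y i) := by
    intro A
    simp only [PiLp.inner_apply, Matrix.ofLp_toLpLin, Matrix.toLin'_apply, Matrix.mulVec,
      dotProduct, RCLike.inner_apply, conj_trivial]
    refine Finset.sum_congr rfl fun i _ => ?_
    rw [Finset.mul_sum]
    exact Finset.sum_congr rfl fun j _ => by ring
  have h1 : ∀ r ∈ Icc (-1 : ℝ) 0, HasDerivWithinAt (fun r => ⟪Matrix.toEuclideanLin (Q r) x, y⟫)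
      ⟪Matrix.toEuclideanLin (Q' r) x, y⟫ (Icc (-1 : ℝ) 0) r := by
    intro r hr
    simp only [ent]
    exact HasDerivWithinAt.fun_sum fun i _ => HasDerivWithinAt.fun_sum fun j _ =>
      (D.Qderiv r hr i j).mul_const _
  have h2 : ∀ r ∈ Icc (-1 : ℝ) 0, ‖⟪Matrix.toEuclideanLin (Q' r) x, y⟫‖ ≤ C₀ / lam * ‖x‖ * ‖y‖ := by
    intro r hr
    refine (norm_inner_le_norm _ _).trans (mul_le_mul_of_nonneg_right ?_ (norm_nonneg _))
    have := (LinearMap.toContinuousLinearMap (Matrix.toEuclideanLin (Q' r))).le_opNorm x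
    exact this.trans (mul_le_mul_of_nonneg_right (D.Qderiv_bound r hr) (norm_nonneg _))
  have h3 := Convex.norm_image_sub_le_of_norm_hasDerivWithin_le h1 h2 (convex_Icc _ _) hs ht
  rw [map_sub, LinearMap.sub_apply, inner_sub_left]
  rw [Real.norm_eq_abs, Real.norm_eq_abs] at h3
  refine h3.trans (le_of_eq (by ring))

set_option maxHeartbeats 1000000 in
lemma CL (D : ObliqueData d lam Λ M C₀ Q Q' v v') {u1 u2 : SpaceTime (d + 1) → ℝ}
    (hu1 : ObliqueSub d lam Q v u1) (hu1c : ContinuousOn u1 (closure (Kc d 1)))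
    (hu2 : ObliqueSub d lam Q v u2) (hu2c : ContinuousOn u2 (closure (Kc d 1)))
    {x0 y0 : Eucl (d + 1)} {t0 s0 τ0 R M0 P0 G δ ρ : ℝ} (hτ0 : 0 < τ0) (hR : 0 < R)
    (hb1 : ∀ X ∈ closure (Kc d 1), |u1 X| ≤ M0) (hb2 : ∀ X ∈ closure (Kc d 1), |u2 X| ≤ M0)
    (hx : ∀ x ∈ closedBall x0 R, ∀ t ∈ Icc (t0 - τ0) t0, (x, t) ∈ Kc d 1)
    (hy : ∀ x ∈ closedBall y0 R, ∀ t ∈ Icc (s0 - τ0) s0, (x, t) ∈ Kc d 1)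
    (hP0 : 0 ≤ P0) (hG : 0 ≤ G) (hδ : 0 < δ)
    (hfac : ∀ r ∈ Icc 0 τ0, ∃ (N : ℕ) (w w' : Fin N → Eucl (d + 1)), Q (t0 - r) = ∑ j, vv (w j) ∧
      Q (s0 - r) = ∑ j, vv (w' j) ∧ ∑ j, ‖w j - w' j‖ ^ 2 ≤ ρ)
    (hρ : 2 * G * ρ < lam * δ)
    (hmax : ∀ τ ∈ Ioo 0 τ0, ∃ p : Eucl (d + 1), ‖p‖ ≤ P0 ∧ ∀ ξ ∈ closedBall (0 : Eucl (d + 1)) R,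
      ∀ ζ ∈ closedBall (0 : Eucl (d + 1)) R, u1 (x0 + ξ, t0 - τ) + u2 (y0 + ζ, s0 - τ) ≤
        u1 (x0, t0) + u2 (y0, s0) + ⟪p, ξ - ζ⟫ + G * ‖ξ - ζ‖ ^ 2 - δ * τ) : False := by
  have hl := D.lam_pos
  have hk := kap_ge_one D
  have hM0 : 0 ≤ M0 := (abs_nonneg _).trans (hb1 (x0, t0) (subset_closure
    (hx x0 (by simp [hR.le]) t0 (by simp [hτ0.le]))))
  set T := (Λ * M ^ 2) * ((d : ℝ) + 1) with hT
  have hT0 : 0 < T := by positivity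
  set a := 12 * T / lam with ha
  set b := a * T / lam with hb
  have ha0 : 0 ≤ a := by positivity
  have hb0 : 0 ≤ b := by positivity
  have h1 : 12 * T ≤ lam * a := by rw [ha]; apply le_of_eq; field_simp
  have h2 : a * T ≤ lam * b := by rw [hb]; apply le_of_eq; field_simp
  have hρ0 : 0 ≤ ρ := by
    obtain ⟨N, w, w', -, -, h⟩ := hfac 0 ⟨le_rfl, hτ0.le⟩
    exact le_trans (Finset.sum_nonneg fun j _ => by positivity) h
  set K := (2 * G * ρ / lam + δ) / 2 with hK
  have hK1 : 2 * G * ρ < lam * K := by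
    have : lam * K = (2 * G * ρ + lam * δ) / 2 := by rw [hK]; field_simp
    linarith
  have hK2 : K < δ := by
    have : 2 * G * ρ / lam < δ := by rw [div_lt_iff₀ hl]; linarith
    linarith
  have hK0 : 0 ≤ K := by positivity
  set Lq := P0 + (4 * M0 + 4 + δ + 2 * P0) / R ^ 4 with hLq
  have hLq0 : 0 < Lq := by positivity
  have hLqR : (Lq - P0) * R ^ 4 = 4 * M0 + 4 + δ + 2 * P0 := by
    rw [hLq]; field_simp; ring
  have hLqP : 0 ≤ Lq - P0 := by rw [hLq, add_sub_cancel_left]; positivity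
  -- choose τ
  set τ := min (τ0 / 2) (min 1 ((δ - K) / (2 * (8 + 4 * Lq * b)))) with hτ
  have hτp : 0 < τ := by
    have : 0 < δ - K := by linarith
    refine lt_min (by positivity) (lt_min one_pos (by positivity))
  have hττ : τ < τ0 := lt_of_le_of_lt (min_le_left _ _) (by linarith)
  have hτ1 : τ ≤ 1 := (min_le_right _ _).trans (min_le_left _ _)
  have hτ2 : τ * (8 + 4 * Lq * b) < δ - K := by
    have h3 : τ ≤ (δ - K) / (2 * (8 + 4 * Lq * b)) := (min_le_right _ _).trans (min_le_right _ _)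
    rw [le_div_iff₀ (by positivity)] at h3
    nlinarith only [h3, hK2]
  obtain ⟨p, hpP, hp⟩ := hmax τ ⟨hτp, hττ⟩
  have exs : ∀ (u : SpaceTime (d + 1) → ℝ) (z0 : Eucl (d + 1)) (r0 : ℝ),
      ContinuousOn u (closure (Kc d 1)) → (∀ X ∈ closure (Kc d 1), |u X| ≤ M0) →
      (∀ x ∈ closedBall z0 R, ∀ t ∈ Icc (r0 - τ0) r0, (x, t) ∈ Kc d 1) →
      ∃ f, Sol lam (fun r => Q (clampT (r0 - τ + r))) f ∧ (∀ x, |f (x, 0)| ≤ M0 + τ ^ 2) ∧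
        ∀ x ∈ closedBall (0 : Eucl (d + 1)) R, |f (x, 0) - u (z0 + x, r0 - τ)| ≤ τ ^ 2 := by
    intro u z0 r0 huc hub hz
    have hin : ∀ x ∈ closedBall (0 : Eucl (d + 1)) R, (z0 + x, r0 - τ) ∈ closure (Kc d 1) := by
      intro x hx
      exact subset_closure (hz _ (by simpa using hx) _ ⟨by linarith, by linarith⟩)
    refine exists_sol hl (Q_qf_cont D (r0 - τ)) (fun t ξ => Q_qf_nonneg D (clampT_mem _) ξ) hR ?_
      (fun x hx => hub _ (hin x hx)) (by positivity)
    exact huc.comp (by fun_prop) hin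
  obtain ⟨f, hf, hfb, hfg⟩ := exs u1 x0 t0 hu1c hb1 hx
  obtain ⟨g, hg, hgb, hgg⟩ := exs u2 y0 s0 hu2c hb2 hy
  have tin : ∀ r ∈ Icc 0 τ, t0 - τ + r ∈ Icc (-1 : ℝ) 0 := fun r hr =>
    mem_time (subset_closure (hx x0 (by simp [hR.le]) (t0 - τ + r)
      ⟨by linarith [hr.1], by linarith [hr.2]⟩))
  have sin : ∀ r ∈ Icc 0 τ, s0 - τ + r ∈ Icc (-1 : ℝ) 0 := fun r hr =>
    mem_time (subset_closure (hy y0 (by simp [hR.le]) (s0 - τ + r)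
      ⟨by linarith [hr.1], by linarith [hr.2]⟩))
  have hfac' : ∀ r ∈ Icc 0 τ, ∃ (N : ℕ) (w w' : Fin N → Eucl (d + 1)),
      Q (clampT (t0 - τ + r)) = ∑ j, vv (w j) ∧
      Q (clampT (s0 - τ + r)) = ∑ j, vv (w' j) ∧ ∑ j, ‖w j - w' j‖ ^ 2 ≤ ρ ∧
      ∑ j, ‖w j‖ ^ 2 ≤ T ∧ ∑ j, ‖w' j‖ ^ 2 ≤ T := by
    intro r hr
    obtain ⟨N, w, w', e1, e2, e3⟩ := hfac (τ - r) ⟨by linarith [hr.2], by linarith [hr.1]⟩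
    rw [clampT_eq (tin r hr), clampT_eq (sin r hr)]
    have t1 : t0 - (τ - r) = t0 - τ + r := by ring
    have t2 : s0 - (τ - r) = s0 - τ + r := by ring
    rw [t1] at e1
    rw [t2] at e2
    refine ⟨N, w, w', e1, e2, e3, ?_, ?_⟩
    · rw [← trace_sum_vv_one, ← e1]; exact Q_trace D (tin r hr)
    · rw [← trace_sum_vv_one, ← e2]; exact Q_trace D (sin r hr)
  have main := mpPsi hl hf hg (c := u1 (x0, t0) + u2 (y0, s0) - δ * τ + 2 * τ ^ 2) (p := p) hfac' hG hLq0
    ha0 hb0 hK1 hK0 h1 h2 (by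
      intro ξ ζ
      have l1 := ell_nonneg ha0 hb0 ξ le_rfl
      have l2 := ell_nonneg ha0 hb0 ζ le_rfl
      have lm : Lq * (‖ξ‖ ^ 4 + ‖ζ‖ ^ 4) ≤ Lq * (ell a b ξ 0 + ell a b ζ 0) := by gcongr
      by_cases hin : ‖ξ‖ ≤ R ∧ ‖ζ‖ ≤ R
      · have q1 := hp ξ (by simpa using hin.1) ζ (by simpa using hin.2)
        have q2 := abs_le.1 (hfg ξ (by simpa using hin.1))
        have q3 := abs_le.1 (hgg ζ (by simpa using hin.2))
        have : 0 ≤ Lq * (‖ξ‖ ^ 4 + ‖ζ‖ ^ 4) := by positivity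
        linarith [q2.2, q3.2]
      · have q1 := (abs_le.1 (hfb ξ)).2
        have q2 := (abs_le.1 (hgb ζ)).2
        have q3 := (abs_le.1 (hb1 (x0, t0) (subset_closure
          (hx x0 (by simp [hR.le]) t0 (by simp [hτ0.le]))))).1
        have q4 := (abs_le.1 (hb2 (y0, s0) (subset_closure
          (hy y0 (by simp [hR.le]) s0 (by simp [hτ0.le]))))).1
        have q5 : R ^ 4 ≤ ‖ξ‖ ^ 4 + ‖ζ‖ ^ 4 := by
          rw [not_and_or, not_le, not_le] at hin
          rcases hin with h | h
          · have := pow_le_pow_left₀ hR.le h.le 4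
            have : 0 ≤ ‖ζ‖ ^ 4 := by positivity
            linarith
          · have := pow_le_pow_left₀ hR.le h.le 4
            have : 0 ≤ ‖ξ‖ ^ 4 := by positivity
            linarith
        have q6 : ∀ s : ℝ, 0 ≤ s → s ≤ 1 + s ^ 4 := by
          intro s hs
          nlinarith only [sq_nonneg (s ^ 2 - 1 / 2), sq_nonneg (s - 1 / 2)]
        have q7 : -⟪p, ξ - ζ⟫ ≤ P0 * (2 + (‖ξ‖ ^ 4 + ‖ζ‖ ^ 4)) := by
          have r1 := neg_le_of_abs_le (abs_real_inner_le_norm p (ξ - ζ))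
          have r2 : ‖p‖ * ‖ξ - ζ‖ ≤ P0 * (‖ξ‖ + ‖ζ‖) :=
            mul_le_mul hpP (norm_sub_le _ _) (norm_nonneg _) hP0
          have r3 : P0 * (‖ξ‖ + ‖ζ‖) ≤ P0 * (2 + (‖ξ‖ ^ 4 + ‖ζ‖ ^ 4)) := by
            refine mul_le_mul_of_nonneg_left ?_ hP0
            linarith [q6 ‖ξ‖ (norm_nonneg _), q6 ‖ζ‖ (norm_nonneg _)]
          linarith
        have q8 := mul_le_mul_of_nonneg_left q5 hLqP
        have q9 : 0 ≤ G * ‖ξ - ζ‖ ^ 2 := by positivity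
        have q10 : δ * τ ≤ δ := mul_le_of_le_one_right hδ.le hτ1
        rw [hLqR] at q8
        linarith) 0 0 τ ⟨hτp.le, le_rfl⟩
  have lowf := sol_lower hl hf (τ := τ) (T := T) (m := M0 + τ ^ 2) (by
    intro r hr
    obtain ⟨N, w, w', e1, e2, e3, e4, e5⟩ := hfac' r hr
    exact ⟨N, w, e1, e4⟩) ha0 hb0 h1 h2 hfb
  have lowg := sol_lower hl hg (τ := τ) (T := T) (m := M0 + τ ^ 2) (by
    intro r hr
    obtain ⟨N, w, w', e1, e2, e3, e4, e5⟩ := hfac' r hr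
    exact ⟨N, w', e2, e5⟩) ha0 hb0 h1 h2 hgb
  have hLR : 2 * M0 + 2 ≤ Lq * R ^ 4 := by nlinarith only [hLqR, hM0, hδ, hP0, show 0 ≤ P0 * R ^ 4 by positivity]
  have A1 := claimA D hu1 hu1c hf hτp hR hτp ha0 hb0 hLq0
    (fun x hx' t ht => hx x hx' t ⟨by linarith [ht.1], ht.2⟩)
    (fun X hX => (abs_le.1 (hb1 X hX)).2)
    (fun ξ hξ => by linarith [(abs_le.1 (hfg ξ hξ)).1]) lowf hLR h1 h2
  have A2 := claimA D hu2 hu2c hg hτp hR hτp ha0 hb0 hLq0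
    (fun x hx' t ht => hy x hx' t ⟨by linarith [ht.1], ht.2⟩)
    (fun X hX => (abs_le.1 (hb2 X hX)).2)
    (fun ξ hξ => by linarith [(abs_le.1 (hgg ξ hξ)).1]) lowg hLR h1 h2
  have ez : ell a b (0 : Eucl (d + 1)) τ = b * τ ^ 2 := by simp [ell]
  rw [ez] at A1 A2 main
  simp only [sub_self, inner_zero_right, norm_zero] at main
  have fin1 := mul_lt_mul_of_pos_right hτ2 hτp
  have fin2 : 0 < τ ^ 2 := by positivity
  have fin3 : G * (0 : ℝ) ^ 2 = 0 := by simp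
  linarith

end
end GH

noncomputable section GH

/-- jets recorded through the two linear functionals of the problem -/
def GJ {n : ℕ} (l : Filter (SpaceTime n)) (Qm : Matrix (Fin n) (Fin n) ℝ) (lam : ℝ) (w : Eucl n)
    (p₀ : SpaceTime n) (f : SpaceTime n → ℝ) (L β : ℝ) (p : Eucl n) : Prop :=
  ∃ b A, Jet l f p₀ b p A ∧ (Qm * A).trace - lam * b = L ∧ ⟪w, p⟫ - b = β

/-- bilinear form -/
def bil {n : ℕ} (Qm : Matrix (Fin n) (Fin n) ℝ) (x y : Eucl n) : ℝ := ⟪Matrix.toEuclideanLin Qm x, y⟫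

section
variable {n : ℕ} {l : Filter (SpaceTime n)} {Qm : Matrix (Fin n) (Fin n) ℝ} {lam : ℝ} {w : Eucl n}
  {p₀ : SpaceTime n} {f g : SpaceTime n → ℝ} {L β L' β' : ℝ} {p p' : Eucl n}

lemma GJ.congr (h : GJ l Qm lam w p₀ f L β p) (h1 : L = L') (h2 : β = β') (h3 : p = p') :
    GJ l Qm lam w p₀ f L' β' p' := by subst h1 h2 h3; exact h

lemma GJ.add (h : GJ l Qm lam w p₀ f L β p) (h' : GJ l Qm lam w p₀ g L' β' p') :
    GJ l Qm lam w p₀ (fun q => f q + g q) (L + L') (β + β') (p + p') := by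
  obtain ⟨b, A, h1, h2, h3⟩ := h
  obtain ⟨b', A', h1', h2', h3'⟩ := h'
  refine ⟨_, _, h1.add h1', ?_, ?_⟩
  · rw [Matrix.mul_add, Matrix.trace_add]; linarith
  · rw [inner_add_right]; linarith

lemma GJ.const_mul (h : GJ l Qm lam w p₀ f L β p) (c : ℝ) :
    GJ l Qm lam w p₀ (fun q => c * f q) (c * L) (c * β) (c • p) := by
  obtain ⟨b, A, h1, h2, h3⟩ := h
  refine ⟨_, _, h1.const_mul c, ?_, ?_⟩
  · rw [Matrix.mul_smul, Matrix.trace_smul, smul_eq_mul, ← h2]; ring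
  · rw [real_inner_smul_right, ← h3]; ring

lemma GJ.const (c : ℝ) : GJ l Qm lam w p₀ (fun _ => c) 0 0 0 :=
  ⟨0, 0, Jet.const p₀ c, by simp, by simp⟩

lemma GJ.comp (hl : l ≤ 𝓝 p₀) (h : GJ l Qm lam w p₀ f L β p) {F : ℝ → ℝ} {F1 F2 : ℝ}
    (hF : (fun s => F s - F (f p₀) - F1 * (s - f p₀) - 1 / 2 * F2 * (s - f p₀) ^ 2)
      =o[𝓝 (f p₀)] (fun s => (s - f p₀) ^ 2)) :
    GJ l Qm lam w p₀ (fun q => F (f q)) (F1 * L + F2 * qf Qm p) (F1 * β) (F1 • p) := by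
  obtain ⟨b, A, h1, h2, h3⟩ := h
  refine ⟨_, _, h1.comp hl hF, ?_, ?_⟩
  · rw [Matrix.mul_add, Matrix.trace_add, Matrix.mul_smul, Matrix.trace_smul, Matrix.mul_smul,
      Matrix.trace_smul, smul_eq_mul, smul_eq_mul, trace_mul_vv, ← h2]; ring
  · rw [real_inner_smul_right, ← h3]; ring

lemma GJ.rpow (hl : l ≤ 𝓝 p₀) (h : GJ l Qm lam w p₀ f L β p) (hf : 0 < f p₀) (q : ℝ) :
    GJ l Qm lam w p₀ (fun x => f x ^ q)
      (q * f p₀ ^ (q - 1) * L + q * ((q - 1) * f p₀ ^ (q - 2)) * qf Qm p)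
      (q * f p₀ ^ (q - 1) * β) ((q * f p₀ ^ (q - 1)) • p) :=
  h.comp hl (taylor_rpow hf)

lemma GJ.exp (hl : l ≤ 𝓝 p₀) (h : GJ l Qm lam w p₀ f L β p) :
    GJ l Qm lam w p₀ (fun x => Real.exp (f x))
      (Real.exp (f p₀) * L + Real.exp (f p₀) * qf Qm p)
      (Real.exp (f p₀) * β) (Real.exp (f p₀) • p) :=
  h.comp hl (taylor2 (F := Real.exp) (F' := Real.exp)
    (Eventually.of_forall fun s => Real.hasDerivAt_exp s) (Real.hasDerivAt_exp _))

lemma GJ.sq (hl : l ≤ 𝓝 p₀) (h : GJ l Qm lam w p₀ f L β p) :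
    GJ l Qm lam w p₀ (fun x => f x ^ 2)
      (2 * f p₀ * L + 2 * qf Qm p) (2 * f p₀ * β) ((2 * f p₀) • p) :=
  h.comp hl (F := fun s => s ^ 2) (by
    refine IsLittleO.congr_left (isLittleO_zero _ _) fun s => ?_
    ring)

lemma bil_polar (hQ : Qm.IsSymm) (x y : Eucl n) :
    qf Qm (x + y) - qf Qm (x - y) = 4 * bil Qm x y := by
  have hsym := toE_symm hQ x y
  have e : ⟪Matrix.toEuclideanLin Qm y, x⟫ = ⟪Matrix.toEuclideanLin Qm x, y⟫ := by
    rw [hsym, real_inner_comm]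
  simp only [qf, bil, map_add, map_sub, inner_add_left, inner_add_right,
        inner_sub_left, inner_sub_right, e]
  ring

lemma GJ.mul (hl : l ≤ 𝓝 p₀) (hQ : Qm.IsSymm) (h : GJ l Qm lam w p₀ f L β p)
    (h' : GJ l Qm lam w p₀ g L' β' p') :
    GJ l Qm lam w p₀ (fun x => f x * g x) (f p₀ * L' + g p₀ * L + 2 * bil Qm p p')
      (f p₀ * β' + g p₀ * β) (f p₀ • p' + g p₀ • p) := by
  have h1 := ((h.add h').sq hl).const_mul (1 / 4)
  have h2 := ((h.add (h'.const_mul (-1))).sq hl).const_mul (-1 / 4)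
  have h3 := h1.add h2
  have e : (fun x => f x * g x) = (fun x => 1 / 4 * (f x + g x) ^ 2 + -1 / 4 * (f x + -1 * g x) ^ 2) := by
    funext x; ring
  rw [e]
  refine h3.congr ?_ ?_ ?_
  · have := bil_polar hQ p p'
    have e2 : p + (-1 : ℝ) • p' = p - p' := by rw [neg_one_smul]; abel
    rw [e2]
    linarith
  · ring
  · module

lemma GJ.poly (hl : l ≤ 𝓝 p₀) (b : ℝ) (p : Eucl n) (A : Matrix (Fin n) (Fin n) ℝ) (c : ℝ) (hA : A.IsSymm)
    (h : ∀ q, f q = f p₀ + b * (q.2 - p₀.2) + ⟪p, q.1 - p₀.1⟫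
    + 1 / 2 * qf A (q.1 - p₀.1) + c * (q.2 - p₀.2) ^ 2) :
    GJ l Qm lam w p₀ f ((Qm * A).trace - lam * b) (⟪w, p⟫ - b) p :=
  ⟨b, A, Jet.poly hl c hA h, rfl, rfl⟩

lemma GJ.lin (hl : l ≤ 𝓝 p₀) (a c : Eucl n) :
    GJ l Qm lam w p₀ (fun q => ⟪a, q.1 - c⟫) 0 ⟪w, a⟫ a :=
  (GJ.poly hl 0 a 0 0 Matrix.isSymm_zero fun q => by
    simp only [inner_sub_right, qf_zero]; ring).congr (by simp) (by simp) rfl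

lemma GJ.nsq (hl : l ≤ 𝓝 p₀) (c : Eucl n) :
    GJ l Qm lam w p₀ (fun q => ‖q.1 - c‖ ^ 2) (2 * Qm.trace) (2 * ⟪w, p₀.1 - c⟫)
      ((2 : ℝ) • (p₀.1 - c)) :=
  GJ.congr ⟨_, _, jet_nsq hl c, rfl, rfl⟩ (by simp) (by simp [real_inner_smul_right]) rfl

lemma GJ.time (hl : l ≤ 𝓝 p₀) (s : ℝ) :
    GJ l Qm lam w p₀ (fun q => q.2 - s) (-lam) (-1) 0 :=
  (GJ.poly hl 1 0 0 0 Matrix.isSymm_zero fun q => by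
    simp [qf_zero]).congr (by simp) (by simp) rfl

end

section
variable {d : ℕ} {lam Λ M C₀ : ℝ} {Q Q' : ℝ → Matrix (Fin (d + 1)) (Fin (d + 1)) ℝ}
  {v v' : ℝ → Eucl (d + 1)}

lemma Q_bil (D : ObliqueData d lam Λ M C₀ Q Q' v v') {t : ℝ} (ht : t ∈ Icc (-1 : ℝ) 0)
    (x y : Eucl (d + 1)) : |bil (Q t) x y| ≤ (Λ * M ^ 2) * ‖x‖ * ‖y‖ := by
  have hk := kap_ge_one D
  have h1 : ∀ x y : Eucl (d + 1), bil (Q t) x y ≤ (Λ * M ^ 2) * ((‖x‖ ^ 2 + ‖y‖ ^ 2) / 2) := by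
    intro x y
    have e1 := bil_polar (D.Qsymm t ht) x y
    have e2 := Q_upper D ht (x + y)
    have e3 := Q_qf_nonneg D ht (x - y)
    have e4 := parallelogram_law_with_norm ℝ x y
    have e5 : (Λ * M ^ 2) * ‖x + y‖ ^ 2 ≤ (Λ * M ^ 2) * (2 * (‖x‖ ^ 2 + ‖y‖ ^ 2)) := by
      apply mul_le_mul_of_nonneg_left _ (by linarith)
      nlinarith [mul_self_nonneg ‖x - y‖]
    linarith
  have h2 : ∀ x y : Eucl (d + 1), bil (Q t) x y ≤ (Λ * M ^ 2) * ‖x‖ * ‖y‖ := by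
    intro x y
    rcases eq_or_ne x 0 with rfl | hx
    · simp [bil]
    rcases eq_or_ne y 0 with rfl | hy
    · simp [bil]
    have hx' : 0 < ‖x‖ := norm_pos_iff.2 hx
    have hy' : 0 < ‖y‖ := norm_pos_iff.2 hy
    have := h1 (‖y‖ • x) (‖x‖ • y)
    have e : bil (Q t) (‖y‖ • x) (‖x‖ • y) = (‖x‖ * ‖y‖) * bil (Q t) x y := by
      simp [bil, real_inner_smul_left, real_inner_smul_right]; ring
    rw [e, norm_smul, norm_smul, norm_norm, norm_norm] at this
    have : (‖x‖ * ‖y‖) * bil (Q t) x y ≤ (‖x‖ * ‖y‖) * ((Λ * M ^ 2) * ‖x‖ * ‖y‖) := by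
      refine this.trans (le_of_eq (by ring))
    exact le_of_mul_le_mul_left this (by positivity)
  rw [abs_le]
  refine ⟨?_, h2 x y⟩
  have := h2 (-x) y
  have e : bil (Q t) (-x) y = - bil (Q t) x y := by simp [bil]
  rw [e, norm_neg] at this
  linarith

/-- comparison on truncated regions -/
lemma comparison2 {u : SpaceTime (d + 1) → ℝ} (hu : ObliqueSub d lam Q v u)
    (huc : ContinuousOn u (closure (Kc d 1))) (c : Eucl (d + 1)) (ρ ta tb : ℝ)
    {W : SpaceTime (d + 1) → ℝ}
    (hW : ContinuousOn W (closure (Kc d 1) ∩ {q | ‖q.1 - c‖ ≤ ρ ∧ ta ≤ q.2 ∧ q.2 ≤ tb}))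
    (hb : ∀ q ∈ closure (Kc d 1), ‖q.1 - c‖ ≤ ρ → ta ≤ q.2 → q.2 ≤ tb →
      (‖q.1‖ = 1 ∨ q.2 = -1) ∨ ‖q.1 - c‖ = ρ ∨ q.2 = ta → u q ≤ W q)
    (hi : ∀ q ∈ closure (Kc d 1), ‖q.1 - c‖ < ρ → ta < q.2 → q.2 ≤ tb →
      (q ∈ Kc d 1 ∨ q ∈ Fc d 1) → ∃ L β p, GJ (PF q) (Q q.2) lam (v q.2) q W L β p ∧
        (q ∈ Kc d 1 → L < 0) ∧ (q ∈ Fc d 1 → β < 0)) :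
    ∀ q ∈ closure (Kc d 1), ‖q.1 - c‖ ≤ ρ → ta ≤ q.2 → q.2 ≤ tb → u q ≤ W q := by
  intro q hq h1 h2 h3
  refine comparison hu huc (G := closure (Kc d 1) ∩ {q | ‖q.1 - c‖ ≤ ρ ∧ ta ≤ q.2 ∧ q.2 ≤ tb})
    ?_ inter_subset_left hW ?_ q ⟨hq, h1, h2, h3⟩
  · refine (isCompact_closure_Kc d).inter_right ?_
    have c1 : Continuous fun q : SpaceTime (d + 1) => ‖q.1 - c‖ := by fun_prop
    exact (isClosed_le c1 continuous_const).inter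
      ((isClosed_le continuous_const continuous_snd).inter (isClosed_le continuous_snd continuous_const))
  rintro p₀ ⟨hp, g1, g2, g3⟩ hlt
  have hnb : ¬ ((‖p₀.1‖ = 1 ∨ p₀.2 = -1) ∨ ‖p₀.1 - c‖ = ρ ∨ p₀.2 = ta) :=
    fun h => absurd (hb p₀ hp g1 g2 g3 h) (not_le.2 hlt)
  have i1 : ‖p₀.1 - c‖ < ρ := lt_of_le_of_ne g1 fun h => hnb (Or.inr (Or.inl h))
  have i2 : ta < p₀.2 := lt_of_le_of_ne g2 fun h => hnb (Or.inr (Or.inr h.symm))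
  have i3 : p₀ ∈ Kc d 1 ∨ p₀ ∈ Fc d 1 := by
    rcases trichotomy hp with h | h
    · exact (hnb (Or.inl h)).elim
    · exact h
  refine ⟨?_, i3, ?_⟩
  · have c1 : Continuous fun q : SpaceTime (d + 1) => ‖q.1 - c‖ := by fun_prop
    have o1 : ∀ᶠ q : SpaceTime (d + 1) in 𝓝 p₀, ‖q.1 - c‖ < ρ ∧ ta < q.2 :=
      ((isOpen_lt c1 continuous_const).inter (isOpen_lt continuous_const continuous_snd)).mem_nhds
        ⟨i1, i2⟩
    filter_upwards [o1.filter_mono (PF_le _), self_mem_nhdsWithin] with q hq hq2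
    exact ⟨hq2.1, hq.1.le, hq.2.le, le_trans hq2.2 g3⟩
  · obtain ⟨L, β, p, ⟨b, A, hJ, e1, e2⟩, hL, hβ⟩ := hi p₀ hp i1 i2 g3 i3
    exact ⟨b, p, A, hJ, fun h => by linarith [hL h], fun h => by linarith [hβ h]⟩

end
end GH

noncomputable section GH

lemma abs_le_of_sq_le_sq'' {a b : ℝ} (h : a ^ 2 ≤ b ^ 2) (hb : 0 ≤ b) : a ≤ b :=
  (le_abs_self a).trans (abs_le_of_sq_le_sq h hb)

section
variable {d : ℕ}

lemma primeDist_sq (x y : Eucl (d + 1)) :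
    primeDist x y ^ 2 + (lastC x - lastC y) ^ 2 = ‖x - y‖ ^ 2 := by
  rw [primeDist, Real.sq_sqrt (Finset.sum_nonneg fun _ _ => sq_nonneg _), EuclideanSpace.norm_sq_eq,
    Fin.sum_univ_castSucc]
  simp [lastC]

lemma primeDist_nonneg (x y : Eucl (d + 1)) : 0 ≤ primeDist x y := Real.sqrt_nonneg _

lemma primeDist_le (x y : Eucl (d + 1)) : primeDist x y ≤ ‖x - y‖ := by
  have h := primeDist_sq x y
  refine abs_le_of_sq_le_sq'' ?_ (norm_nonneg _)
  nlinarith [sq_nonneg (lastC x - lastC y)]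

lemma norm_le_primeDist (x y : Eucl (d + 1)) : ‖x - y‖ ≤ primeDist x y + |lastC x - lastC y| := by
  have h := primeDist_sq x y
  have h0 := primeDist_nonneg x y
  have h1 := abs_nonneg (lastC x - lastC y)
  refine abs_le_of_sq_le_sq'' ?_ (by positivity)
  nlinarith [sq_abs (lastC x - lastC y), mul_nonneg h0 h1]

lemma pdistL_eq {lam : ℝ} (hl : 0 < lam) (X Y : SpaceTime (d + 1)) :
    pdistL lam X Y = primeDist X.1 Y.1 + min (|lastC X.1| + |lastC Y.1| + |X.2 - Y.2|)
      (|lastC X.1 - lastC Y.1| + Real.sqrt (|X.2 - Y.2| / lam)) := by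
  have e1 : primeDist (lam • X.1) (lam • Y.1) = lam * primeDist X.1 Y.1 := by
    rw [primeDist, primeDist, ← Real.sqrt_sq hl.le, ← Real.sqrt_mul (sq_nonneg _), Real.sqrt_sq hl.le,
      Finset.mul_sum]
    congr 1
    refine Finset.sum_congr rfl fun i _ => ?_
    simp; ring
  have e2 : Real.sqrt |lam * X.2 - lam * Y.2| = lam * Real.sqrt (|X.2 - Y.2| / lam) := by
    rw [← mul_sub, abs_mul, abs_of_pos hl]
    conv_rhs => rw [← Real.sqrt_sq hl.le, ← Real.sqrt_mul (sq_nonneg _), Real.sqrt_sq hl.le]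
    congr 1; field_simp
  rw [pdistL, pdist]
  simp only [e2]
  simp only [e1, lastC_smul, ← mul_sub, abs_mul, abs_of_pos hl, ← mul_add]
  rw [← mul_min_of_nonneg _ _ hl.le, ← mul_add]
  field_simp

lemma pdistL_nonneg {lam : ℝ} (hl : 0 < lam) (X Y : SpaceTime (d + 1)) : 0 ≤ pdistL lam X Y := by
  rw [pdistL_eq hl]
  have := primeDist_nonneg X.1 Y.1
  have : 0 ≤ min (|lastC X.1| + |lastC Y.1| + |X.2 - Y.2|)
      (|lastC X.1 - lastC Y.1| + Real.sqrt (|X.2 - Y.2| / lam)) := by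
    apply le_min <;> positivity
  linarith

lemma pdistL_le1 {lam : ℝ} (hl : 0 < lam) (X Y : SpaceTime (d + 1)) (hY : lastC Y.1 = 0) :
    pdistL lam X Y ≤ 2 * ‖X.1 - Y.1‖ + |X.2 - Y.2| := by
  rw [pdistL_eq hl]
  have h1 := primeDist_le X.1 Y.1
  have h2 := abs_lastC_le (X.1 - Y.1)
  rw [lastC_sub, hY, sub_zero] at h2
  have := min_le_left (|lastC X.1| + |lastC Y.1| + |X.2 - Y.2|)
      (|lastC X.1 - lastC Y.1| + Real.sqrt (|X.2 - Y.2| / lam))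
  rw [hY, abs_zero] at *
  linarith

lemma pdistL_le2 {lam : ℝ} (hl : 0 < lam) (X Y : SpaceTime (d + 1)) :
    pdistL lam X Y ≤ 2 * ‖X.1 - Y.1‖ + Real.sqrt (|X.2 - Y.2| / lam) := by
  rw [pdistL_eq hl]
  have h1 := primeDist_le X.1 Y.1
  have h2 := abs_lastC_le (X.1 - Y.1)
  rw [lastC_sub] at h2
  have := min_le_right (|lastC X.1| + |lastC Y.1| + |X.2 - Y.2|)
      (|lastC X.1 - lastC Y.1| + Real.sqrt (|X.2 - Y.2| / lam))
  linarith

lemma norm_le_pdistL {lam : ℝ} (hl : 0 < lam) (X Y : SpaceTime (d + 1)) :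
    ‖X.1 - Y.1‖ ≤ pdistL lam X Y := by
  rw [pdistL_eq hl]
  have h1 := norm_le_primeDist X.1 Y.1
  have h2 : |lastC X.1 - lastC Y.1| ≤ min (|lastC X.1| + |lastC Y.1| + |X.2 - Y.2|)
      (|lastC X.1 - lastC Y.1| + Real.sqrt (|X.2 - Y.2| / lam)) := by
    apply le_min
    · have := abs_sub (lastC X.1) (lastC Y.1)
      have := abs_nonneg (X.2 - Y.2)
      linarith
    · have := Real.sqrt_nonneg (|X.2 - Y.2| / lam)
      linarith
  linarith

lemma time_le_pdistL {lam : ℝ} (hl : 0 < lam) (X Y : SpaceTime (d + 1)) :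
    min (2 * |lastC Y.1| + |X.2 - Y.2|) (Real.sqrt (|X.2 - Y.2| / lam)) ≤ 2 * pdistL lam X Y := by
  rw [pdistL_eq hl]
  have h0 := primeDist_nonneg X.1 Y.1
  have a1 := abs_nonneg (lastC X.1)
  have a3 := abs_nonneg (X.2 - Y.2)
  have a2 := abs_nonneg (lastC X.1 - lastC Y.1)
  have a4 := Real.sqrt_nonneg (|X.2 - Y.2| / lam)
  rcases min_choice (|lastC X.1| + |lastC Y.1| + |X.2 - Y.2|)
      (|lastC X.1 - lastC Y.1| + Real.sqrt (|X.2 - Y.2| / lam)) with h | h <;> rw [h]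
  · refine (min_le_left _ _).trans ?_
    linarith
  · refine (min_le_right _ _).trans ?_
    linarith

end

/-- the working package -/
structure HB (d : ℕ) (lam Λ M C₀ α N : ℝ) (Q Q' : ℝ → Matrix (Fin (d + 1)) (Fin (d + 1)) ℝ)
    (v v' : ℝ → Eucl (d + 1)) (u : SpaceTime (d + 1) → ℝ) : Prop where
  D : ObliqueData d lam Λ M C₀ Q Q' v v'
  a0 : 0 < α
  a1 : α ≤ 1 / 2
  hN : 0 < N
  sub : ObliqueSub d lam Q v u
  sub' : ObliqueSub d lam Q v (fun q => - u q)
  cont : ContinuousOn u (closure (Kc d 1))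
  bd : ∀ X ∈ closure (Kc d 1), |u X| ≤ N
  data : ∀ X ∈ bdryK d, ∀ Y ∈ bdryK d, |u X - u Y| ≤ N * pdistL lam X Y ^ α

section
variable {d : ℕ} {lam Λ M C₀ α N : ℝ} {Q Q' : ℝ → Matrix (Fin (d + 1)) (Fin (d + 1)) ℝ}
  {v v' : ℝ → Eucl (d + 1)} {u : SpaceTime (d + 1) → ℝ}

lemma HB.neg (h : HB d lam Λ M C₀ α N Q Q' v v' u) :
    HB d lam Λ M C₀ α N Q Q' v v' (fun q => - u q) where
  D := h.D
  a0 := h.a0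
  a1 := h.a1
  hN := h.hN
  sub := h.sub'
  sub' := by simpa using h.sub
  cont := h.cont.neg
  bd := fun X hX => by rw [abs_neg]; exact h.bd X hX
  data := fun X hX Y hY => by
    rw [show - u X - - u Y = -(u X - u Y) by ring, abs_neg]; exact h.data X hX Y hY

lemma HB.bd2 (h : HB d lam Λ M C₀ α N Q Q' v v' u) {X Y : SpaceTime (d + 1)}
    (hX : X ∈ closure (Kc d 1)) (hY : Y ∈ closure (Kc d 1)) : u X - u Y ≤ 2 * N := by
  have h1 := abs_le.1 (h.bd X hX)
  have h2 := abs_le.1 (h.bd Y hY)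
  linarith [h1.2, h2.1]

lemma HB.data1 (h : HB d lam Λ M C₀ α N Q Q' v v' u) {X Y : SpaceTime (d + 1)}
    (hX : X ∈ bdryK d) (hY : Y ∈ bdryK d) {D0 : ℝ} (hD : pdistL lam X Y ≤ D0) :
    u X - u Y ≤ N * D0 ^ α :=
  (le_abs_self _).trans ((h.data X hX Y hY).trans (mul_le_mul_of_nonneg_left
    (Real.rpow_le_rpow (pdistL_nonneg h.D.lam_pos _ _) hD h.a0.le) h.hN.le))

/-- `(c s)^α ≤ c s^α` for `c ≥ 1`. -/
lemma mul_rpow_le {c s α : ℝ} (hc : 1 ≤ c) (hs : 0 ≤ s) (a1 : α ≤ 1) :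
    (c * s) ^ α ≤ c * s ^ α := by
  rw [Real.mul_rpow (by linarith) hs]
  apply mul_le_mul_of_nonneg_right _ (Real.rpow_nonneg hs _)
  calc c ^ α ≤ c ^ (1 : ℝ) := Real.rpow_le_rpow_of_exponent_le hc a1
    _ = c := Real.rpow_one c

lemma rpow_le_mul {x c s α : ℝ} (hx : 0 ≤ x) (hxs : x ≤ c * s) (hc : 1 ≤ c) (hs : 0 ≤ s) (a0 : 0 ≤ α)
    (a1 : α ≤ 1) : x ^ α ≤ c * s ^ α :=
  (Real.rpow_le_rpow hx hxs a0).trans (mul_rpow_le hc hs a1)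

lemma sq_rpow_half {r α : ℝ} (hr : 0 ≤ r) : (r ^ 2) ^ (α / 2) = r ^ α := by
  rw [← Real.rpow_natCast, ← Real.rpow_mul hr]; congr 1; push_cast; ring

lemma le_half_rpow {r S α : ℝ} (hr : 0 ≤ r) (hS : r ^ 2 ≤ S) (a0 : 0 ≤ α) : r ^ α ≤ S ^ (α / 2) := by
  rw [← sq_rpow_half hr]; exact Real.rpow_le_rpow (sq_nonneg _) hS (by linarith)

lemma half_rpow_le {r S α : ℝ} (hr : 0 ≤ r) (h0 : 0 ≤ S) (hS : S ≤ r ^ 2) (a0 : 0 ≤ α) :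
    S ^ (α / 2) ≤ r ^ α := by
  rw [← sq_rpow_half hr]; exact Real.rpow_le_rpow h0 hS (by linarith)

lemma one_le_rpow' {r α : ℝ} (hr : 1 ≤ r) (a0 : 0 ≤ α) : 1 ≤ r ^ α := Real.one_le_rpow hr a0

end
end GH

noncomputable section GH

/-- constants of the corner barrier -/
def bH (M : ℝ) : ℝ := 1 + 4 * M ^ 2
def bmu (d : ℕ) (Λ M : ℝ) : ℝ :=
  (Λ * M ^ 2) * (bH M * (Λ * M ^ 2 * (d + 1) + 1 + 5 * (Λ * M ^ 2)) + 1)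

section
variable {d : ℕ} {lam Λ M C₀ α N : ℝ} {Q Q' : ℝ → Matrix (Fin (d + 1)) (Fin (d + 1)) ℝ}
  {v v' : ℝ → Eucl (d + 1)} {u : SpaceTime (d + 1) → ℝ}

lemma qf_two (A : Matrix (Fin (d + 1)) (Fin (d + 1)) ℝ) (z : Eucl (d + 1)) (c : ℝ) :
    qf A (c • z) = c ^ 2 * qf A z := by
  simp [qf, real_inner_smul_left, real_inner_smul_right]; ring

lemma bil_smul (A : Matrix (Fin (d + 1)) (Fin (d + 1)) ℝ) (x y : Eucl (d + 1)) (a b : ℝ) :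
    bil A (a • x) (b • y) = a * b * bil A x y := by
  simp [bil, real_inner_smul_left, real_inner_smul_right]; ring

set_option maxHeartbeats 4000000 in
/-- pointwise barrier computation at corner points -/
lemma corner_barrier (D : ObliqueData d lam Λ M C₀ Q Q' v v') (a0 : 0 < α) (a1 : α ≤ 1 / 2)
    (hα1 : 4 * α * (Λ * M ^ 2) * bH M ≤ 1 / 2)
    (hα2 : 2 * Real.exp (2 * (bmu d Λ M * bH M)) * α * (Λ * M ^ 2 * (d + 1) + 1) * (M + 1)
      < bmu d Λ M / 2)
    {y : Eucl (d + 1)} (hy : ‖y‖ = 1) (hyn : lastC y = 0) {tb : ℝ} (htb : tb ∈ Icc (-1 : ℝ) 0)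
    {q : SpaceTime (d + 1)} (hq : q ∈ closure (Kc d 1)) (hqt : q.2 ≤ tb)
    (hqy : q.1 ≠ y) :
    ∃ L β p, GJ (PF q) (Q q.2) lam (v q.2) q
      (fun q => (‖q.1 - y‖ ^ 2 + (q.2 - tb) ^ 2) ^ (α / 2) *
        (2 * Real.exp (bmu d Λ M * bH M) + -1 * Real.exp (bmu d Λ M *
          (⟪y + (4 * M ^ 2) • eN d, q.1 - y⟫ * (‖q.1 - y‖ ^ 2 + (q.2 - tb) ^ 2) ^ (-1 / 2 : ℝ))))) L β p
       ∧ L < 0 ∧ (lastC q.1 = 0 → β < 0) := by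
  obtain ⟨hq1, hq2, hq3, hq4⟩ := mem_closure_Kc.1 hq
  have ht : q.2 ∈ Icc (-1 : ℝ) 0 := ⟨hq3, hq4⟩
  have hl := PF_le q
  have hk := kap_ge_one D
  have hM := D.M_ge_one
  set κ := Λ * M ^ 2 with hκ
  set H := bH M with hH
  set μ := bmu d Λ M with hμ
  set a := y + (4 * M ^ 2) • eN d with ha
  have hMM : 1 ≤ M ^ 2 := by nlinarith only [hM]
  have hH1 : 1 ≤ H := by rw [hH, bH]; linarith only [hMM]
  have hn0 : (0 : ℝ) ≤ d := Nat.cast_nonneg d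
  have hμ0 : 1 ≤ μ := by
    rw [hμ, bmu, ← hH, ← hκ]
    have : 0 ≤ H * (κ * (d + 1) + 1 + 5 * κ) := by positivity
    nlinarith only [this, hk]
  set z := q.1 - y with hz
  set σ := tb - q.2 with hσ
  have hσ0 : 0 ≤ σ := by linarith
  have hσ1 : σ ≤ 1 := by linarith [htb.2]
  have hz0 : z ≠ 0 := sub_ne_zero.2 hqy
  set S := ‖z‖ ^ 2 + (q.2 - tb) ^ 2 with hS
  have hS0 : 0 < S := by have := norm_pos_iff.2 hz0; positivity
  set i := S ^ (-1 / 2 : ℝ) with hi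
  have hi0 : 0 < i := Real.rpow_pos_of_pos hS0 _
  have hiS : i ^ 2 * S = 1 := by
    rw [hi, ← Real.rpow_natCast, ← Real.rpow_mul hS0.le]
    norm_num
    rw [Real.rpow_neg_one]; field_simp
  have hSi : S⁻¹ = i ^ 2 := by field_simp; linarith
  have e1 : S ^ (-1 / 2 - 1 : ℝ) = i ^ 3 := by
    rw [Real.rpow_sub hS0, Real.rpow_one, ← hi, div_eq_mul_inv, hSi]; ring
  have e2 : S ^ (-1 / 2 - 2 : ℝ) = i ^ 5 := by
    rw [Real.rpow_sub hS0, ← hi, Real.rpow_two, div_eq_mul_inv, ← inv_pow, hSi]; ring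
  set R := S ^ (α / 2) with hR
  have hR0 : 0 < R := Real.rpow_pos_of_pos hS0 _
  have e3 : S ^ (α / 2 - 1) = R * i ^ 2 := by
    rw [Real.rpow_sub hS0, Real.rpow_one, ← hR, div_eq_mul_inv, hSi]
  have e4 : S ^ (α / 2 - 2) = R * i ^ 4 := by
    rw [Real.rpow_sub hS0, ← hR, Real.rpow_two, div_eq_mul_inv, ← inv_pow, hSi]; ring
  -- geometry
  have hzi : i * ‖z‖ ≤ 1 := by
    apply abs_le_of_sq_le_sq'' _ one_pos.le
    rw [mul_pow, one_pow, ← hiS, hS]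
    have : 0 ≤ i ^ 2 * (q.2 - tb) ^ 2 := by positivity
    linarith
  have hσi : i * σ ≤ 1 := by
    apply abs_le_of_sq_le_sq'' _ one_pos.le
    rw [mul_pow, one_pow, ← hiS, hS, hσ]
    have : 0 ≤ i ^ 2 * ‖z‖ ^ 2 := by positivity
    linarith only [this]
  have haH : ‖a‖ ≤ H := by
    rw [ha, hH, bH]
    refine (norm_add_le _ _).trans ?_
    rw [hy, norm_smul, norm_eN, Real.norm_of_nonneg (by positivity)]; linarith
  have hyz : ⟪y, z⟫ ≤ 0 := by
    rw [hz, inner_sub_right, real_inner_self_eq_norm_sq, hy]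
    have := real_inner_le_norm y q.1
    rw [hy] at this; linarith
  have hzn : lastC z = lastC q.1 := by rw [hz, lastC_sub, hyn, sub_zero]
  set m := ⟪a, z⟫ with hm
  have hme : m = ⟪y, z⟫ + 4 * M ^ 2 * lastC q.1 := by
    rw [hm, ha, inner_add_left, real_inner_smul_left, inner_eN, hzn]
  have hmi : |m * i| ≤ H := by
    rw [abs_mul, abs_of_pos hi0]
    have h1 := abs_real_inner_le_norm a z
    calc |m| * i ≤ (‖a‖ * ‖z‖) * i := by gcongr
      _ = ‖a‖ * (i * ‖z‖) := by ring
      _ ≤ H * 1 := by gcongr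
      _ = H := mul_one _
  obtain ⟨hmi1, hmi2⟩ := abs_le.1 hmi
  -- jets
  set T := (Q q.2).trace with hT
  have hT1 : T ≤ κ * (d + 1) := Q_trace D ht
  have hT0 : 0 < T := Q_trace_nonneg D ht
  have hlam := D.lam_pos
  have hlam1 := D.lam_le_one
  have jS : GJ (PF q) (Q q.2) lam (v q.2) q (fun q => ‖q.1 - y‖ ^ 2 + (q.2 - tb) ^ 2)
      (2 * (T + lam * σ)) (2 * (⟪v q.2, z⟫ + σ)) ((2 : ℝ) • z) := by
    refine ((GJ.nsq hl y).add ((GJ.time hl tb).sq hl)).congr ?_ ?_ ?_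
    · simp only [qf, map_zero, inner_zero_left]; rw [hσ]; ring
    · rw [hσ]; ring
    · simp [hz]
  have jf2 := jS.rpow hl hS0 (-1 / 2)
  have jh := ((GJ.lin hl a y).mul hl (D.Qsymm _ ht) jf2)
  have jh' : GJ (PF q) (Q q.2) lam (v q.2) q
      (fun q => ⟪a, q.1 - y⟫ * (‖q.1 - y‖ ^ 2 + (q.2 - tb) ^ 2) ^ (-1 / 2 : ℝ))
      (i ^ 2 * ((m * i) * (-(T + lam * σ) + 3 * (i ^ 2 * qf (Q q.2) z)) - 2 * (i * bil (Q q.2) a z)))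
      (i * (⟪v q.2, a⟫ - (m * i) * (i * (⟪v q.2, z⟫ + σ))))
      (i • (a - (m * i ^ 2) • z)) := by
    refine jh.congr ?_ ?_ ?_
    · simp only [← hz, ← hS, e1, e2, ← hi, ← hm]
      rw [smul_smul, show a = (1 : ℝ) • a by simp, bil_smul, qf_two, one_smul]; ring
    · simp only [← hz, ← hS, e1, ← hi, ← hm]; ring
    · simp only [← hz, ← hS, e1, ← hi, ← hm]; module
  clear jh jf2
  set Lh := (i ^ 2 * ((m * i) * (-(T + lam * σ) + 3 * (i ^ 2 * qf (Q q.2) z)) - 2 * (i * bil (Q q.2) a z))) with hLh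
  set βh := (i * (⟪v q.2, a⟫ - (m * i) * (i * (⟪v q.2, z⟫ + σ)))) with hβh
  set g := a - (m * i ^ 2) • z with hg
  have jE := (jh'.const_mul μ).exp hl
  have jg := (GJ.const (l := PF q) (Qm := Q q.2) (lam := lam) (w := v q.2) (p₀ := q)
    (2 * Real.exp (μ * H))).add (jE.const_mul (-1))
  have jR := jS.rpow hl hS0 (α / 2)
  have jw := jR.mul hl (D.Qsymm _ ht) jg
  refine ⟨_, _, _, jw, ?_, ?_⟩
  all_goals clear jw jR jg jE jh' jS
  all_goals simp only [← hz, ← hS, e3, e4, ← hi, ← hm, ← hR]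
  all_goals set E := Real.exp (μ * (m * i)) with hE
  all_goals set A0 := 2 * Real.exp (μ * H) with hA0
  all_goals
    have hE1 : Real.exp (- (μ * H)) ≤ E := by
      apply Real.exp_le_exp.2
      nlinarith only [hμ0, hmi1]
    have hE2 : E ≤ Real.exp (μ * H) := by
      apply Real.exp_le_exp.2
      nlinarith only [hμ0, hmi2]
    have hE0 : 0 < E := Real.exp_pos _
    have hcon : A0 * α * (κ * (d + 1) + 1) * (M + 1) < μ * E / 2 := by
      have x1 : Real.exp (2 * (μ * H)) * Real.exp (- (μ * H)) = Real.exp (μ * H) := by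
        rw [← Real.exp_add]; congr 1; ring
      have x2 := mul_lt_mul_of_pos_right hα2 (Real.exp_pos (- (μ * H)))
      have x3 : μ / 2 * Real.exp (- (μ * H)) ≤ μ * E / 2 := by nlinarith only [hμ0, hE1]
      calc A0 * α * (κ * (d + 1) + 1) * (M + 1)
        = 2 * (Real.exp (2 * (μ * H)) * Real.exp (- (μ * H))) * α * (κ * (d + 1) + 1) * (M + 1) := by
            rw [x1]
        _ = 2 * Real.exp (2 * (μ * H)) * α * (κ * (d + 1) + 1) * (M + 1) * Real.exp (- (μ * H)) := by ring
        _ < _ := x2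
        _ ≤ _ := x3
    have hgg : 0 ≤ A0 + -1 * E := by rw [hA0]; linarith
    have hgA : A0 + -1 * E ≤ A0 := by linarith
  · -- interior
    have q1 : i ^ 2 * qf (Q q.2) z ≤ κ := by
      have := Q_upper D ht z
      calc i ^ 2 * qf (Q q.2) z ≤ i ^ 2 * (κ * ‖z‖ ^ 2) := by gcongr
        _ = κ * (i * ‖z‖) ^ 2 := by ring
        _ ≤ κ * 1 ^ 2 := by gcongr
        _ = κ := by ring
    have q0 : 0 ≤ i ^ 2 * qf (Q q.2) z := mul_nonneg (by positivity) (Q_qf_nonneg D ht z)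
    have q2 : |i * bil (Q q.2) a z| ≤ κ * H := by
      have := Q_bil D ht a z
      rw [abs_mul, abs_of_pos hi0]
      calc i * |bil (Q q.2) a z| ≤ i * (κ * ‖a‖ * ‖z‖) := by gcongr
        _ = κ * ‖a‖ * (i * ‖z‖) := by ring
        _ ≤ κ * H * 1 := by gcongr
        _ = κ * H := by ring
    obtain ⟨q3, q4⟩ := abs_le.1 q2
    have hls : lam * σ ≤ 1 := by nlinarith only [hlam1, hσ1, hσ0, hlam]
    have hls0 : 0 ≤ lam * σ := by positivity
    have hX : |(m * i) * (-(T + lam * σ) + 3 * (i ^ 2 * qf (Q q.2) z))| ≤ H * (κ * (d + 1) + 1 + 3 * κ) := by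
      rw [abs_mul]
      apply mul_le_mul hmi _ (abs_nonneg _) (by linarith)
      rw [abs_le]; constructor <;> linarith only [q1, q0, hls, hls0, hT1, hT0, hk]
    have hLh1 : -(i ^ 2 * (H * (κ * (d + 1) + 1 + 5 * κ))) ≤ Lh := by
      rw [hLh, ← mul_neg]
      apply mul_le_mul_of_nonneg_left _ (by positivity)
      have := (abs_le.1 hX).1
      nlinarith only [this, q3, q4]
    have hgn : 1 ≤ ‖g‖ := by
      rcases le_total 0 m with h | h
      · have h1 : 1 ≤ ⟪g, y⟫ := by
          rw [hg, inner_sub_left, real_inner_smul_left, real_inner_comm y z, ha, inner_add_left, real_inner_smul_left,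
            inner_eN, hyn, real_inner_self_eq_norm_sq, hy]
          have : m * i ^ 2 * ⟪y, z⟫ ≤ 0 := mul_nonpos_of_nonneg_of_nonpos (by positivity) hyz
          linarith
        have := real_inner_le_norm g y
        rw [hy] at this; linarith
      · have h1 : 1 ≤ ⟪eN d, g⟫ := by
          rw [inner_eN, hg, lastC_sub, lastC_smul, ha, lastC_add, lastC_smul, lastC_eN, hyn, hzn]
          have : m * i ^ 2 * lastC q.1 ≤ 0 :=
            mul_nonpos_of_nonpos_of_nonneg (mul_nonpos_of_nonpos_of_nonneg h (by positivity)) hq2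
          linarith only [this, hMM]
        have := real_inner_le_norm (eN d) g
        rw [norm_eN] at this; linarith
    have hgu : ‖g‖ ≤ 2 * H := by
      rw [hg]
      refine (norm_sub_le _ _).trans ?_
      rw [norm_smul, Real.norm_eq_abs]
      have : |m * i ^ 2| * ‖z‖ ≤ H * 1 := by
        calc |m * i ^ 2| * ‖z‖ = |m * i| * (i * ‖z‖) := by
              rw [show m * i ^ 2 = (m * i) * i by ring, abs_mul _ i, abs_of_pos hi0]; ring
          _ ≤ H * 1 := by gcongr
      linarith
    have hqg : κ⁻¹ * i ^ 2 ≤ qf (Q q.2) (i • g) := by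
      refine le_trans ?_ (Q_lower D ht _)
      rw [norm_smul, Real.norm_of_nonneg hi0.le, mul_pow]
      have : 1 ≤ ‖g‖ ^ 2 := by nlinarith only [hgn]
      have hk' : 0 < κ⁻¹ := by positivity
      calc κ⁻¹ * i ^ 2 = κ⁻¹ * (i ^ 2 * 1) := by ring
        _ ≤ _ := by gcongr
    have hb : 2 * bil (Q q.2) ((α / 2 * (R * i ^ 2)) • (2 : ℝ) • z) (0 + (-1 : ℝ) • E • μ • i • g)
        ≤ (R * i ^ 2) * (μ * E / 2) := by
      rw [zero_add, smul_smul, smul_smul, smul_smul, smul_smul, bil_smul]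
      have h1 := neg_le_of_abs_le (Q_bil D ht z g)
      have h2 : -(i * bil (Q q.2) z g) ≤ κ * (2 * H) := by
        calc -(i * bil (Q q.2) z g) ≤ i * (κ * ‖z‖ * ‖g‖) := by nlinarith only [h1, hi0]
          _ = κ * (i * ‖z‖) * ‖g‖ := by ring
          _ ≤ κ * 1 * (2 * H) := by gcongr
          _ = _ := by ring
      have h3 : 0 ≤ (R * i ^ 2) * (μ * E) * (2 * α) := by positivity
      have h4 := mul_le_mul_of_nonneg_left h2 h3
      have h5 : 0 ≤ (R * i ^ 2) * (μ * E) := by positivity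
      have h6 := mul_le_mul_of_nonneg_left hα1 h5
      linarith only [h4, h6]
    have hgR : (A0 + -1 * E) * (α / 2 * (R * i ^ 2) * (2 * (T + lam * σ)) +
        α / 2 * ((α / 2 - 1) * (R * i ^ 4)) * qf (Q q.2) ((2 : ℝ) • z)) ≤
        (R * i ^ 2) * (A0 * α * (κ * (d + 1) + 1)) := by
      have h1 : α / 2 * ((α / 2 - 1) * (R * i ^ 4)) * qf (Q q.2) ((2 : ℝ) • z) ≤ 0 := by
        apply mul_nonpos_of_nonpos_of_nonneg _ (Q_qf_nonneg D ht _)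
        have : 0 ≤ R * i ^ 4 := by positivity
        apply mul_nonpos_of_nonneg_of_nonpos (by linarith)
        apply mul_nonpos_of_nonpos_of_nonneg (by linarith) this
      have h2 : α / 2 * (R * i ^ 2) * (2 * (T + lam * σ)) ≤ (R * i ^ 2) * (α * (κ * (d + 1) + 1)) := by
        have : 0 ≤ R * i ^ 2 * α := by positivity
        linarith only [mul_le_mul_of_nonneg_left (add_le_add hT1 hls) this]
      calc _ ≤ (A0 + -1 * E) * ((R * i ^ 2) * (α * (κ * (d + 1) + 1))) := by
            apply mul_le_mul_of_nonneg_left _ hgg; linarith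
        _ ≤ A0 * ((R * i ^ 2) * (α * (κ * (d + 1) + 1))) := by
            apply mul_le_mul_of_nonneg_right hgA; positivity
        _ = _ := by ring
    have hLg : R * (0 + -1 * (E * (μ * Lh) + E * qf (Q q.2) (μ • i • g))) ≤ -((R * i ^ 2) * (μ * E)) := by
      rw [qf_two]
      have h1 : μ * (κ⁻¹) = H * (κ * (d + 1) + 1 + 5 * κ) + 1 := by
        rw [hμ, bmu, ← hκ, ← hH]; field_simp
      have h2 : i ^ 2 * μ ≤ μ * Lh + μ ^ 2 * qf (Q q.2) (i • g) := by
        have h3 := mul_le_mul_of_nonneg_left hqg (by positivity : 0 ≤ μ ^ 2)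
        have h4 := mul_le_mul_of_nonneg_left hLh1 (by linarith : 0 ≤ μ)
        have h5 : μ ^ 2 * (κ⁻¹ * i ^ 2) = μ * i ^ 2 * (H * (κ * (d + 1) + 1 + 5 * κ) + 1) := by
          rw [← h1]; ring
        linarith only [h3, h4, h5]
      have h6 := mul_le_mul_of_nonneg_left h2 (by positivity : 0 ≤ R * E)
      linarith only [h6]
    have hfin : (R * i ^ 2) * (A0 * α * (κ * (d + 1) + 1)) < (R * i ^ 2) * (μ * E / 2) := by
      apply mul_lt_mul_of_pos_left _ (by positivity)
      refine lt_of_le_of_lt ?_ hcon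
      have : 0 ≤ A0 * α * (κ * (d + 1) + 1) := by positivity
      exact le_mul_of_one_le_right this (by linarith only [hM])
    linarith only [hfin, hLg, hgR, hb]
  · intro hF
    have hm2 : m ≤ 0 := by rw [hme, hF]; linarith
    have hm3 : -1 ≤ m * i := by
      rw [hme, hF, mul_zero, add_zero]
      have h1 := neg_le_of_abs_le (abs_real_inner_le_norm y z)
      rw [hy, one_mul] at h1
      nlinarith only [h1, hi0, hzi]
    have hvb := D.vbound _ ht
    have hvz : |i * (⟪v q.2, z⟫ + σ)| ≤ M + 1 := by
      rw [mul_add]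
      refine (abs_add_le _ _).trans ?_
      have h1 : |i * ⟪v q.2, z⟫| ≤ M * 1 := by
        rw [abs_mul, abs_of_pos hi0]
        calc i * |⟪v q.2, z⟫| ≤ i * (‖v q.2‖ * ‖z‖) := by
              gcongr; exact abs_real_inner_le_norm _ _
          _ = ‖v q.2‖ * (i * ‖z‖) := by ring
          _ ≤ M * 1 := by gcongr
      have h2 : |i * σ| ≤ 1 := by rw [abs_of_nonneg (by positivity)]; exact hσi
      linarith
    have hva : 3 * M ≤ ⟪v q.2, a⟫ := by
      rw [ha, inner_add_right, real_inner_smul_right, real_inner_comm (eN d), inner_eN]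
      have h1 := neg_le_of_abs_le (abs_real_inner_le_norm (v q.2) y)
      rw [hy] at h1
      have h2 := D.vlast _ ht
      have h3 : 4 * M ^ 2 * M⁻¹ = 4 * M := by field_simp
      have h4 : 4 * M ^ 2 * M⁻¹ ≤ 4 * M ^ 2 * lastC (v q.2) := by gcongr
      linarith
    have hβ1 : i ≤ βh := by
      rw [hβh]
      obtain ⟨x1, x2⟩ := abs_le.1 hvz
      have hm4 : m * i ≤ 0 := mul_nonpos_of_nonpos_of_nonneg hm2 hi0.le
      have : 1 ≤ ⟪v q.2, a⟫ - (m * i) * (i * (⟪v q.2, z⟫ + σ)) := by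
        have : (m * i) * (i * (⟪v q.2, z⟫ + σ)) ≤ M + 1 := by
          nlinarith only [x1, x2, hm3, hm4, hM]
        linarith only [this, hva, hM]
      exact le_mul_of_one_le_right hi0.le this
    have h1 : (A0 + -1 * E) * (α / 2 * (R * i ^ 2) * (2 * (⟪v q.2, z⟫ + σ))) ≤
        (R * i) * (A0 * α * (M + 1)) := by
      have x2 := (abs_le.1 hvz).2
      have h2 : α / 2 * (R * i ^ 2) * (2 * (⟪v q.2, z⟫ + σ)) ≤ (R * i) * (α * (M + 1)) := by
        have : 0 ≤ R * i * α := by positivity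
        linarith only [mul_le_mul_of_nonneg_left x2 this]
      calc _ ≤ (A0 + -1 * E) * ((R * i) * (α * (M + 1))) := mul_le_mul_of_nonneg_left h2 hgg
        _ ≤ A0 * ((R * i) * (α * (M + 1))) := by
            apply mul_le_mul_of_nonneg_right hgA; positivity
        _ = _ := by ring
    have h2 : R * (0 + -1 * (E * (μ * βh))) ≤ -((R * i) * (μ * E)) := by
      have := mul_le_mul_of_nonneg_left hβ1 (by positivity : 0 ≤ R * (μ * E))
      linarith only [this]
    have h3 : (R * i) * (A0 * α * (M + 1)) < (R * i) * (μ * E) := by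
      apply mul_lt_mul_of_pos_left _ (by positivity)
      have x1 : 0 ≤ A0 * α * (M + 1) := by positivity
      have x2 : 0 ≤ κ * (d + 1) := by positivity
      have x3 : 0 < μ * E := by positivity
      nlinarith only [x1, x2, x3, hcon]
    linarith only [h1, h2, h3]

end
end GH

noncomputable section GH

section
variable {d : ℕ} {lam Λ M C₀ α N : ℝ} {Q Q' : ℝ → Matrix (Fin (d + 1)) (Fin (d + 1)) ℝ}
  {v v' : ℝ → Eucl (d + 1)} {u : SpaceTime (d + 1) → ℝ}

lemma hbound {a z : Eucl (d + 1)} {S : ℝ} (hS : ‖z‖ ^ 2 ≤ S) :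
    |⟪a, z⟫ * S ^ (-1 / 2 : ℝ)| ≤ ‖a‖ := by
  rcases eq_or_ne z 0 with rfl | hz
  · simp
  have hz0 := norm_pos_iff.2 hz
  have hS0 : 0 < S := lt_of_lt_of_le (by positivity) hS
  have hi0 : 0 < S ^ (-1 / 2 : ℝ) := Real.rpow_pos_of_pos hS0 _
  have hiS : (S ^ (-1 / 2 : ℝ)) ^ 2 * S = 1 := by
    rw [← Real.rpow_natCast, ← Real.rpow_mul hS0.le]
    norm_num
    rw [Real.rpow_neg_one]; field_simp
  have hzi : S ^ (-1 / 2 : ℝ) * ‖z‖ ≤ 1 := by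
    apply abs_le_of_sq_le_sq'' _ one_pos.le
    rw [mul_pow, one_pow]
    refine le_trans ?_ hiS.le
    gcongr
  rw [abs_mul, abs_of_pos hi0]
  have h1 := abs_real_inner_le_norm a z
  calc |⟪a, z⟫| * S ^ (-1 / 2 : ℝ) ≤ (‖a‖ * ‖z‖) * S ^ (-1 / 2 : ℝ) := by gcongr
    _ = ‖a‖ * (S ^ (-1 / 2 : ℝ) * ‖z‖) := by ring
    _ ≤ ‖a‖ * 1 := by gcongr
    _ = ‖a‖ := mul_one _

/-- smallness of the exponent -/
def aOK (d : ℕ) (Λ M α : ℝ) : Prop := 4 * α * (Λ * M ^ 2) * bH M ≤ 1 / 2 ∧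
    2 * Real.exp (2 * (bmu d Λ M * bH M)) * α * (Λ * M ^ 2 * (d + 1) + 1) * (M + 1) < bmu d Λ M / 2

def cB1 (d : ℕ) (Λ M : ℝ) : ℝ := 6 * Real.exp (bmu d Λ M * bH M)

lemma B1 (h : HB d lam Λ M C₀ α N Q Q' v v' u) (hα : aOK d Λ M α)
    {y : Eucl (d + 1)} (hy : ‖y‖ = 1) (hyn : lastC y = 0) {tb : ℝ} (htb : tb ∈ Icc (-1 : ℝ) 0) :
    ∀ X ∈ closure (Kc d 1), X.2 ≤ tb →
      u X - u (y, tb) ≤ cB1 d Λ M * N * (‖X.1 - y‖ + (tb - X.2)) ^ α := by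
  set w : SpaceTime (d + 1) → ℝ := fun q => (‖q.1 - y‖ ^ 2 + (q.2 - tb) ^ 2) ^ (α / 2) *
        (2 * Real.exp (bmu d Λ M * bH M) + -1 * Real.exp (bmu d Λ M *
          (⟪y + (4 * M ^ 2) • eN d, q.1 - y⟫ * (‖q.1 - y‖ ^ 2 + (q.2 - tb) ^ 2) ^ (-1 / 2 : ℝ)))) with hw
  have a0 := h.a0
  have a1 := h.a1
  have hN := h.hN
  have hM := h.D.M_ge_one
  have hk := kap_ge_one h.D
  have hH0 : 0 ≤ bH M := by rw [bH]; positivity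
  have hμ0 : 0 ≤ bmu d Λ M := by rw [bmu]; positivity
  have haH : ‖y + (4 * M ^ 2) • eN d‖ ≤ bH M := by
    rw [bH]
    refine (norm_add_le _ _).trans ?_
    rw [hy, norm_smul, norm_eN, Real.norm_of_nonneg (by positivity)]; linarith
  have hE : ∀ q : SpaceTime (d + 1), Real.exp (bmu d Λ M *
          (⟪y + (4 * M ^ 2) • eN d, q.1 - y⟫ * (‖q.1 - y‖ ^ 2 + (q.2 - tb) ^ 2) ^ (-1 / 2 : ℝ)))
          ≤ Real.exp (bmu d Λ M * bH M) := fun q => by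
    apply Real.exp_le_exp.2
    apply mul_le_mul_of_nonneg_left _ hμ0
    exact (le_abs_self _).trans ((hbound (by linarith only [sq_nonneg (q.2 - tb)])).trans haH)
  have hS0 : ∀ q : SpaceTime (d + 1), 0 ≤ ‖q.1 - y‖ ^ 2 + (q.2 - tb) ^ 2 := fun q => by positivity
  have hw1 : ∀ q, (‖q.1 - y‖ ^ 2 + (q.2 - tb) ^ 2) ^ (α / 2) ≤ w q := fun q => by
    have h1 := hE q
    have h2 : 1 ≤ Real.exp (bmu d Λ M * bH M) := Real.one_le_exp (by positivity)
    exact le_mul_of_one_le_right (Real.rpow_nonneg (hS0 q) _) (by linarith)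
  have hw2 : ∀ q, w q ≤ (‖q.1 - y‖ ^ 2 + (q.2 - tb) ^ 2) ^ (α / 2) * (2 * Real.exp (bmu d Λ M * bH M)) := by
    intro q
    apply mul_le_mul_of_nonneg_left _ (Real.rpow_nonneg (hS0 q) _)
    linarith [Real.exp_pos (bmu d Λ M *
          (⟪y + (4 * M ^ 2) • eN d, q.1 - y⟫ * (‖q.1 - y‖ ^ 2 + (q.2 - tb) ^ 2) ^ (-1 / 2 : ℝ)))]
  have cS : Continuous fun q : SpaceTime (d + 1) => ‖q.1 - y‖ ^ 2 + (q.2 - tb) ^ 2 := by fun_prop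
  have cR : Continuous fun q : SpaceTime (d + 1) => (‖q.1 - y‖ ^ 2 + (q.2 - tb) ^ 2) ^ (α / 2) :=
    cS.rpow_const fun q => Or.inr (by linarith)
  have hwc : Continuous w := by
    rw [continuous_iff_continuousAt]
    intro q
    rcases eq_or_ne (‖q.1 - y‖ ^ 2 + (q.2 - tb) ^ 2) 0 with h0 | h0
    · have hR0 : (‖q.1 - y‖ ^ 2 + (q.2 - tb) ^ 2) ^ (α / 2) = 0 := by
        rw [h0, Real.zero_rpow (by linarith)]
      have hwq : w q = 0 := by simp only [hw, hR0, zero_mul]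
      rw [ContinuousAt, hwq]
      refine squeeze_zero (fun q => (Real.rpow_nonneg (hS0 q) _).trans (hw1 q)) hw2 ?_
      have := (cR.tendsto q).mul_const (2 * Real.exp (bmu d Λ M * bH M))
      simp only [hR0, zero_mul] at this
      exact this
    · have c2 : ContinuousAt (fun q : SpaceTime (d + 1) =>
          (‖q.1 - y‖ ^ 2 + (q.2 - tb) ^ 2) ^ (-1 / 2 : ℝ)) q :=
        cS.continuousAt.rpow_const (Or.inl h0)
      have c3 : ContinuousAt (fun q : SpaceTime (d + 1) => ⟪y + (4 * M ^ 2) • eN d, q.1 - y⟫) q := by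
        fun_prop
      exact cR.continuousAt.mul (continuousAt_const.add (continuousAt_const.mul
        (Real.continuous_exp.continuousAt.comp (continuousAt_const.mul (c3.mul c2)))))
  have hYc : (y, tb) ∈ closure (Kc d 1) := mem_closure_Kc.2 ⟨hy.le, hyn.ge, htb.1, htb.2⟩
  have hYb : (y, tb) ∈ bdryK d := mem_bdryK hYc (Or.inl hy)
  have key := comparison2 h.sub h.cont y 3 (-1) tb (W := fun q => u (y, tb) + 3 * N * w q)
    (continuous_const.add (continuous_const.mul hwc)).continuousOn ?_ ?_
  · intro X hX hXt
    obtain ⟨x1, x2, x3, x4⟩ := mem_closure_Kc.1 hX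
    have := key X hX ((norm_sub_le _ _).trans (by rw [hy]; linarith)) x3 hXt
    have h2 := hw2 X
    have h3 : (‖X.1 - y‖ ^ 2 + (X.2 - tb) ^ 2) ^ (α / 2) ≤ (‖X.1 - y‖ + (tb - X.2)) ^ α := by
      have := norm_nonneg (X.1 - y)
      apply half_rpow_le (by linarith) (hS0 X) _ a0.le
      nlinarith only [this, hXt]
    have h4 : w X ≤ (‖X.1 - y‖ + (tb - X.2)) ^ α * (2 * Real.exp (bmu d Λ M * bH M)) :=
      h2.trans (mul_le_mul_of_nonneg_right h3 (by positivity))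
    have h5 := mul_le_mul_of_nonneg_left h4 (by positivity : 0 ≤ 3 * N)
    rw [cB1]
    linarith
  · intro q hq g1 g2 g3 hb
    obtain ⟨x1, x2, x3, x4⟩ := mem_closure_Kc.1 hq
    have hq2 : ‖q.1 - y‖ ≤ 2 := (norm_sub_le _ _).trans (by rw [hy]; linarith)
    have hqb : q ∈ bdryK d := mem_bdryK hq (by
      rcases hb with hb | hb | hb
      · exact hb
      · linarith
      · exact Or.inr hb)
    have h1 := h.data1 hqb hYb (pdistL_le1 h.D.lam_pos q (y, tb) hyn)
    simp only at h1
    have h2 : (2 * ‖q.1 - y‖ + |q.2 - tb|) ^ α ≤ 3 * (‖q.1 - y‖ ^ 2 + (q.2 - tb) ^ 2) ^ (α / 2) := by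
      have e : (‖q.1 - y‖ ^ 2 + (q.2 - tb) ^ 2) ^ (α / 2) = √(‖q.1 - y‖ ^ 2 + (q.2 - tb) ^ 2) ^ α := by
        rw [← sq_rpow_half (Real.sqrt_nonneg _), Real.sq_sqrt (hS0 q)]
      rw [e]
      refine rpow_le_mul (by positivity) ?_ (by norm_num) (Real.sqrt_nonneg _) a0.le (by linarith)
      have y1 : ‖q.1 - y‖ ≤ √(‖q.1 - y‖ ^ 2 + (q.2 - tb) ^ 2) :=
        Real.le_sqrt_of_sq_le (by linarith only [sq_nonneg (q.2 - tb)])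
      have y2 : |q.2 - tb| ≤ √(‖q.1 - y‖ ^ 2 + (q.2 - tb) ^ 2) :=
        Real.le_sqrt_of_sq_le (by rw [sq_abs]; linarith only [sq_nonneg ‖q.1 - y‖])
      linarith
    have h3 := mul_le_mul_of_nonneg_left (h2.trans (mul_le_mul_of_nonneg_left (hw1 q) (by norm_num))) hN.le
    linarith
  · intro q hq g1 g2 g3 hi
    have hqy : q.1 ≠ y := by
      intro e
      have : ‖q.1‖ < 1 := by
        rcases hi with hi | hi <;> exact mem_ball_zero_iff.1 hi.1
      rw [e, hy] at this; exact lt_irrefl _ this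
    obtain ⟨L, β, p, j1, j2, j3⟩ := corner_barrier h.D a0 a1 hα.1 hα.2 hy hyn htb hq g3 hqy
    have j4 := (GJ.const (l := PF q) (Qm := Q q.2) (lam := lam) (w := v q.2) (p₀ := q)
      (u (y, tb))).add (j1.const_mul (3 * N))
    refine ⟨_, _, _, j4, fun _ => ?_, fun hF => ?_⟩
    · have : 3 * N * L < 0 := mul_neg_of_pos_of_neg (by positivity) j2
      linarith
    · have : 3 * N * β < 0 := mul_neg_of_pos_of_neg (by positivity) (j3 hF.2.1)
      linarith

lemma quarter_rpow {r α : ℝ} (hr : 1 / 4 ≤ r) (a0 : 0 ≤ α) (a1 : α ≤ 1) : 1 ≤ 4 * r ^ α := by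
  have := rpow_le_mul (x := 1) (c := 4) (s := r) one_pos.le (by linarith) (by norm_num) (by linarith) a0 a1
  simpa using this

lemma cB1_pos (d : ℕ) (Λ M : ℝ) : 0 < cB1 d Λ M := by rw [cB1]; positivity

lemma B1' (h : HB d lam Λ M C₀ α N Q Q' v v' u) (hα : aOK d Λ M α)
    {y : Eucl (d + 1)} (hy : ‖y‖ = 1) (hyn : 0 ≤ lastC y) {tb : ℝ} (htb : tb ∈ Icc (-1 : ℝ) 0)
    {X : SpaceTime (d + 1)} (hX : X ∈ closure (Kc d 1)) (hXt : X.2 ≤ tb) {r : ℝ}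
    (hr1 : lastC y ≤ 2 * r) (hr2 : ‖X.1 - y‖ + (tb - X.2) ≤ 2 * r) :
    u X - u (y, tb) ≤ 8 * (cB1 d Λ M + 1) * N * r ^ α := by
  have hc := cB1_pos d Λ M
  have a0 := h.a0
  have a1 := h.a1
  have hN := h.hN
  have hYc : (y, tb) ∈ closure (Kc d 1) := mem_closure_Kc.2 ⟨hy.le, hyn, htb.1, htb.2⟩
  have hYb : (y, tb) ∈ bdryK d := mem_bdryK hYc (Or.inl hy)
  have hr0 : 0 ≤ r := by linarith
  rcases le_or_gt (1 / 2) (lastC y) with hc2 | hc2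
  · have h1 := h.bd2 hX hYc
    have h2 := quarter_rpow (r := r) (by linarith) a0.le (by linarith : α ≤ 1)
    have h3 : 0 ≤ N * r ^ α := by positivity
    nlinarith only [h1, h2, h3, hN, mul_le_mul_of_nonneg_left h2 hN.le, mul_nonneg hc.le h3]
  · set y' := y - (lastC y) • eN d with hy'
    have n1 : ‖y - y'‖ = lastC y := by
      rw [hy', sub_sub_cancel, norm_smul, norm_eN, Real.norm_of_nonneg hyn, mul_one]
    have n2 : 1 - lastC y ≤ ‖y'‖ := by
      have := norm_sub_norm_le y (y - y')
      rw [n1, hy, sub_sub_cancel] at this; exact this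
    have n3 : ‖y'‖ ≤ 1 := by
      have e : ‖y'‖ ^ 2 ≤ 1 ^ 2 := by
        rw [hy', norm_sub_sq_real, hy, real_inner_smul_right, real_inner_comm, inner_eN, norm_smul, norm_eN,
          Real.norm_eq_abs, mul_one, sq_abs]
        linarith only [sq_nonneg (lastC y)]
      exact abs_le_of_sq_le_sq'' e one_pos.le
    have n4 : 0 < ‖y'‖ := by linarith
    set w := ‖y'‖⁻¹ • y' with hw
    have w1 : ‖w‖ = 1 := by rw [hw, norm_smul, norm_inv, norm_norm, inv_mul_cancel₀ n4.ne']
    have w2 : lastC w = 0 := by rw [hw, lastC_smul, hy', lastC_sub, lastC_smul, lastC_eN]; ring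
    have w3 : ‖y' - w‖ ≤ lastC y := by
      have : y' - w = (‖y'‖ - 1) • w := by
        rw [hw, smul_smul, sub_mul, mul_inv_cancel₀ n4.ne']; module
      rw [this, norm_smul, w1, mul_one, Real.norm_eq_abs, abs_le]
      constructor <;> linarith
    have w4 : ‖y - w‖ ≤ 2 * lastC y := by
      have := norm_sub_le_norm_sub_add_norm_sub y y' w
      linarith
    have hWc : (w, tb) ∈ closure (Kc d 1) := mem_closure_Kc.2 ⟨w1.le, w2.ge, htb.1, htb.2⟩
    have hWb : (w, tb) ∈ bdryK d := mem_bdryK hWc (Or.inl w1)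
    have e1 := B1 h hα w1 w2 htb X hX hXt
    have e2 := h.data1 hWb hYb (pdistL_le2 h.D.lam_pos (w, tb) (y, tb))
    simp only [sub_self, abs_zero, zero_div, Real.sqrt_zero, add_zero] at e2
    have e3 : (‖X.1 - w‖ + (tb - X.2)) ^ α ≤ 8 * r ^ α := by
      refine rpow_le_mul (add_nonneg (norm_nonneg _) (by linarith)) ?_ (by norm_num) hr0 a0.le (by linarith)
      have := norm_sub_le_norm_sub_add_norm_sub X.1 y w
      linarith
    have e4 : (2 * ‖w - y‖) ^ α ≤ 8 * r ^ α := by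
      refine rpow_le_mul (by positivity) ?_ (by norm_num) hr0 a0.le (by linarith)
      rw [norm_sub_rev]; linarith
    have e5 := mul_le_mul_of_nonneg_left e3 (by positivity : 0 ≤ cB1 d Λ M * N)
    have e6 := mul_le_mul_of_nonneg_left e4 hN.le
    linarith

/-- constant of the lateral estimate -/
def cL (d : ℕ) (Λ M : ℝ) : ℝ :=
  8 * (cB1 d Λ M + 1) * (1 + 2 * (Λ * M ^ 2) * (2 * (Λ * M ^ 2 * (d + 1)) + 1))

lemma lat_barrier (D : ObliqueData d lam Λ M C₀ Q Q' v v') (a0 : 0 < α) (a1 : α ≤ 1 / 2)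
    {y : Eucl (d + 1)} (hy : ‖y‖ = 1) {tb : ℝ} {q : SpaceTime (d + 1)} (hq : q ∈ closure (Kc d 1))
    (g3 : q.2 ≤ tb) (hl1 : 0 < ⟪-y, q.1 - y⟫) :
    ∃ L β p, GJ (PF q) (Q q.2) lam (v q.2) q
      (fun q => (‖q.1 - y‖ ^ 2 + (-1 / lam) * (q.2 - tb)) ^ (α / 2)
        + 2 * (Λ * M ^ 2) * (2 * (Λ * M ^ 2 * (d + 1)) + 1) * (⟪-y, q.1 - y⟫) ^ α) L β p ∧ L < 0 := by
  obtain ⟨x1, x2, x3, x4⟩ := mem_closure_Kc.1 hq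
  have ht : q.2 ∈ Icc (-1 : ℝ) 0 := ⟨x3, x4⟩
  have hk := kap_ge_one D
  have hlam := D.lam_pos
  set κ := Λ * M ^ 2 with hκ
  set K := 2 * κ * (2 * (κ * (d + 1)) + 1) with hK
  have hK0 : 0 ≤ K := by positivity
  have hSn : 0 ≤ (tb - q.2) / lam := div_nonneg (by linarith) hlam.le
  have hS : (-1 / lam) * (q.2 - tb) = (tb - q.2) / lam := by ring
  have hlz : ⟪-y, q.1 - y⟫ ≤ ‖q.1 - y‖ := by
    have := real_inner_le_norm (-y) (q.1 - y)
    rw [norm_neg, hy] at this; linarith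
  have hS0 : 0 < ‖q.1 - y‖ ^ 2 + (-1 / lam) * (q.2 - tb) := by
    rw [hS]
    have : 0 < ‖q.1 - y‖ := lt_of_lt_of_le hl1 hlz
    positivity
  have hl := PF_le q
  have jS : GJ (PF q) (Q q.2) lam (v q.2) q (fun q => ‖q.1 - y‖ ^ 2 + (-1 / lam) * (q.2 - tb))
      (2 * (Q q.2).trace + 1) _ _ :=
    ((GJ.nsq hl y).add ((GJ.time hl tb).const_mul (-1 / lam))).congr
      (by field_simp) rfl rfl
  have j1 := jS.rpow hl hS0 (α / 2)
  have j2 := ((GJ.lin (Qm := Q q.2) (lam := lam) (w := v q.2) hl (-y) y).rpow hl hl1 α).const_mul K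
  refine ⟨_, _, _, j1.add j2, ?_⟩
  set S := ‖q.1 - y‖ ^ 2 + (-1 / lam) * (q.2 - tb) with hSS
  set l := ⟪-y, q.1 - y⟫ with hll
  have e1 : α / 2 * ((α / 2 - 1) * S ^ (α / 2 - 2)) * qf (Q q.2) ((2 : ℝ) • (q.1 - y) + (-1 / lam) • (0 : Eucl (d + 1))) ≤ 0 := by
    apply mul_nonpos_of_nonpos_of_nonneg _ (Q_qf_nonneg D ht _)
    exact mul_nonpos_of_nonneg_of_nonpos (by linarith) (mul_nonpos_of_nonpos_of_nonneg (by linarith)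
      (Real.rpow_nonneg hS0.le _))
  have e2 : S ^ (α / 2 - 1) ≤ l ^ (α - 2) := by
    rw [show α / 2 - 1 = (α - 2) / 2 by ring, ← sq_rpow_half hl1.le]
    apply Real.rpow_le_rpow_of_nonpos (by positivity) _ (by linarith)
    rw [hSS, hS]
    nlinarith only [hlz, hl1, hSn]
  have e3 : κ⁻¹ ≤ qf (Q q.2) (-y) := by
    have := Q_lower D ht (-y)
    rw [norm_neg, hy] at this; linarith
  have hT := Q_trace D ht
  rw [← hκ] at hT
  have hL0 : 0 < l ^ (α - 2) := Real.rpow_pos_of_pos hl1 _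
  have e4 : α / 2 * S ^ (α / 2 - 1) * (2 * (Q q.2).trace + 1) ≤
      α / 2 * l ^ (α - 2) * (2 * (κ * (d + 1)) + 1) := by
    have := Q_trace_nonneg D ht
    gcongr
  have e5 : K * κ⁻¹ = 2 * (2 * (κ * (d + 1)) + 1) := by rw [hK]; field_simp
  have e6 : K * (α * ((α - 1) * l ^ (α - 2)) * qf (Q q.2) (-y)) ≤
      - (α * l ^ (α - 2) * (2 * (κ * (d + 1)) + 1)) := by
    have s1 := mul_le_mul_of_nonneg_left e3 (by positivity : 0 ≤ K * (α * l ^ (α - 2)))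
    have s2 : K * (α * l ^ (α - 2)) * κ⁻¹ = α * l ^ (α - 2) * (2 * (2 * (κ * (d + 1)) + 1)) := by
      rw [← e5]; ring
    rw [s2] at s1
    have s3 : 0 ≤ α * l ^ (α - 2) * (2 * (2 * (κ * (d + 1)) + 1)) := by positivity
    have s4 : K * (α * ((α - 1) * l ^ (α - 2)) * qf (Q q.2) (-y)) =
      - ((1 - α) * (K * (α * l ^ (α - 2)) * qf (Q q.2) (-y))) := by ring
    rw [s4]
    have s5 : 1 / 2 * (α * l ^ (α - 2) * (2 * (2 * (κ * (d + 1)) + 1))) ≤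
        (1 - α) * (K * (α * l ^ (α - 2)) * qf (Q q.2) (-y)) :=
      mul_le_mul (by linarith) s1 s3 (by linarith)
    linarith
  have e7 : 0 < α * l ^ (α - 2) * (2 * (κ * (d + 1)) + 1) := by positivity
  linarith

lemma lateral (h : HB d lam Λ M C₀ α N Q Q' v v' u) (hα : aOK d Λ M α)
    {y : Eucl (d + 1)} (hy : ‖y‖ = 1) (hyn : 0 ≤ lastC y) {tb : ℝ} (htb : tb ∈ Icc (-1 : ℝ) 0)
    {x : Eucl (d + 1)} (hX : (x, tb) ∈ closure (Kc d 1)) :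
    u (x, tb) - u (y, tb) ≤ cL d Λ M * N * ‖x - y‖ ^ α := by
  have hc := cB1_pos d Λ M
  have a0 := h.a0
  have a1 := h.a1
  have hN := h.hN
  have hk := kap_ge_one h.D
  have hlam := h.D.lam_pos
  have hlam1 := h.D.lam_le_one
  set κ := Λ * M ^ 2 with hκ
  set K := 2 * κ * (2 * (κ * (d + 1)) + 1) with hK
  have hK0 : 0 ≤ K := by positivity
  set C := 8 * (cB1 d Λ M + 1) with hC
  have hC8 : 8 ≤ C := by linarith
  have hYc : (y, tb) ∈ closure (Kc d 1) := mem_closure_Kc.2 ⟨hy.le, hyn, htb.1, htb.2⟩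
  have hYb : (y, tb) ∈ bdryK d := mem_bdryK hYc (Or.inl hy)
  rcases le_or_gt (lastC y) (2 * ‖x - y‖) with hcase | hcase
  · have := B1' h hα hy hyn htb hX le_rfl hcase (by simp; linarith [norm_nonneg (x - y)])
    refine this.trans ?_
    rw [cL, ← hκ, ← hK, ← hC]
    have : 0 ≤ C * N * ‖x - y‖ ^ α := by positivity
    nlinarith only [this, hK0]
  set ρ := lastC y / 2 with hρ
  have hρ0 : 0 < ρ := by rw [hρ]; linarith [norm_nonneg (x - y)]
  have hρ1 : ρ ≤ 1 / 2 := by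
    have := (le_abs_self _).trans (abs_lastC_le y); rw [hy] at this; rw [hρ]; linarith
  set w : SpaceTime (d + 1) → ℝ := fun q => (‖q.1 - y‖ ^ 2 + (-1 / lam) * (q.2 - tb)) ^ (α / 2)
    + K * (⟪-y, q.1 - y⟫) ^ α with hw
  have hl0 : ∀ q : SpaceTime (d + 1), ‖q.1‖ ≤ 1 → 0 ≤ ⟪-y, q.1 - y⟫ := by
    intro q hq
    rw [inner_neg_left, inner_sub_right, real_inner_self_eq_norm_sq, hy]
    have := real_inner_le_norm y q.1
    rw [hy] at this; linarith
  have hS : ∀ q : SpaceTime (d + 1), (-1 / lam) * (q.2 - tb) = (tb - q.2) / lam := fun q => by ring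
  have hwS : ∀ q : SpaceTime (d + 1), ‖q.1‖ ≤ 1 →
      (‖q.1 - y‖ ^ 2 + (-1 / lam) * (q.2 - tb)) ^ (α / 2) ≤ w q := fun q hq => by
    have := mul_nonneg hK0 (Real.rpow_nonneg (hl0 q hq) α)
    simp only [hw]; linarith
  have hwc : Continuous w := by
    have c1 : Continuous fun q : SpaceTime (d + 1) => ‖q.1 - y‖ ^ 2 + (-1 / lam) * (q.2 - tb) := by fun_prop
    have c2 : Continuous fun q : SpaceTime (d + 1) => ⟪-y, q.1 - y⟫ := by fun_prop
    exact (c1.rpow_const fun q => Or.inr (by linarith)).add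
      (continuous_const.mul (c2.rpow_const fun q => Or.inr a0.le))
  have key := comparison2 h.sub h.cont y ρ (max (-1) (tb - lam * ρ ^ 2)) tb
    (W := fun q => u (y, tb) + C * N * w q) (continuous_const.add (continuous_const.mul hwc)).continuousOn ?_ ?_
  · have := key (x, tb) hX (by simp; linarith) (max_le htb.1 (by simp; positivity)) le_rfl
    have e1 : w (x, tb) ≤ (1 + K) * ‖x - y‖ ^ α := by
      have x1 : (⟪-y, x - y⟫) ^ α ≤ ‖x - y‖ ^ α := by
        apply Real.rpow_le_rpow (hl0 (x, tb) (mem_closure_Kc.1 hX).1) _ a0.le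
        have := real_inner_le_norm (-y) (x - y)
        rw [norm_neg, hy] at this; linarith
      simp only [hw, sub_self, mul_zero, add_zero]
      rw [sq_rpow_half (norm_nonneg _)]
      have := mul_le_mul_of_nonneg_left x1 hK0
      linarith
    have e2 := mul_le_mul_of_nonneg_left e1 (by positivity : 0 ≤ C * N)
    rw [cL, ← hκ, ← hK, ← hC]
    linarith
  · intro q hq g1 g2 g3 hb
    obtain ⟨x1, x2, x3, x4⟩ := mem_closure_Kc.1 hq
    have hσ : tb - lam * ρ ^ 2 ≤ q.2 := (le_max_right _ _).trans g2
    have hSn : 0 ≤ (tb - q.2) / lam := div_nonneg (by linarith) hlam.le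
    have hw0 := hwS q x1
    rw [hS] at hw0
    have hout : ρ ^ 2 ≤ ‖q.1 - y‖ ^ 2 + (tb - q.2) / lam → u q ≤ u (y, tb) + C * N * w q := by
      intro hge
      have e1 := B1' h hα hy hyn htb hq g3 (r := ρ) (by rw [hρ]; linarith) (by
        have : lam * ρ ^ 2 ≤ ρ := by nlinarith only [hlam1, hρ0, hρ1, mul_nonneg hρ0.le hρ0.le]
        linarith only [this, g1, hσ])
      have e2 := (le_half_rpow hρ0.le hge a0.le).trans hw0
      have e3 := mul_le_mul_of_nonneg_left e2 (by positivity : 0 ≤ C * N)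
      linarith
    have hdat : (‖q.1‖ = 1 ∨ q.2 = -1) → u q ≤ u (y, tb) + C * N * w q := by
      intro hb
      have h1 := h.data1 (mem_bdryK hq hb) hYb (pdistL_le2 hlam q (y, tb))
      simp only at h1
      rw [abs_sub_comm, abs_of_nonneg (by linarith : 0 ≤ tb - q.2)] at h1
      have e : (‖q.1 - y‖ ^ 2 + (tb - q.2) / lam) ^ (α / 2) = √(‖q.1 - y‖ ^ 2 + (tb - q.2) / lam) ^ α := by
        rw [← sq_rpow_half (Real.sqrt_nonneg _), Real.sq_sqrt (by positivity)]
      have h2 : (2 * ‖q.1 - y‖ + √((tb - q.2) / lam)) ^ α ≤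
          3 * (‖q.1 - y‖ ^ 2 + (tb - q.2) / lam) ^ (α / 2) := by
        rw [e]
        refine rpow_le_mul (by positivity) ?_ (by norm_num) (Real.sqrt_nonneg _) a0.le (by linarith)
        have y1 : ‖q.1 - y‖ ≤ √(‖q.1 - y‖ ^ 2 + (tb - q.2) / lam) :=
          Real.le_sqrt_of_sq_le (by linarith)
        have y2 : √((tb - q.2) / lam) ≤ √(‖q.1 - y‖ ^ 2 + (tb - q.2) / lam) :=
          Real.sqrt_le_sqrt (by linarith only [sq_nonneg ‖q.1 - y‖])
        linarith
      have h3 := mul_le_mul_of_nonneg_left (h2.trans (mul_le_mul_of_nonneg_left hw0 (by norm_num))) hN.le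
      have hw00 : 0 ≤ w q := (Real.rpow_nonneg (by positivity) _).trans hw0
      have := mul_nonneg hN.le hw00
      nlinarith only [this, h1, h3, hC8]
    rcases hb with hb | hb | hb
    · exact hdat hb
    · exact hout (by rw [hb]; linarith)
    · rcases max_choice (-1) (tb - lam * ρ ^ 2) with hm | hm <;> rw [hm] at hb
      · exact hdat (Or.inr hb)
      · refine hout ?_
        have : (tb - q.2) / lam = ρ ^ 2 := by rw [hb]; field_simp; ring
        rw [this]; linarith only [sq_nonneg ‖q.1 - y‖]
  · intro q hq g1 g2 g3 hi
    obtain ⟨x1, x2, x3, x4⟩ := mem_closure_Kc.1 hq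
    have ht : q.2 ∈ Icc (-1 : ℝ) 0 := ⟨x3, x4⟩
    have hxn : 0 < lastC q.1 := by
      have := neg_le_of_abs_le (abs_lastC_le (q.1 - y))
      rw [lastC_sub] at this
      linarith
    have hx1 : ‖q.1‖ < 1 := by
      rcases hi with hi | hi <;> exact mem_ball_zero_iff.1 hi.1
    have hSn : 0 ≤ (tb - q.2) / lam := div_nonneg (by linarith) hlam.le
    have hl1 : 0 < ⟪-y, q.1 - y⟫ := by
      rw [inner_neg_left, inner_sub_right, real_inner_self_eq_norm_sq, hy]
      have := real_inner_le_norm y q.1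
      rw [hy] at this; linarith
    obtain ⟨L, β, p, j1, j2⟩ := lat_barrier h.D a0 a1 hy hq g3 hl1
    have j3 := (GJ.const (l := PF q) (Qm := Q q.2) (lam := lam) (w := v q.2) (p₀ := q)
      (u (y, tb))).add (j1.const_mul (C * N))
    refine ⟨_, _, _, j3, fun _ => ?_, fun hF => absurd hF.2.1 hxn.ne'⟩
    rw [zero_add]
    exact mul_neg_of_pos_of_neg (by positivity) j2

end
end GH

noncomputable section GH

section
variable {d : ℕ} {lam Λ M C₀ α N : ℝ} {Q Q' : ℝ → Matrix (Fin (d + 1)) (Fin (d + 1)) ℝ}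
  {v v' : ℝ → Eucl (d + 1)} {u : SpaceTime (d + 1) → ℝ}

lemma jet_moving {p₀ : SpaceTime (d + 1)} (c : Eucl (d + 1)) {g : ℝ → Eucl (d + 1)}
    {g' : Eucl (d + 1)} (hg : HasDerivWithinAt g g' (Icc (-1 : ℝ) 0) p₀.2) :
    Jet (PF p₀) (fun q => ‖q.1 - c + g q.2‖ ^ 2) p₀ (2 * ⟪p₀.1 - c + g p₀.2, g'⟫)
      ((2 : ℝ) • (p₀.1 - c + g p₀.2)) ((2 : ℝ) • 1) := by
  have ht0 : Tendsto (fun q : SpaceTime (d + 1) => q.2) (PF p₀) (𝓝 p₀.2) :=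
    (continuous_snd.tendsto p₀).mono_left (PF_le p₀)
  have ht : Tendsto (fun q : SpaceTime (d + 1) => q.2) (PF p₀) (𝓝[Icc (-1 : ℝ) 0] p₀.2) :=
    tendsto_nhdsWithin_iff.2 ⟨ht0, eventually_nhdsWithin_of_forall fun q hq => mem_time hq.1⟩
  have e0 : (fun q : SpaceTime (d + 1) => q.2 - p₀.2) =O[PF p₀] prho p₀ := by
    refine IsBigO.of_bound 1 (Eventually.of_forall fun q => ?_)
    rw [one_mul, Real.norm_of_nonneg (prho_nonneg _ _), Real.norm_eq_abs, prho]
    nlinarith [sq_nonneg ‖q.1 - p₀.1‖]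
  have e1 := ((hasDerivWithinAt_iff_isLittleO.1 hg).comp_tendsto ht).trans_isBigO e0
  have e2 : (fun q : SpaceTime (d + 1) => g q.2 - g p₀.2) =O[PF p₀] prho p₀ := by
    have e3 : (fun q : SpaceTime (d + 1) => (q.2 - p₀.2) • g') =O[PF p₀] prho p₀ :=
      (IsBigO.of_bound ‖g'‖ (Eventually.of_forall fun q => by
        rw [norm_smul, mul_comm])).trans e0
    refine (e1.isBigO.add e3).congr_left fun q => ?_
    simp
  have e4 : Tendsto (fun q : SpaceTime (d + 1) => g q.2 - g p₀.2) (PF p₀) (𝓝 0) :=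
    e2.trans_tendsto (prho_tendsto (PF_le p₀))
  have e5 : Tendsto (fun q : SpaceTime (d + 1) => q.1 - p₀.1) (PF p₀) (𝓝 0) := by
    have : Tendsto (fun q : SpaceTime (d + 1) => q.1 - p₀.1) (𝓝 p₀) (𝓝 (p₀.1 - p₀.1)) :=
      Continuous.tendsto (by fun_prop) _
    rw [sub_self] at this
    exact this.mono_left (PF_le p₀)
  have inn : ∀ {a b : SpaceTime (d + 1) → Eucl (d + 1)}, Tendsto a (PF p₀) (𝓝 0) →
      b =O[PF p₀] prho p₀ → (fun q => ⟪a q, b q⟫) =o[PF p₀] prho p₀ := by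
    intro a b ha hb
    have h1 : (fun q => ‖a q‖ * ‖b q‖) =o[PF p₀] (fun q => (1 : ℝ) * prho p₀ q) :=
      ((isLittleO_one_iff ℝ).2 (by simpa using ha.norm)).mul_isBigO hb.norm_left
    refine IsBigO.trans_isLittleO (IsBigO.of_bound 1 (Eventually.of_forall fun q => ?_))
      (h1.congr_right fun q => by ring)
    rw [one_mul, Real.norm_eq_abs, Real.norm_of_nonneg (by positivity)]
    exact abs_real_inner_le_norm _ _
  have k1 := inn e4 e2
  have k2 := inn e5 e2
  have k3 : (fun q : SpaceTime (d + 1) => ⟪p₀.1 - c + g p₀.2, g q.2 - g p₀.2 - (q.2 - p₀.2) • g'⟫)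
      =o[PF p₀] prho p₀ := by
    refine IsBigO.trans_isLittleO (IsBigO.of_bound ‖p₀.1 - c + g p₀.2‖ (Eventually.of_forall fun q => ?_)) e1
    exact abs_real_inner_le_norm _ _
  refine ⟨by simp [Matrix.IsSymm], ((k1.add (k2.const_mul_left 2)).add (k3.const_mul_left 2)).congr_left
    fun q => ?_⟩
  have e : q.1 - c + g q.2 = (p₀.1 - c + g p₀.2) + (q.1 - p₀.1) + (g q.2 - g p₀.2) := by abel
  beta_reduce
  rw [e, norm_add_sq_real, norm_add_sq_real, qf_smul, qf_one, real_inner_smul_left,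
    inner_add_left (p₀.1 - c + g p₀.2) (q.1 - p₀.1), inner_sub_right (p₀.1 - c + g p₀.2) (g q.2 - g p₀.2), real_inner_smul_right,
    real_inner_self_eq_norm_sq]
  ring

/-- The moving penalization vector. -/
def PV (v : ℝ → Eucl (d + 1)) (h : Eucl (d + 1)) (X Y : SpaceTime (d + 1)) : Eucl (d + 1) :=
  X.1 - (Y.1 + h) + (X.2 - Y.2) • v X.2

def ps (v : ℝ → Eucl (d + 1)) (h : Eucl (d + 1)) (X Y : SpaceTime (d + 1)) : ℝ :=
  ‖PV v h X Y‖ ^ 2 + lastC (X.1 - Y.1) ^ 2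

lemma jet_lastsq {l : Filter (SpaceTime (d + 1))} {p₀ : SpaceTime (d + 1)} (hl : l ≤ 𝓝 p₀)
    (c : Eucl (d + 1)) : ∃ A, Jet l (fun q => lastC (q.1 - c) ^ 2) p₀ 0
      ((2 * lastC (p₀.1 - c)) • eN d) A := by
  have h1 : Jet l (fun q => lastC (q.1 - c)) p₀ 0 (eN d) 0 :=
    Jet.poly hl 0 Matrix.isSymm_zero fun q => by
      rw [inner_eN, qf_zero, ← sub_add_sub_cancel' p₀.1 c q.1, lastC_add]; simp
  exact ⟨_, (jet_sq hl h1).congr (by ring) rfl rfl⟩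

lemma sigma_le (D : ObliqueData d lam Λ M C₀ Q Q' v v') {h : Eucl (d + 1)} (hh : lastC h = 0)
    {X Y : SpaceTime (d + 1)} (hX : X ∈ closure (Kc d 1)) :
    (X.2 - Y.2) ^ 2 ≤ 2 * M ^ 2 * ps v h X Y := by
  have h1 : lastC (PV v h X Y) = lastC (X.1 - Y.1) + (X.2 - Y.2) * lastC (v X.2) := by
    rw [PV, lastC_add, lastC_sub, lastC_add, lastC_smul, lastC_sub, hh]; ring
  have h2 : lastC (PV v h X Y) ^ 2 ≤ ‖PV v h X Y‖ ^ 2 := by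
    rw [← sq_abs]; gcongr; exact abs_lastC_le _
  have h3 := D.vlast _ (mem_time hX)
  have hM := D.M_ge_one
  have h4 : 1 ≤ M * lastC (v X.2) := by
    have := mul_le_mul_of_nonneg_left h3 (by linarith : 0 ≤ M)
    rwa [mul_inv_cancel₀ (by linarith)] at this
  have h5 : (X.2 - Y.2) ^ 2 ≤ (M * lastC (v X.2)) ^ 2 * (X.2 - Y.2) ^ 2 := by
    have : 1 ≤ (M * lastC (v X.2)) ^ 2 := by nlinarith only [h4]
    nlinarith only [this, sq_nonneg (X.2 - Y.2)]
  have h6 : (X.2 - Y.2) * lastC (v X.2) = lastC (PV v h X Y) - lastC (X.1 - Y.1) := by linarith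
  have h7 : (M * lastC (v X.2)) ^ 2 * (X.2 - Y.2) ^ 2 =
      M ^ 2 * (lastC (PV v h X Y) - lastC (X.1 - Y.1)) ^ 2 := by rw [← h6]; ring
  have h8 : (lastC (PV v h X Y) - lastC (X.1 - Y.1)) ^ 2 ≤ 2 * ps v h X Y := by
    unfold ps; nlinarith only [h2, sq_nonneg (lastC (PV v h X Y) + lastC (X.1 - Y.1))]
  have := mul_le_mul_of_nonneg_left h8 (sq_nonneg M)
  linarith

lemma prod_le (D : ObliqueData d lam Λ M C₀ Q Q' v v') {h : Eucl (d + 1)} (hh : lastC h = 0)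
    {X Y : SpaceTime (d + 1)} (hX : X ∈ closure (Kc d 1)) :
    ‖PV v h X Y‖ * |X.2 - Y.2| ≤ 2 * M * ps v h X Y := by
  have h1 := sigma_le D hh hX (Y := Y)
  have hM := D.M_ge_one
  have h2 : ‖PV v h X Y‖ ^ 2 ≤ ps v h X Y := by unfold ps; linarith only [sq_nonneg (lastC (X.1 - Y.1))]
  have h0 : 0 ≤ ps v h X Y := (sq_nonneg _).trans h2
  apply abs_le_of_sq_le_sq'' _ (by positivity)
  rw [mul_pow, sq_abs]
  calc ‖PV v h X Y‖ ^ 2 * (X.2 - Y.2) ^ 2 ≤ ps v h X Y * (2 * M ^ 2 * ps v h X Y) :=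
        mul_le_mul h2 h1 (sq_nonneg _) h0
    _ ≤ _ := by nlinarith only [mul_nonneg (sq_nonneg M) (sq_nonneg (ps v h X Y))]

/-- The data at a maximum point of the doubled functional. -/
structure DM (d : ℕ) (lam M : ℝ) (v : ℝ → Eucl (d + 1)) (u : SpaceTime (d + 1) → ℝ)
    (h : Eucl (d + 1)) (δ ε γ : ℝ) (X0 Y0 : SpaceTime (d + 1)) : Prop where
  hh : lastC h = 0
  hδ : 0 < δ
  hε : 0 < ε
  hX : X0 ∈ closure (Kc d 1)
  hY : Y0 ∈ closure (Kc d 1)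
  hmax : ∀ X ∈ closure (Kc d 1), ∀ Y ∈ closure (Kc d 1),
    u X - u Y - δ / 2 * (X.2 + Y.2) - ε⁻¹ * ps v h X Y ≤
    u X0 - u Y0 - δ / 2 * (X0.2 + Y0.2) - ε⁻¹ * ps v h X0 Y0
  hps : ε⁻¹ * ps v h X0 Y0 ≤ γ
  hγ : 4 * M * γ / lam < δ / 2

lemma DM.fin {δ ε γ B : ℝ} {h : Eucl (d + 1)} {X0 Y0 : SpaceTime (d + 1)} (D : ObliqueData d lam Λ M C₀ Q Q' v v')
    (m : DM d lam M v u h δ ε γ X0 Y0)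
    (hB : B ≤ ‖PV v h X0 Y0‖ * (lam⁻¹ * |X0.2 - Y0.2|)) (hc : δ / 2 ≤ ε⁻¹ * (2 * B)) : False := by
  have h1 := prod_le D m.hh m.hX (Y := Y0)
  have hl := D.lam_pos
  have hM := D.M_ge_one
  have hi : 0 < ε⁻¹ := inv_pos.2 m.hε
  have h2 : B ≤ lam⁻¹ * (2 * M * ps v h X0 Y0) := by
    refine hB.trans ?_
    rw [show ‖PV v h X0 Y0‖ * (lam⁻¹ * |X0.2 - Y0.2|) = lam⁻¹ * (‖PV v h X0 Y0‖ * |X0.2 - Y0.2|) by ring]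
    gcongr
  have h3 : ε⁻¹ * (2 * B) ≤ ε⁻¹ * (2 * (lam⁻¹ * (2 * M * ps v h X0 Y0))) := by gcongr
  have h4 : ε⁻¹ * (2 * (lam⁻¹ * (2 * M * ps v h X0 Y0))) = 4 * M * (ε⁻¹ * ps v h X0 Y0) / lam := by
    rw [div_eq_mul_inv]; ring
  have h5 : 4 * M * (ε⁻¹ * ps v h X0 Y0) / lam ≤ 4 * M * γ / lam := by
    have := m.hps
    gcongr
  have := m.hγ
  linarith

lemma DM.F1 {δ ε γ : ℝ} {h : Eucl (d + 1)} {X0 Y0 : SpaceTime (d + 1)} (D : ObliqueData d lam Λ M C₀ Q Q' v v')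
    (hu : ObliqueSub d lam Q v u) (m : DM d lam M v u h δ ε γ X0 Y0) (hF : X0 ∈ Fc d 1) : False := by
  have ht := mem_time m.hX
  have hg : HasDerivWithinAt (fun t => (t - Y0.2) • v t) ((X0.2 - Y0.2) • v' X0.2 + (1 : ℝ) • v X0.2)
      (Icc (-1 : ℝ) 0) X0.2 :=
    ((hasDerivWithinAt_id _ _).sub_const _).fun_smul (D.vderiv _ ht)
  obtain ⟨A, j2⟩ := jet_lastsq (PF_le X0) Y0.1
  have j := (jet_time (PF_le X0) (δ / 2) 0).add (((jet_moving (Y0.1 + h) hg).add j2).const_mul ε⁻¹)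
  have k := (jet_touch hu m.hX j (eventually_nhdsWithin_of_forall fun q hq => by
    have := m.hmax q hq.1 Y0 m.hY
    unfold ps PV at this
    linarith)).2 hF
  have e : X0.1 - (Y0.1 + h) + (X0.2 - Y0.2) • v X0.2 = PV v h X0 Y0 := rfl
  simp only [e, zero_add, one_smul, inner_smul_right, inner_add_right] at k
  rw [real_inner_comm (eN d), inner_eN, real_inner_comm (v X0.2)] at k
  have hz : lastC (X0.1 - Y0.1) ≤ 0 := by
    rw [lastC_sub, hF.2.1]; linarith [(mem_closure_Kc.1 m.hY).2.1]
  have hv : 0 ≤ lastC (v X0.2) := (inv_nonneg.2 (by linarith [D.M_ge_one])).trans (D.vlast _ ht)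
  have hi : 0 < ε⁻¹ := inv_pos.2 m.hε
  have h1 : -((X0.2 - Y0.2) * ⟪PV v h X0 Y0, v' X0.2⟫) ≤ ‖PV v h X0 Y0‖ * (lam⁻¹ * |X0.2 - Y0.2|) := by
    refine (neg_le_abs _).trans ?_
    rw [abs_mul]
    have := (abs_real_inner_le_norm (PV v h X0 Y0) (v' X0.2)).trans
      (mul_le_mul_of_nonneg_left (D.vderiv_bound _ ht) (norm_nonneg _))
    have := mul_le_mul_of_nonneg_left this (abs_nonneg (X0.2 - Y0.2))
    linarith
  refine m.fin D h1 ?_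
  have := mul_nonneg hi.le (mul_nonneg (neg_nonneg.2 hz) hv)
  nlinarith only [k, this]

lemma DM.F2 {δ ε γ : ℝ} {h : Eucl (d + 1)} {X0 Y0 : SpaceTime (d + 1)} (D : ObliqueData d lam Λ M C₀ Q Q' v v')
    (hu : ObliqueSub d lam Q v (fun q => - u q)) (m : DM d lam M v u h δ ε γ X0 Y0) (hF : Y0 ∈ Fc d 1) :
    False := by
  have ht := mem_time m.hX
  have hs := mem_time m.hY
  have hg : HasDerivWithinAt (fun s => (s - X0.2) • v X0.2) ((1 : ℝ) • v X0.2)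
      (Icc (-1 : ℝ) 0) Y0.2 :=
    ((hasDerivWithinAt_id _ _).sub_const _).smul_const _
  obtain ⟨A, j2⟩ := jet_lastsq (PF_le Y0) X0.1
  have j := (jet_time (PF_le Y0) (δ / 2) 0).add (((jet_moving (X0.1 - h) hg).add j2).const_mul ε⁻¹)
  have e : ∀ q : SpaceTime (d + 1), q.1 - (X0.1 - h) + (q.2 - X0.2) • v X0.2 = - PV v h X0 q := fun q => by
    rw [PV, ← neg_sub X0.2 q.2, neg_smul]; abel
  have k := (jet_touch hu m.hY j (eventually_nhdsWithin_of_forall fun q hq => by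
    have := m.hmax X0 m.hX q hq.1
    simp only [e, norm_neg]
    unfold ps at this
    rw [← neg_sub q.1, ← neg_sub Y0.1] at this
    have e2 : ∀ z : Eucl (d + 1), lastC (-z) ^ 2 = lastC z ^ 2 := fun z => by
      rw [← zero_sub, lastC_sub]; unfold lastC; simp
    rw [e2, e2] at this
    linarith)).2 hF
  simp only [e, zero_add, one_smul, inner_smul_right, inner_add_right, inner_neg_left, inner_neg_right] at k
  rw [real_inner_comm (eN d), inner_eN] at k
  have hz : 0 ≤ lastC (X0.1 - Y0.1) := by
    rw [lastC_sub, hF.2.1]; linarith [(mem_closure_Kc.1 m.hX).2.1]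
  have hz' : lastC (Y0.1 - X0.1) = - lastC (X0.1 - Y0.1) := by rw [lastC_sub, lastC_sub]; ring
  have hv : 0 ≤ lastC (v Y0.2) := (inv_nonneg.2 (by linarith [D.M_ge_one])).trans (D.vlast _ hs)
  have hi : 0 < ε⁻¹ := inv_pos.2 m.hε
  have h1 : ⟪PV v h X0 Y0, v X0.2⟫ - ⟪v Y0.2, PV v h X0 Y0⟫ ≤ ‖PV v h X0 Y0‖ * (lam⁻¹ * |X0.2 - Y0.2|) := by
    rw [real_inner_comm, ← inner_sub_left, real_inner_comm]
    exact (real_inner_le_norm _ _).trans (mul_le_mul_of_nonneg_left (v_lip D ht hs) (norm_nonneg _))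
  refine m.fin D h1 ?_
  rw [hz'] at k
  have := mul_nonneg hi.le (mul_nonneg hz hv)
  nlinarith only [k, this]

end
end GH

noncomputable section GH

section
variable {d : ℕ} {lam Λ M C₀ α N : ℝ} {Q Q' : ℝ → Matrix (Fin (d + 1)) (Fin (d + 1)) ℝ}
  {v v' : ℝ → Eucl (d + 1)} {u : SpaceTime (d + 1) → ℝ}

lemma Kc_nhd {X : SpaceTime (d + 1)} (hX : X ∈ Kc d 1) : ∃ r > 0, ∀ r' ≤ r, ∀ x ∈ closedBall X.1 r',
    ∀ t ∈ Icc (X.2 - r') X.2, (x, t) ∈ Kc d 1 := by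
  obtain ⟨h1, h2, h3, h4⟩ := hX
  rw [mem_ball_zero_iff] at h1
  refine ⟨min (min ((1 - ‖X.1‖) / 2) (lastC X.1 / 2)) ((X.2 + 1) / 2),
    lt_min (lt_min (by linarith) (by linarith)) (by linarith), ?_⟩
  intro r' hr x hx t ht
  rw [le_min_iff, le_min_iff] at hr
  rw [mem_closedBall, dist_eq_norm] at hx
  have a1 := norm_le_norm_add_norm_sub' x X.1
  have a2 := neg_le_of_abs_le (abs_lastC_le (x - X.1))
  rw [lastC_sub] at a2
  refine ⟨mem_ball_zero_iff.2 ?_, ?_, ?_, ?_⟩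
  · show ‖x‖ < 1
    linarith
  · show 0 < lastC x
    linarith
  · show -1 < t
    linarith [ht.1]
  · show t ≤ 0
    linarith [ht.2]

lemma ps_incr (D : ObliqueData d lam Λ M C₀ Q Q' v v') {h : Eucl (d + 1)} (hh : lastC h = 0)
    {X Y : SpaceTime (d + 1)} (hX : X ∈ closure (Kc d 1)) (ξ ζ : Eucl (d + 1)) {τ : ℝ} (h0 : 0 ≤ τ)
    (h1 : τ ≤ 1) (ht : X.2 - τ ∈ Icc (-1 : ℝ) 0) :
    ps v h (X.1 + ξ, X.2 - τ) (Y.1 + ζ, Y.2 - τ) ≤ ps v h X Y +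
      ⟪(2 : ℝ) • (PV v h X Y + (X.2 - Y.2) • (v (X.2 - τ) - v X.2) + lastC (X.1 - Y.1) • eN d), ξ - ζ⟫
      + 2 * ‖ξ - ζ‖ ^ 2 + τ * (4 * M / lam + 2 * M ^ 2 / lam ^ 2) * ps v h X Y := by
  set w := (X.2 - Y.2) • (v (X.2 - τ) - v X.2) with hw
  have e1 : PV v h (X.1 + ξ, X.2 - τ) (Y.1 + ζ, Y.2 - τ) = (PV v h X Y + w) + (ξ - ζ) := by
    simp only [PV, hw]
    rw [smul_sub, show X.2 - τ - (Y.2 - τ) = X.2 - Y.2 by ring]; abel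
  have e2 : lastC ((X.1 + ξ) - (Y.1 + ζ)) = lastC (X.1 - Y.1) + lastC (ξ - ζ) := by
    rw [← lastC_add]; congr 1; abel
  have hl := D.lam_pos
  have hM := D.M_ge_one
  have hwn : ‖w‖ ≤ |X.2 - Y.2| * (lam⁻¹ * τ) := by
    rw [hw, norm_smul, Real.norm_eq_abs]
    have := v_lip D ht (mem_time hX)
    rw [show X.2 - τ - X.2 = -τ by ring, abs_neg, abs_of_nonneg h0] at this
    gcongr
  have b1 := prod_le D hh hX (Y := Y)
  have b2 := sigma_le D hh hX (Y := Y)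
  have hp0 : 0 ≤ ps v h X Y := by unfold ps; positivity
  have c1 : 2 * ⟪PV v h X Y, w⟫ ≤ τ * (4 * M / lam) * ps v h X Y := by
    have q1 := (real_inner_le_norm (PV v h X Y) w).trans (mul_le_mul_of_nonneg_left hwn (norm_nonneg _))
    have q2 := mul_le_mul_of_nonneg_left b1 (by positivity : 0 ≤ lam⁻¹ * τ)
    have q3 : τ * (4 * M / lam) * ps v h X Y = 2 * (lam⁻¹ * τ * (2 * M * ps v h X Y)) := by
      rw [div_eq_mul_inv]; ring
    rw [q3]
    linarith only [q1, q2]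
  have c2 : ‖w‖ ^ 2 ≤ τ * (2 * M ^ 2 / lam ^ 2) * ps v h X Y := by
    have q1 : ‖w‖ ^ 2 ≤ (|X.2 - Y.2| * (lam⁻¹ * τ)) ^ 2 := by gcongr
    rw [mul_pow, sq_abs] at q1
    have q2 := mul_le_mul_of_nonneg_right b2 (sq_nonneg (lam⁻¹ * τ))
    have q3 : τ * (2 * M ^ 2 / lam ^ 2) * ps v h X Y = 2 * M ^ 2 * ps v h X Y * (lam⁻¹ ^ 2 * τ) := by
      rw [div_eq_mul_inv, inv_pow]; ring
    rw [q3]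
    have q4 : (lam⁻¹ * τ) ^ 2 ≤ lam⁻¹ ^ 2 * τ := by
      rw [mul_pow]; gcongr; nlinarith only [h0, h1]
    have := mul_le_mul_of_nonneg_left q4 (by positivity : 0 ≤ 2 * M ^ 2 * ps v h X Y)
    linarith only [this, q1, q2]
  have c3 : lastC (ξ - ζ) ^ 2 ≤ ‖ξ - ζ‖ ^ 2 := by
    rw [← sq_abs]; gcongr; exact abs_lastC_le _
  unfold ps at *
  simp only at *
  rw [e1, e2, norm_add_sq_real (PV v h X Y + w), norm_add_sq_real (PV v h X Y) w, inner_smul_left, inner_add_left (PV v h X Y + w),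
    inner_smul_left, inner_eN]
  simp only [conj_trivial]
  nlinarith only [c1, c2, c3]

lemma DM.int {δ ε γ : ℝ} {h : Eucl (d + 1)} {X0 Y0 : SpaceTime (d + 1)}
    (D : ObliqueData d lam Λ M C₀ Q Q' v v') (hc : ContinuousOn u (closure (Kc d 1)))
    (hN : ∀ X ∈ closure (Kc d 1), |u X| ≤ N) (hu : ObliqueSub d lam Q v u)
    (hu' : ObliqueSub d lam Q v (fun q => - u q)) (m : DM d lam M v u h δ ε γ X0 Y0)
    (hX : X0 ∈ Kc d 1) (hY : Y0 ∈ Kc d 1) (hg2 : (4 * M / lam + 2 * M ^ 2 / lam ^ 2) * γ ≤ δ / 2)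
    (hg3 : 4 * (d + 1) * (Λ * M ^ 2) * (C₀ / lam) ^ 2 * M ^ 2 * γ < lam * (δ / 2))
    (hσ : (Λ * M ^ 2) * (C₀ / lam * |X0.2 - Y0.2|) ≤ 2) : False := by
  have hl := D.lam_pos
  have hM := D.M_ge_one
  have hi : 0 < ε⁻¹ := inv_pos.2 m.hε
  have hδ := m.hδ
  obtain ⟨r1, hr1, k1⟩ := Kc_nhd hX
  obtain ⟨r2, hr2, k2⟩ := Kc_nhd hY
  set r := min (min r1 r2) 1 with hr
  have hr0 : 0 < r := lt_min (lt_min hr1 hr2) one_pos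
  have g1 := k1 r ((min_le_left _ _).trans (min_le_left _ _))
  have g2 := k2 r ((min_le_left _ _).trans (min_le_right _ _))
  have hrle : r ≤ 1 := min_le_right _ _
  have htime : ∀ τ ∈ Icc 0 r, X0.2 - τ ∈ Icc (-1 : ℝ) 0 ∧ Y0.2 - τ ∈ Icc (-1 : ℝ) 0 := by
    intro τ hτ
    have a1 := g1 X0.1 (mem_closedBall_self hr0.le) (X0.2 - τ) ⟨by linarith [hτ.2], by linarith [hτ.1]⟩
    have a2 := g2 Y0.1 (mem_closedBall_self hr0.le) (Y0.2 - τ) ⟨by linarith [hτ.2], by linarith [hτ.1]⟩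
    exact ⟨⟨a1.2.2.1.le, a1.2.2.2⟩, ⟨a2.2.2.1.le, a2.2.2.2⟩⟩
  refine CL D hu hc hu' hc.neg (x0 := X0.1) (y0 := Y0.1) (t0 := X0.2) (s0 := Y0.2) (τ0 := r) (R := r)
    (M0 := N) (P0 := ε⁻¹ * (2 * (‖PV v h X0 Y0‖ + |X0.2 - Y0.2| * lam⁻¹ + |lastC (X0.1 - Y0.1)|)))
    (G := ε⁻¹ * 2) (δ := δ / 2)
    (ρ := (d + 1 : ℕ) * ((Λ * M ^ 2) * (C₀ / lam * |X0.2 - Y0.2|) ^ 2 / 2)) hr0 hr0 hN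
    (fun X hX => by rw [abs_neg]; exact hN X hX) g1 g2 (by positivity) (by positivity) (by linarith) ?_ ?_ ?_
  · intro τ hτ
    obtain ⟨t1, t2⟩ := htime τ hτ
    refine exists_factors (D.Qsymm _ t1) (D.Qsymm _ t2) (kap_ge_one D) (by have := D.C0_pos; positivity) (Q_lower D t1) (Q_lower D t2)
      (fun x y => ?_) hσ
    have := Q_lip D t1 t2 x y
    rwa [show X0.2 - τ - (Y0.2 - τ) = X0.2 - Y0.2 by ring] at this
  · have b2 := sigma_le D m.hh m.hX (Y := Y0)
    have hk := kap_ge_one D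
    refine lt_of_le_of_lt ?_ hg3
    have := m.hps
    rw [mul_pow, sq_abs]
    push_cast
    calc 2 * (ε⁻¹ * 2) * (((d : ℝ) + 1) * (Λ * M ^ 2 * ((C₀ / lam) ^ 2 * (X0.2 - Y0.2) ^ 2) / 2))
        = ε⁻¹ * (2 * ((d + 1) * (Λ * M ^ 2) * (C₀ / lam) ^ 2)) * (X0.2 - Y0.2) ^ 2 := by ring
      _ ≤ ε⁻¹ * (2 * ((d + 1) * (Λ * M ^ 2) * (C₀ / lam) ^ 2)) * (2 * M ^ 2 * ps v h X0 Y0) := by gcongr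
      _ = 4 * (d + 1) * (Λ * M ^ 2) * (C₀ / lam) ^ 2 * M ^ 2 * (ε⁻¹ * ps v h X0 Y0) := by ring
      _ ≤ _ := by gcongr
  · intro τ hτ
    obtain ⟨t1, t2⟩ := htime τ ⟨hτ.1.le, hτ.2.le⟩
    refine ⟨ε⁻¹ • ((2 : ℝ) • (PV v h X0 Y0 + (X0.2 - Y0.2) • (v (X0.2 - τ) - v X0.2)
      + lastC (X0.1 - Y0.1) • eN d)), ?_, ?_⟩
    · rw [norm_smul, norm_smul, Real.norm_of_nonneg hi.le, Real.norm_of_nonneg (by norm_num : (0:ℝ) ≤ 2)]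
      gcongr
      refine (norm_add₃_le).trans ?_
      rw [norm_smul, norm_smul, norm_eN, mul_one, Real.norm_eq_abs, Real.norm_eq_abs]
      gcongr
      have := v_lip D t1 (mem_time m.hX)
      rw [show X0.2 - τ - X0.2 = -τ by ring, abs_neg, abs_of_pos hτ.1] at this
      refine this.trans ?_
      have hli : 0 < lam⁻¹ := inv_pos.2 hl
      nlinarith only [hli, hτ.2, hrle]
    · intro ξ hξ ζ hζ
      have hξ' : (X0.1 + ξ, X0.2 - τ) ∈ Kc d 1 := g1 _ (by simpa using hξ) _ ⟨by linarith [hτ.2], by linarith [hτ.1]⟩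
      have hζ' : (Y0.1 + ζ, Y0.2 - τ) ∈ Kc d 1 := g2 _ (by simpa using hζ) _ ⟨by linarith [hτ.2], by linarith [hτ.1]⟩
      have a1 := m.hmax _ (subset_closure hξ') _ (subset_closure hζ')
      have a2 := ps_incr D m.hh m.hX ξ ζ (Y := Y0) hτ.1.le (hτ.2.le.trans hrle) t1
      have a3 := mul_le_mul_of_nonneg_left a2 hi.le
      rw [inner_smul_left]
      simp only [conj_trivial]
      simp only at a1
      have a4 : ε⁻¹ * (τ * (4 * M / lam + 2 * M ^ 2 / lam ^ 2) * ps v h X0 Y0) ≤ τ * (δ / 2) := by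
        rw [show ε⁻¹ * (τ * (4 * M / lam + 2 * M ^ 2 / lam ^ 2) * ps v h X0 Y0) =
          τ * ((4 * M / lam + 2 * M ^ 2 / lam ^ 2) * (ε⁻¹ * ps v h X0 Y0)) by ring]
        refine mul_le_mul_of_nonneg_left (le_trans ?_ hg2) hτ.1.le
        exact mul_le_mul_of_nonneg_left m.hps (by positivity)
      linarith only [a1, a3, a4]

lemma exists_rho {X : Type*} [TopologicalSpace X] {K : Set X} (hK : IsCompact K) {f g : X → ℝ}
    (hf : ContinuousOn f K) (hg : ContinuousOn g K) (hg0 : ∀ x ∈ K, 0 ≤ g x) {m γ : ℝ}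
    (hm : ∀ x ∈ K, g x = 0 → f x ≤ m) (hγ : 0 < γ) :
    ∃ ρ > 0, ∀ x ∈ K, g x < ρ → f x < m + γ := by
  have hK1 : IsCompact (K ∩ f ⁻¹' (Ici (m + γ))) := by
    obtain ⟨V, hV, e⟩ := continuousOn_iff_isClosed.1 hf _ (isClosed_Ici (a := m + γ))
    rw [inter_comm, e, inter_comm]
    exact hK.inter_right hV
  rcases (K ∩ f ⁻¹' (Ici (m + γ))).eq_empty_or_nonempty with he | hne
  · refine ⟨1, one_pos, fun x hx _ => ?_⟩
    by_contra hcon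
    exact absurd (show x ∈ (K ∩ f ⁻¹' (Ici (m + γ))) from ⟨hx, not_lt.1 hcon⟩) (by simp [he])
  · obtain ⟨x0, hx0, hmin⟩ := hK1.exists_isMinOn hne (hg.mono inter_subset_left)
    refine ⟨g x0, ?_, fun x hx hlt => ?_⟩
    · rcases (hg0 _ hx0.1).lt_or_eq with h | h
      · exact h
      · have := hm _ hx0.1 h.symm
        have h2 : m + γ ≤ f x0 := hx0.2
        linarith
    · by_contra hcon
      exact absurd (hmin (show x ∈ (K ∩ f ⁻¹' (Ici (m + γ))) from ⟨hx, not_lt.1 hcon⟩)) (not_le.2 hlt)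

end
end GH

noncomputable section GH

section
variable {d : ℕ} {lam Λ M C₀ α N : ℝ} {Q Q' : ℝ → Matrix (Fin (d + 1)) (Fin (d + 1)) ℝ}
  {v v' : ℝ → Eucl (d + 1)} {u : SpaceTime (d + 1) → ℝ}

lemma cL_ge (D : ObliqueData d lam Λ M C₀ Q Q' v v') : 8 ≤ cL d Λ M := by
  have h1 := cB1_pos d Λ M
  have hk := kap_ge_one D
  have h2 : 0 ≤ 2 * (Λ * M ^ 2) * (2 * (Λ * M ^ 2 * (d + 1)) + 1) := by positivity
  unfold cL
  nlinarith only [h1, h2, mul_nonneg h1.le h2]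

lemma bdry_pair (h : HB d lam Λ M C₀ α N Q Q' v v' u) (hα : aOK d Λ M α) {a b : Eucl (d + 1)} {s : ℝ}
    (ha : (a, s) ∈ closure (Kc d 1)) (hb : (b, s) ∈ closure (Kc d 1))
    (hc : ‖a‖ = 1 ∨ ‖b‖ = 1 ∨ s = -1) :
    u (a, s) - u (b, s) ≤ cL d Λ M * N * ‖a - b‖ ^ α := by
  rcases hc with hc | hc | hc
  · have := lateral h.neg hα hc (mem_closure_Kc.1 ha).2.1 (mem_time ha) hb
    rw [norm_sub_rev] at this
    linarith
  · exact lateral h hα hc (mem_closure_Kc.1 hb).2.1 (mem_time ha) ha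
  · have h1 := h.data1 (mem_bdryK ha (Or.inr hc)) (mem_bdryK hb (Or.inr hc)) (pdistL_le2 h.D.lam_pos _ _)
    simp only [sub_self, abs_zero, zero_div, Real.sqrt_zero, add_zero] at h1
    have h2 := mul_rpow_le (c := 2) (by norm_num) (norm_nonneg (a - b)) (by linarith [h.a1] : α ≤ 1)
    have h3 := mul_le_mul_of_nonneg_left h2 h.hN.le
    have h4 := mul_nonneg h.hN.le (Real.rpow_nonneg (norm_nonneg (a - b)) α)
    nlinarith only [h1, h3, h4, cL_ge h.D]

lemma exists_gamma {K1 K2 K3 a b c : ℝ} (ha : 0 < a) (hb : 0 < b) (hc : 0 < c) (h1 : 0 ≤ K1) (h2 : 0 ≤ K2)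
    (h3 : 0 ≤ K3) : ∃ γ > 0, K1 * γ < a ∧ K2 * γ ≤ b ∧ K3 * γ < c := by
  refine ⟨min (min (a / (K1 + 1)) (b / (K2 + 1))) (c / (K3 + 1)), by positivity, ?_, ?_, ?_⟩
  · calc _ ≤ K1 * (a / (K1 + 1)) := by gcongr; exact (min_le_left _ _).trans (min_le_left _ _)
      _ < a := by rw [mul_div_assoc', div_lt_iff₀ (by linarith)]; nlinarith
  · calc _ ≤ K2 * (b / (K2 + 1)) := by gcongr; exact (min_le_left _ _).trans (min_le_right _ _)
      _ ≤ b := by rw [mul_div_assoc', div_le_iff₀ (by linarith)]; nlinarith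
  · calc _ ≤ K3 * (c / (K3 + 1)) := by gcongr; exact min_le_right _ _
      _ < c := by rw [mul_div_assoc', div_lt_iff₀ (by linarith)]; nlinarith

lemma v_cont (D : ObliqueData d lam Λ M C₀ Q Q' v v') : ContinuousOn v (Icc (-1 : ℝ) 0) :=
  fun t ht => (D.vderiv t ht).continuousWithinAt

lemma ps_zero (D : ObliqueData d lam Λ M C₀ Q Q' v v') {h : Eucl (d + 1)} (hh : lastC h = 0)
    {X Y : SpaceTime (d + 1)} (hX : X ∈ closure (Kc d 1)) (h0 : ps v h X Y = 0) :
    X.2 = Y.2 ∧ X.1 - Y.1 = h := by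
  have h1 := sigma_le D hh hX (Y := Y)
  rw [h0, mul_zero] at h1
  have h2 : X.2 - Y.2 = 0 := pow_eq_zero_iff (two_ne_zero) |>.1 (le_antisymm h1 (sq_nonneg _))
  refine ⟨sub_eq_zero.1 h2, ?_⟩
  have h3 : ‖PV v h X Y‖ ^ 2 = 0 := by
    unfold ps at h0
    linarith [sq_nonneg ‖PV v h X Y‖, sq_nonneg (lastC (X.1 - Y.1))]
  have h4 := norm_eq_zero.1 (pow_eq_zero_iff (two_ne_zero) |>.1 h3)
  rw [PV, h2, zero_smul, add_zero, sub_eq_zero] at h4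
  rw [h4]; abel

lemma tang (h : HB d lam Λ M C₀ α N Q Q' v v' u) (hα : aOK d Λ M α) {x y : Eucl (d + 1)} {t : ℝ}
    (hX : (x, t) ∈ closure (Kc d 1)) (hY : (y, t) ∈ closure (Kc d 1)) (hl : lastC x = lastC y) :
    u (x, t) - u (y, t) ≤ cL d Λ M * N * ‖x - y‖ ^ α := by
  by_contra! hcon
  set e := x - y with he
  have hh : lastC e = 0 := by rw [he, lastC_sub, hl, sub_self]
  set A0 := cL d Λ M * N * ‖e‖ ^ α with hA0
  have hA00 : 0 ≤ A0 := by
    have := cL_ge h.D; have := h.hN; positivity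
  obtain ⟨m0, hm0⟩ : ∃ m0, m0 = u (x, t) - u (y, t) - A0 := ⟨_, rfl⟩
  have hm00 : 0 < m0 := by linarith
  have D := h.D
  have hlam := D.lam_pos
  have hM := D.M_ge_one
  have hk := kap_ge_one D
  have hC0 := D.C0_pos
  have hN := h.hN
  obtain ⟨δ, hδ⟩ : ∃ δ, δ = m0 / 4 := ⟨_, rfl⟩
  have hδ0 : 0 < δ := by linarith
  obtain ⟨γ, hγ0, hγ1, hγ2, hγ3⟩ := exists_gamma (K1 := 4 * M / lam) (K2 := 4 * M / lam + 2 * M ^ 2 / lam ^ 2)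
    (K3 := 4 * (d + 1) * (Λ * M ^ 2) * (C₀ / lam) ^ 2 * M ^ 2) (a := δ / 2) (b := δ / 2) (c := lam * (δ / 2))
    (by positivity) (by positivity) (by positivity) (by positivity) (by positivity) (by positivity)
  let K : Set (SpaceTime (d + 1) × SpaceTime (d + 1)) := closure (Kc d 1) ×ˢ closure (Kc d 1)
  have hK : IsCompact K := (isCompact_closure_Kc d).prod (isCompact_closure_Kc d)
  let F : SpaceTime (d + 1) × SpaceTime (d + 1) → ℝ := fun p => u p.1 - u p.2 - δ / 2 * (p.1.2 + p.2.2)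
  let g : SpaceTime (d + 1) × SpaceTime (d + 1) → ℝ := fun p => ps v e p.1 p.2
  have hFc : ContinuousOn F K := by
    refine ContinuousOn.sub (ContinuousOn.sub (h.cont.comp continuousOn_fst fun p hp => hp.1)
      (h.cont.comp continuousOn_snd fun p hp => hp.2)) (by fun_prop)
  have hgc : ContinuousOn g K := by
    have hv : ContinuousOn (fun p : SpaceTime (d + 1) × SpaceTime (d + 1) => v p.1.2) K :=
      (v_cont D).comp (by fun_prop) fun p hp => mem_time hp.1
    have h1 : Continuous (fun p : SpaceTime (d + 1) × SpaceTime (d + 1) => lastC (p.1.1 - p.2.1)) :=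
      lastC_continuous.comp (by fun_prop)
    have h2 : ContinuousOn (fun p : SpaceTime (d + 1) × SpaceTime (d + 1) => PV v e p.1 p.2) K := by
      unfold PV
      refine ContinuousOn.add (f := fun p : SpaceTime (d + 1) × SpaceTime (d + 1) => p.1.1 - (p.2.1 + e)) (g := fun p => (p.1.2 - p.2.2) • v p.1.2) (Continuous.continuousOn (by fun_prop)) (ContinuousOn.smul (f := fun p : SpaceTime (d + 1) × SpaceTime (d + 1) => p.1.2 - p.2.2) (Continuous.continuousOn (by fun_prop)) hv)
    exact (h2.norm.pow 2).add (h1.pow 2).continuousOn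
  have hg0 : ∀ p ∈ K, 0 ≤ g p := fun p _ => by simp only [g, ps]; positivity
  have hp0K : (((x, t), (y, t)) : SpaceTime (d + 1) × SpaceTime (d + 1)) ∈ K := ⟨hX, hY⟩
  have hp0g : g ((x, t), (y, t)) = 0 := by
    simp only [g, ps, PV]
    rw [← he, hh]; simp [he]
  have htle : ∀ p ∈ K, p.1.2 + p.2.2 ≤ 0 ∧ -2 ≤ p.1.2 + p.2.2 := fun p hp => by
    have h1 := mem_time hp.1
    have h2 := mem_time hp.2
    constructor <;> linarith [h1.1, h1.2, h2.1, h2.2]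
  -- maximum on the zero set
  obtain ⟨p1, ⟨hp1K, hp1g⟩, hp1⟩ : ∃ p1 ∈ K ∩ g ⁻¹' {0}, IsMaxOn F (K ∩ g ⁻¹' {0}) p1 := by
    have hne : (K ∩ g ⁻¹' {0}).Nonempty := ⟨((x, t), (y, t)), hp0K, hp0g⟩
    refine IsCompact.exists_isMaxOn ?_ hne (hFc.mono inter_subset_left)
    obtain ⟨V, hV, e⟩ := continuousOn_iff_isClosed.1 hgc _ (isClosed_singleton (x := (0 : ℝ)))
    rw [inter_comm, e, inter_comm]
    exact hK.inter_right hV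
  have hF1 : A0 + m0 ≤ F p1 := by
    have h1 : F ((x, t), (y, t)) ≤ F p1 := hp1 ⟨hp0K, hp0g⟩
    have h2 : A0 + m0 ≤ F ((x, t), (y, t)) := by
      have := (htle _ hp0K).1
      simp only [F] at this ⊢
      nlinarith only [this, hm0, hδ0]
    linarith
  obtain ⟨ρ1, hρ1, r1⟩ := exists_rho hK hFc hgc hg0 (m := F p1) (γ := γ)
    (fun p hp hp0 => hp1 ⟨hp, hp0⟩) hγ0
  let B : Set (SpaceTime (d + 1) × SpaceTime (d + 1)) := {p | ‖p.1.1‖ = 1 ∨ p.1.2 = -1 ∨ ‖p.2.1‖ = 1 ∨ p.2.2 = -1}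
  have hBc : IsClosed B := by
    refine (isClosed_eq (by fun_prop) continuous_const).union ((isClosed_eq (by fun_prop) continuous_const).union
      ((isClosed_eq (by fun_prop) continuous_const).union (isClosed_eq (by fun_prop) continuous_const)))
  obtain ⟨ρ2, hρ2, r2⟩ := exists_rho (hK.inter_right hBc) (hFc.mono inter_subset_left)
    (hgc.mono inter_subset_left) (fun p hp => hg0 p hp.1) (m := A0 + δ) (γ := δ) (by
      rintro ⟨⟨a, s⟩, ⟨b, s'⟩⟩ ⟨hpK, hpB⟩ hp0
      obtain ⟨e1, e2⟩ := ps_zero D hh hpK.1 hp0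
      simp only at e1 e2
      subst e1
      have h1 := bdry_pair h hα hpK.1 hpK.2 (by
        simp only [B, mem_ofPred_eq] at hpB
        tauto)
      rw [e2] at h1
      have := (htle _ hpK).2
      simp only [F] at this ⊢
      nlinarith only [this, h1, hδ0]) hδ0
  obtain ⟨ρ3, hρ3, r3⟩ := exists_rho hK (f := fun p : SpaceTime (d + 1) × SpaceTime (d + 1) => |p.1.2 - p.2.2|) (by fun_prop) hgc hg0
    (m := 0) (γ := 2 / (Λ * M ^ 2 * (C₀ / lam))) (fun p hp hp0 => by
      simp [(ps_zero D hh hp.1 hp0).1]) (by positivity)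
  obtain ⟨ε, hε0, hε1, hε2, hε3⟩ := exists_gamma (K1 := 4 * N) (K2 := 4 * N) (K3 := 4 * N) hρ1 hρ2 hρ3
    (by positivity) (by positivity) (by positivity)
  have hi : 0 < ε⁻¹ := inv_pos.2 hε0
  obtain ⟨p0, hp0K', hp0⟩ := hK.exists_isMaxOn ⟨_, hp1K⟩ (hFc.sub (hgc.const_smul ε⁻¹))
  have hmax : ∀ p ∈ K, F p - ε⁻¹ * g p ≤ F p0 - ε⁻¹ * g p0 := fun p hp => hp0 hp
  have h1 := hmax p1 hp1K
  rw [show g p1 = 0 from hp1g, mul_zero, sub_zero] at h1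
  have hg00 := hg0 p0 hp0K'
  have hFle : F p0 ≤ 2 * N + δ := by
    have h2 := h.bd2 hp0K'.1 hp0K'.2
    have := (htle _ hp0K').2
    simp only [F]
    nlinarith only [this, h2, hδ0]
  have hg1 : g p0 ≤ 2 * N * ε := by
    have h3 : ε⁻¹ * g p0 ≤ 2 * N := by linarith
    rw [inv_mul_le_iff₀ hε0] at h3
    linarith
  have hNε : 0 < N * ε := by positivity
  have q1 := r1 p0 hp0K' (by linarith)
  have q3 := r3 p0 hp0K' (by linarith)
  have q2 : p0 ∉ B := fun hB => by
    have := r2 p0 ⟨hp0K', hB⟩ (by linarith)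
    have := mul_nonneg hi.le hg00
    linarith
  simp only [B, mem_ofPred_eq, not_or] at q2
  have m : DM d lam M v u e δ ε γ p0.1 p0.2 := ⟨hh, hδ0, hε0, hp0K'.1, hp0K'.2,
    fun X hX Y hY => hmax (X, Y) ⟨hX, hY⟩, by
      show ε⁻¹ * g p0 ≤ γ
      linarith, by
      rw [show 4 * M * γ / lam = 4 * M / lam * γ by ring]; exact hγ1⟩
  rcases trichotomy hp0K'.1 with hc | hcX | hcX
  · rcases hc with hc | hc
    · exact q2.1 hc
    · exact q2.2.1 hc
  · rcases trichotomy hp0K'.2 with hc | hcY | hcY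
    · rcases hc with hc | hc
      · exact q2.2.2.1 hc
      · exact q2.2.2.2 hc
    · refine m.int D h.cont h.bd h.sub h.sub' hcX hcY hγ2 hγ3 ?_
      simp only [zero_add] at q3
      rw [lt_div_iff₀ (by positivity)] at q3
      linarith
    · exact m.F2 D h.sub' hcY
  · exact m.F1 D h.sub hcX

end
end GH

noncomputable section GH

section
variable {d : ℕ} {lam Λ M C₀ α N : ℝ} {Q Q' : ℝ → Matrix (Fin (d + 1)) (Fin (d + 1)) ℝ}
  {v v' : ℝ → Eucl (d + 1)} {u : SpaceTime (d + 1) → ℝ}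

/-- spatial constant -/
def cK (d : ℕ) (Λ M : ℝ) : ℝ := 2 * (Λ * M ^ 2) ^ 2 * (d + 1) + M ^ 2 + 1

def wsp (d : ℕ) (Λ M α : ℝ) (z : Eucl (d + 1)) : ℝ :=
  (‖z‖ ^ 2) ^ (α / 2) + cK d Λ M * (lastC z ^ 2) ^ (α / 2)

lemma lastsq_le (z : Eucl (d + 1)) : lastC z ^ 2 ≤ ‖z‖ ^ 2 := by
  rw [← sq_abs]; gcongr; exact abs_lastC_le _

lemma sp_num1 {q f g Tr Qn K κ X n : ℝ} (hq : 0 < q) (hq1 : q ≤ 1 / 4) (hg : 0 < g) (hfg : f ≤ g) (hf : 0 ≤ f)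
    (hTr : Tr ≤ κ * n) (hTr0 : 0 ≤ Tr) (hκ : 1 ≤ κ) (hQn : κ⁻¹ ≤ Qn) (hX : 0 ≤ X) (hK : 2 * κ ^ 2 * n < K) (hn : 0 ≤ n) :
    q * f * (2 * Tr) + q * ((q - 1) * X) + K * (q * g * (2 * Qn) + q * ((q - 1) * (4 * g * Qn))) < 0 := by
  have hκ0 : 0 < κ := by linarith
  have h1 : q * f * (2 * Tr) ≤ q * g * (2 * (κ * n)) := by gcongr
  have h2 : q * ((q - 1) * X) ≤ 0 := by
    have : (q - 1) * X ≤ 0 := mul_nonpos_of_nonpos_of_nonneg (by linarith) hX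
    exact mul_nonpos_of_nonneg_of_nonpos hq.le this
  have hQ0 : 0 < Qn := lt_of_lt_of_le (by positivity) hQn
  have hK0 : 0 < K := lt_of_le_of_lt (by positivity) hK
  have h3 : K * (q * g * (2 * Qn) + q * ((q - 1) * (4 * g * Qn))) ≤ - (q * g * (K * κ⁻¹)) := by
    have e : K * (q * g * (2 * Qn) + q * ((q - 1) * (4 * g * Qn))) = - (q * g * (K * Qn) * (2 - 4 * q)) := by ring
    rw [e, neg_le_neg_iff]
    have a1 : q * g * (K * κ⁻¹) ≤ q * g * (K * Qn) := by gcongr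
    have a2 : 0 ≤ q * g * (K * Qn) := by positivity
    nlinarith only [a1, a2, hq1]
  have h4 : 2 * (κ * n) < K * κ⁻¹ := by
    rw [← div_eq_mul_inv, lt_div_iff₀ hκ0]; nlinarith only [hK]
  have h5 : q * g * (2 * (κ * n)) < q * g * (K * κ⁻¹) := by gcongr
  linarith

lemma spat_jet (D : ObliqueData d lam Λ M C₀ Q Q' v v') (a0 : 0 < α) (a1 : α ≤ 1 / 2)
    {p₀ : SpaceTime (d + 1)} (hp : p₀ ∈ closure (Kc d 1)) {c : Eucl (d + 1)} (hz : lastC (p₀.1 - c) ≠ 0) :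
    ∃ L β p, GJ (PF p₀) (Q p₀.2) lam (v p₀.2) p₀ (fun q => wsp d Λ M α (q.1 - c)) L β p ∧ L < 0 ∧
      (lastC (p₀.1 - c) < 0 → β < 0) := by
  have ht := mem_time hp
  have hl := PF_le p₀
  have hM := D.M_ge_one
  have hk := kap_ge_one D
  set z := p₀.1 - c with hzdef
  have hg : 0 < lastC z ^ 2 := by positivity
  have hfg := lastsq_le z
  have hf : 0 < ‖z‖ ^ 2 := lt_of_lt_of_le hg hfg
  have j1 := (GJ.nsq (Qm := Q p₀.2) (lam := lam) (w := v p₀.2) hl c).rpow hl hf (α / 2)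
  have j2 := ((GJ.lin (Qm := Q p₀.2) (lam := lam) (w := v p₀.2) hl (eN d) c).sq hl).rpow hl
    (by rw [inner_eN]; exact hg) (α / 2)
  have j := j1.add (j2.const_mul (cK d Λ M))
  simp only [inner_eN, ← hzdef] at j
  refine ⟨_, _, _, j, ?_, ?_⟩
  · have eg : lastC z ^ 2 * (lastC z ^ 2) ^ (α / 2 - 2) = (lastC z ^ 2) ^ (α / 2 - 1) := by
      rw [show α / 2 - 1 = (α / 2 - 2) + 1 by ring, Real.rpow_add_one hg.ne']; ring
    have hfg' : (‖z‖ ^ 2) ^ (α / 2 - 1) ≤ (lastC z ^ 2) ^ (α / 2 - 1) :=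
      Real.rpow_le_rpow_of_nonpos hg hfg (by linarith)
    have hQn := Q_lower D ht (eN d)
    rw [norm_eN, one_pow, mul_one] at hQn
    have key := sp_num1 (q := α / 2) (by linarith) (by linarith) (Real.rpow_pos_of_pos hg (α / 2 - 1)) hfg'
      (Real.rpow_nonneg hf.le _) (Q_trace D ht) (Q_trace_nonneg D ht).le hk hQn
      (mul_nonneg (Real.rpow_nonneg hf.le (α / 2 - 2)) (Q_qf_nonneg D ht ((2 : ℝ) • z)))
      (K := cK d Λ M) (by unfold cK; nlinarith only [hM]) (by positivity)
    refine lt_of_eq_of_lt ?_ key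
    rw [qf_two _ (eN d), ← eg]; ring
  · intro hneg
    have hG := Real.rpow_pos_of_pos hg (α / 2 - 1)
    have hr0 : 0 < ‖z‖ := by
      rcases (norm_nonneg z).lt_or_eq with h | h
      · exact h
      · rw [← h] at hf; norm_num at hf
    have hn : ∀ r : ℝ, 0 < r → (r ^ 2) ^ (α / 2 - 1) * r = (r ^ 2) ^ (α / 2 - 1 / 2) := fun r hr => by
      rw [show (r ^ 2) ^ (α / 2 - 1 / 2) = (r ^ 2) ^ ((α / 2 - 1) + 1 / 2) by ring_nf,
        Real.rpow_add (by positivity), ← Real.sqrt_eq_rpow, Real.sqrt_sq hr.le]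
    have h1 := hn _ hr0
    have h2 := hn _ (neg_pos.2 hneg)
    rw [neg_sq] at h2
    have h3 : (‖z‖ ^ 2) ^ (α / 2 - 1 / 2) ≤ (lastC z ^ 2) ^ (α / 2 - 1 / 2) :=
      Real.rpow_le_rpow_of_nonpos hg hfg (by linarith)
    rw [← h1, ← h2] at h3
    have h4 : ⟪v p₀.2, z⟫ ≤ M * ‖z‖ := (real_inner_le_norm _ _).trans (by gcongr; exact D.vbound _ ht)
    have h5 : lastC (v p₀.2) = ⟪v p₀.2, eN d⟫ := by rw [real_inner_comm, inner_eN]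
    have h6 := D.vlast _ ht
    rw [h5] at h6
    set G := (lastC z ^ 2) ^ (α / 2 - 1)
    set F := (‖z‖ ^ 2) ^ (α / 2 - 1)
    have hF : 0 ≤ F := Real.rpow_nonneg hf.le _
    have b1 : F * ⟪v p₀.2, z⟫ ≤ M * (G * -lastC z) := by nlinarith only [h3, h4, hF, hM]
    have hGz : 0 < G * -lastC z := mul_pos hG (neg_pos.2 hneg)
    have hK : M ^ 2 < cK d Λ M := by
      unfold cK
      have : 0 ≤ 2 * (Λ * M ^ 2) ^ 2 * ((d : ℝ) + 1) := by positivity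
      linarith
    have b2 : M < cK d Λ M * ⟪v p₀.2, eN d⟫ := by
      calc M = M ^ 2 * M⁻¹ := by field_simp
        _ < cK d Λ M * M⁻¹ := by gcongr
        _ ≤ _ := by
          have : 0 ≤ cK d Λ M := (sq_nonneg M).trans hK.le
          gcongr
    have b3 := mul_lt_mul_of_pos_right b2 hGz
    have b4 : 0 < α * (cK d Λ M * ⟪v p₀.2, eN d⟫ * (G * -lastC z) - F * ⟪v p₀.2, z⟫) :=
      mul_pos a0 (by linarith)
    nlinarith only [b4]

lemma sp_touch (D : ObliqueData d lam Λ M C₀ Q Q' v v') (a0 : 0 < α) (a1 : α ≤ 1 / 2)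
    (hu : ObliqueSub d lam Q v u) {L e : ℝ} (hL : 0 < L) (he : 0 < e)
    {p₀ : SpaceTime (d + 1)} (hp : p₀ ∈ closure (Kc d 1)) (hpi : p₀ ∈ Kc d 1 ∨ p₀ ∈ Fc d 1)
    {c : Eucl (d + 1)} {s : ℝ} (hz : lastC (p₀.1 - c) ≠ 0) (hc : 0 ≤ lastC c)
    (hm : ∀ q ∈ closure (Kc d 1), u q - (L * wsp d Λ M α (q.1 - c) + e * (q.2 - s) ^ 2) ≤
      u p₀ - (L * wsp d Λ M α (p₀.1 - c) + e * (p₀.2 - s) ^ 2)) : p₀.2 < s := by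
  obtain ⟨L', β, p, j, h1, h2⟩ := spat_jet D a0 a1 hp hz
  have hl := PF_le p₀
  have hlam := D.lam_pos
  have j' := (j.const_mul L).add (((GJ.time (Qm := Q p₀.2) (lam := lam) (w := v p₀.2) hl s).sq hl).const_mul e)
  have q0 : qf (Q p₀.2) (0 : Eucl (d + 1)) = 0 := by simp [qf]
  rw [q0] at j'
  obtain ⟨b, A, k1, k2, k3⟩ := j'
  have k := jet_touch hu hp k1 (eventually_nhdsWithin_of_forall fun q hq => by
    have := hm q hq.1
    linarith)
  by_contra! hcon
  have hσ : 0 ≤ p₀.2 - s := by linarith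
  rcases hpi with hi | hi
  · have k4 := k.1 hi
    have := mul_neg_of_pos_of_neg hL h1
    have : 0 ≤ e * (2 * (p₀.2 - s) * lam) := by positivity
    linarith
  · have k4 := k.2 hi
    have := mul_neg_of_pos_of_neg hL (h2 (lt_of_le_of_ne (by rw [lastC_sub, hi.2.1]; linarith) hz))
    have : 0 ≤ e * (2 * (p₀.2 - s)) := by positivity
    linarith

lemma wsp_cont (hα : 0 < α) : Continuous (wsp d Λ M α) := by
  unfold wsp
  have := lastC_continuous (d := d)
  refine Continuous.add ?_ (Continuous.mul continuous_const ?_)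
  · exact Continuous.rpow_const (by fun_prop) fun x => Or.inr (by linarith)
  · exact Continuous.rpow_const (by fun_prop) fun x => Or.inr (by linarith)

lemma wsp_neg (z : Eucl (d + 1)) : wsp d Λ M α (-z) = wsp d Λ M α z := by
  have : lastC (-z) ^ 2 = lastC z ^ 2 := by
    rw [← zero_sub, lastC_sub]; unfold lastC; simp
  unfold wsp
  rw [norm_neg, this]

lemma cK_pos (hM : 1 ≤ M) : 0 < cK d Λ M := by unfold cK; positivity

lemma wsp_ge (hM : 1 ≤ M) (z : Eucl (d + 1)) : ‖z‖ ^ α ≤ wsp d Λ M α z := by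
  unfold wsp
  rw [sq_rpow_half (norm_nonneg _)]
  have := cK_pos (d := d) (Λ := Λ) hM
  have : 0 ≤ cK d Λ M * (lastC z ^ 2) ^ (α / 2) := by positivity
  linarith

lemma wsp_le (hM : 1 ≤ M) (hα : 0 < α) (z : Eucl (d + 1)) : wsp d Λ M α z ≤ (1 + cK d Λ M) * ‖z‖ ^ α := by
  unfold wsp
  rw [sq_rpow_half (norm_nonneg _)]
  have := cK_pos (d := d) (Λ := Λ) hM
  have h1 := half_rpow_le (norm_nonneg z) (sq_nonneg (lastC z)) (lastsq_le z) hα.le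
  have := mul_le_mul_of_nonneg_left h1 this.le
  linarith

/-- spatial Hölder constant -/
def cS (d : ℕ) (Λ M : ℝ) : ℝ := cL d Λ M * (1 + cK d Λ M)

lemma cS_ge (D : ObliqueData d lam Λ M C₀ Q Q' v v') : 8 ≤ cS d Λ M := by
  have h1 := cL_ge D
  have h2 := cK_pos (d := d) (Λ := Λ) D.M_ge_one
  unfold cS
  nlinarith only [h1, h2]

lemma spatial (h : HB d lam Λ M C₀ α N Q Q' v v' u) (hα : aOK d Λ M α) {x y : Eucl (d + 1)} {t : ℝ}
    (hX : (x, t) ∈ closure (Kc d 1)) (hY : (y, t) ∈ closure (Kc d 1)) :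
    u (x, t) - u (y, t) ≤ cS d Λ M * N * ‖x - y‖ ^ α := by
  have D := h.D
  have hM := D.M_ge_one
  have hN := h.hN
  have hcL := cL_ge D
  obtain ⟨L, hL⟩ : ∃ L, L = cL d Λ M * N := ⟨_, rfl⟩
  have hL0 : 0 < L := by rw [hL]; positivity
  suffices hs : u (x, t) - u (y, t) ≤ L * wsp d Λ M α (x - y) by
    have h1 := mul_le_mul_of_nonneg_left (wsp_le (Λ := Λ) hM h.a0 (x - y)) hL0.le
    have : cS d Λ M * N * ‖x - y‖ ^ α = L * ((1 + cK d Λ M) * ‖x - y‖ ^ α) := by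
      rw [hL, cS]; ring
    linarith
  by_contra! hcon
  obtain ⟨m0, hm0⟩ : ∃ m0, m0 = u (x, t) - u (y, t) - L * wsp d Λ M α (x - y) := ⟨_, rfl⟩
  have hm00 : 0 < m0 := by linarith
  let K : Set (SpaceTime (d + 1) × SpaceTime (d + 1)) := closure (Kc d 1) ×ˢ closure (Kc d 1)
  have hK : IsCompact K := (isCompact_closure_Kc d).prod (isCompact_closure_Kc d)
  let F : SpaceTime (d + 1) × SpaceTime (d + 1) → ℝ := fun p => u p.1 - u p.2 - L * wsp d Λ M α (p.1.1 - p.2.1)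
  let g : SpaceTime (d + 1) × SpaceTime (d + 1) → ℝ := fun p => (p.1.2 - p.2.2) ^ 2
  have hFc : ContinuousOn F K := by
    refine ContinuousOn.sub (ContinuousOn.sub (h.cont.comp continuousOn_fst fun p hp => hp.1)
      (h.cont.comp continuousOn_snd fun p hp => hp.2)) (Continuous.continuousOn ?_)
    exact continuous_const.mul ((wsp_cont h.a0).comp (by fun_prop))
  have hgc : ContinuousOn g K := by fun_prop
  have hg0 : ∀ p ∈ K, 0 ≤ g p := fun p _ => sq_nonneg _
  have hp0K : (((x, t), (y, t)) : SpaceTime (d + 1) × SpaceTime (d + 1)) ∈ K := ⟨hX, hY⟩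
  let B : Set (SpaceTime (d + 1) × SpaceTime (d + 1)) :=
    {p | lastC (p.1.1 - p.2.1) = 0 ∨ ‖p.1.1‖ = 1 ∨ p.1.2 = -1 ∨ ‖p.2.1‖ = 1 ∨ p.2.2 = -1}
  have hBc : IsClosed B := by
    refine (isClosed_eq (lastC_continuous.comp (by fun_prop)) continuous_const).union ((isClosed_eq (by fun_prop) continuous_const).union ((isClosed_eq (by fun_prop) continuous_const).union
      ((isClosed_eq (by fun_prop) continuous_const).union (isClosed_eq (by fun_prop) continuous_const))))
  obtain ⟨ρ, hρ, r2⟩ := exists_rho (hK.inter_right hBc) (hFc.mono inter_subset_left)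
    (hgc.mono inter_subset_left) (fun p hp => hg0 p hp.1) (m := 0) (γ := m0) (by
      rintro ⟨⟨a, s⟩, ⟨b, s'⟩⟩ ⟨hpK, hpB⟩ hp0
      have e1 : s = s' := sub_eq_zero.1 (pow_eq_zero_iff two_ne_zero |>.1 hp0)
      subst e1
      have h1 : u (a, s) - u (b, s) ≤ cL d Λ M * N * ‖a - b‖ ^ α := by
        rcases hpB with hB | hB
        · rw [lastC_sub, sub_eq_zero] at hB
          exact tang h hα hpK.1 hpK.2 hB
        · exact bdry_pair h hα hpK.1 hpK.2 (by simp only at hB; tauto)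
      rw [← hL] at h1
      have := mul_le_mul_of_nonneg_left (wsp_ge (Λ := Λ) (α := α) hM (a - b)) hL0.le
      simp only [F]
      linarith) hm00
  obtain ⟨e, he⟩ : ∃ e, e = 4 * N / ρ := ⟨_, rfl⟩
  have he0 : 0 < e := by rw [he]; positivity
  obtain ⟨p0, hp0K', hp0⟩ := hK.exists_isMaxOn ⟨_, hp0K⟩ (hFc.sub (hgc.const_smul e))
  have hmax : ∀ p ∈ K, F p - e * g p ≤ F p0 - e * g p0 := fun p hp => hp0 hp
  have h1 := hmax _ hp0K
  have h1' : F ((x, t), (y, t)) - e * g ((x, t), (y, t)) = m0 := by simp only [F, g]; rw [hm0]; ring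
  rw [h1'] at h1
  have hg00 := hg0 p0 hp0K'
  have hw0 : 0 ≤ L * wsp d Λ M α (p0.1.1 - p0.2.1) :=
    mul_nonneg hL0.le ((Real.rpow_nonneg (norm_nonneg _) _).trans (wsp_ge hM _))
  have hFle : F p0 ≤ 2 * N := by
    have h2 := h.bd2 hp0K'.1 hp0K'.2
    simp only [F]
    linarith
  have hg1 : g p0 < ρ := by
    have h3 : e * g p0 ≤ 2 * N := by linarith
    rw [he, div_mul_eq_mul_div, div_le_iff₀ hρ] at h3
    nlinarith only [h3, hN, hρ]
  have q2 : p0 ∉ B := fun hB => by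
    have := r2 p0 ⟨hp0K', hB⟩ hg1
    have := mul_nonneg he0.le hg00
    linarith
  simp only [B, mem_ofPred_eq, not_or] at q2
  obtain ⟨q1, q3, q4, q5, q6⟩ := q2
  have c1 := sp_touch D h.a0 h.a1 h.sub hL0 he0 hp0K'.1 ((trichotomy hp0K'.1).resolve_left (by tauto))
    (s := p0.2.2) q1 (mem_closure_Kc.1 hp0K'.2).2.1 (fun q hq => by
      have := hmax (q, p0.2) ⟨hq, hp0K'.2⟩
      simp only [F, g] at this
      linarith)
  have c2 := sp_touch D h.a0 h.a1 h.sub' hL0 he0 hp0K'.2 ((trichotomy hp0K'.2).resolve_left (by tauto))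
    (s := p0.1.2) (c := p0.1.1) (fun h0 => q1 (by rw [lastC_sub] at h0 ⊢; linarith)) (mem_closure_Kc.1 hp0K'.1).2.1 (fun q hq => by
      have := hmax (p0.1, q) ⟨hp0K'.1, hq⟩
      simp only [F, g] at this
      rw [← neg_sub p0.1.1 q.1, ← neg_sub p0.1.1 p0.2.1, wsp_neg, wsp_neg, ← neg_sub p0.1.2 q.2,
        ← neg_sub p0.1.2 p0.2.2, neg_sq, neg_sq]
      linarith)
  linarith

end
end GH

noncomputable section GH

section
variable {d : ℕ} {lam Λ M C₀ α N : ℝ} {Q Q' : ℝ → Matrix (Fin (d + 1)) (Fin (d + 1)) ℝ}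
  {v v' : ℝ → Eucl (d + 1)} {u : SpaceTime (d + 1) → ℝ}

/-- time constant -/
def cU (d : ℕ) (Λ M : ℝ) : ℝ := 2 * (Λ * M ^ 2) ^ 2 * (d + 1 + 1) + 1

def ellT (M : ℝ) (y : Eucl (d + 1)) (s : ℝ) (q : SpaceTime (d + 1)) : ℝ := ⟪eN d, q.1 - y⟫ + 3 * M * (q.2 - s)

def wtm (d : ℕ) (Λ M α : ℝ) (y : Eucl (d + 1)) (s : ℝ) (q : SpaceTime (d + 1)) : ℝ :=
  (‖q.1 - y‖ ^ 2 + ellT M y s q ^ 2) ^ (α / 2) + cU d Λ M * (ellT M y s q ^ 2) ^ (α / 2)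

lemma cU_ge : 1 ≤ cU d Λ M := by
  unfold cU
  have : 0 ≤ 2 * (Λ * M ^ 2) ^ 2 * ((d : ℝ) + 1 + 1) := by positivity
  linarith

lemma wtm_beta {q F G iz B e K M z l : ℝ} (hq : 0 < q) (hF : 0 ≤ F) (hG : 0 < G) (h1 : iz ≤ M * z)
    (h3 : F * z ≤ G * l) (hl : 0 < l) (he : e ≤ M) (hM : 1 ≤ M) (hK : 1 ≤ K) (hB : B = 3 * M) :
    q * F * (2 * iz + 2 * l * (e + B * -1)) + K * (q * G * (2 * l * (e + B * -1))) < 0 := by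
  subst hB
  have a1 : F * iz ≤ M * (G * l) := by nlinarith only [h1, h3, hF, hM]
  have hGl : 0 < G * l := mul_pos hG hl
  have a2 : 0 ≤ F * l := by positivity
  have a3 : 0 ≤ F * l * (3 * M - e) := mul_nonneg a2 (by linarith)
  have a5 : 2 * M * (G * l) ≤ (3 * M - e) * (G * l) := by gcongr; linarith
  have a4 : 0 ≤ (3 * M - e) * (G * l) := mul_nonneg (by linarith) hGl.le
  have a6 : (3 * M - e) * (G * l) ≤ K * ((3 * M - e) * (G * l)) := by nlinarith only [a4, hK]
  have a7 : 0 < M * (G * l) := mul_pos (by linarith) hGl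
  have : 0 < q * (K * ((3 * M - e) * (G * l)) + F * l * (3 * M - e) - F * iz) :=
    mul_pos hq (by linarith)
  nlinarith only [this]

lemma wtm_jet (D : ObliqueData d lam Λ M C₀ Q Q' v v') (a0 : 0 < α) (a1 : α ≤ 1 / 2)
    {p₀ : SpaceTime (d + 1)} (hp : p₀ ∈ closure (Kc d 1)) {y : Eucl (d + 1)} {s : ℝ} (hz : 0 < ellT M y s p₀) :
    ∃ L β p, GJ (PF p₀) (Q p₀.2) lam (v p₀.2) p₀ (wtm d Λ M α y s) L β p ∧ L < 0 ∧ β < 0 := by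
  have ht := mem_time hp
  have hl := PF_le p₀
  have hM := D.M_ge_one
  have hlam := D.lam_pos
  have hk := kap_ge_one D
  have jl := (GJ.lin (Qm := Q p₀.2) (lam := lam) (w := v p₀.2) hl (eN d) y).add
    ((GJ.time (Qm := Q p₀.2) (lam := lam) (w := v p₀.2) hl s).const_mul (3 * M))
  change GJ _ _ _ _ _ (fun q => ellT M y s q) _ _ _ at jl
  have js := jl.sq hl
  have jf := (GJ.nsq (Qm := Q p₀.2) (lam := lam) (w := v p₀.2) hl y).add js
  obtain ⟨l, hl'⟩ : ∃ l, l = ellT M y s p₀ := ⟨_, rfl⟩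
  rw [← hl'] at hz
  have hg : 0 < l ^ 2 := by positivity
  obtain ⟨f, hf'⟩ : ∃ f, f = ‖p₀.1 - y‖ ^ 2 + l ^ 2 := ⟨_, rfl⟩
  have hfg : l ^ 2 ≤ f := by rw [hf']; nlinarith only [sq_nonneg ‖p₀.1 - y‖]
  have hf : 0 < f := lt_of_lt_of_le hg hfg
  have j := (jf.rpow hl (by rw [← hl', ← hf']; exact hf) (α / 2)).add
    ((js.rpow hl (by rw [← hl']; exact hg) (α / 2)).const_mul (cU d Λ M))
  change GJ _ _ _ _ _ (wtm d Λ M α y s) _ _ _ at j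
  rw [← hl', ← hf', smul_zero, add_zero] at j
  have hfg' : f ^ (α / 2 - 1) ≤ (l ^ 2) ^ (α / 2 - 1) :=
      Real.rpow_le_rpow_of_nonpos hg hfg (by linarith)
  have hG := Real.rpow_pos_of_pos hg (α / 2 - 1)
  have hF := Real.rpow_nonneg hf.le (α / 2 - 1)
  refine ⟨_, _, _, j, ?_, ?_⟩
  · have eg : l ^ 2 * (l ^ 2) ^ (α / 2 - 2) = (l ^ 2) ^ (α / 2 - 1) := by
      rw [show α / 2 - 1 = (α / 2 - 2) + 1 by ring, Real.rpow_add_one hg.ne']; ring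
    have hQn := Q_lower D ht (eN d)
    have hQn' := Q_upper D ht (eN d)
    rw [norm_eN, one_pow, mul_one] at hQn hQn'
    have key := sp_num1 (q := α / 2) (n := (d : ℝ) + 1 + 1) (Tr := (Q p₀.2).trace + qf (Q p₀.2) (eN d)) (by linarith) (by linarith) hG hfg'
      hF (by have := Q_trace D ht; linarith) (add_nonneg (Q_trace_nonneg D ht).le (Q_qf_nonneg D ht _)) hk hQn
      (mul_nonneg (Real.rpow_nonneg hf.le (α / 2 - 2)) (Q_qf_nonneg D ht ((2 : ℝ) • (p₀.1 - y) + (2 * l) • eN d)))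
      (K := cU d Λ M) (by unfold cU; linarith) (by positivity)
    have n1 : 0 ≤ (α / 2) * f ^ (α / 2 - 1) * (2 * l * (3 * M * lam)) := by positivity
    have hK := cU_ge (d := d) (Λ := Λ) (M := M)
    have n2 : 0 ≤ cU d Λ M * ((α / 2) * (l ^ 2) ^ (α / 2 - 1) * (2 * l * (3 * M * lam))) := by positivity
    refine lt_of_le_of_lt ?_ key
    rw [qf_two _ (eN d), ← eg] at *
    linarith only [n1, n2]
  · have hz0 : 0 ≤ ‖p₀.1 - y‖ := norm_nonneg _
    have hsqf : ∀ r : ℝ, 0 < r → r ^ (α / 2 - 1) * √r = r ^ (α / 2 - 1 / 2) := fun r hr => by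
      rw [show r ^ (α / 2 - 1 / 2) = r ^ ((α / 2 - 1) + 1 / 2) by ring_nf,
        Real.rpow_add (by positivity), ← Real.sqrt_eq_rpow]
    have h3 : f ^ (α / 2 - 1 / 2) ≤ (l ^ 2) ^ (α / 2 - 1 / 2) :=
      Real.rpow_le_rpow_of_nonpos hg hfg (by linarith)
    rw [← hsqf _ hf, ← hsqf _ hg, Real.sqrt_sq hz.le] at h3
    have hzf : ‖p₀.1 - y‖ ≤ √f := Real.le_sqrt_of_sq_le (by rw [hf']; linarith)
    have h3' := (mul_le_mul_of_nonneg_left hzf hF).trans h3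
    have h4 : ⟪v p₀.2, p₀.1 - y⟫ ≤ M * ‖p₀.1 - y‖ := (real_inner_le_norm _ _).trans (by gcongr; exact D.vbound _ ht)
    have h5 : ⟪v p₀.2, eN d⟫ ≤ M := (real_inner_le_norm _ _).trans (by rw [norm_eN, mul_one]; exact D.vbound _ ht)
    exact wtm_beta (q := α / 2) (by linarith) hF hG h4 h3' hz h5 hM cU_ge rfl

lemma wtm_cont (a0 : 0 < α) (y : Eucl (d + 1)) (s : ℝ) : Continuous (wtm d Λ M α y s) := by
  unfold wtm ellT
  refine Continuous.add ?_ (Continuous.mul continuous_const ?_)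
  · exact Continuous.rpow_const (by fun_prop) fun x => Or.inr (by linarith)
  · exact Continuous.rpow_const (by fun_prop) fun x => Or.inr (by linarith)

lemma wtm_ge (hM : 1 ≤ M) (a0 : 0 < α) (a1 : α ≤ 1 / 2) {y : Eucl (d + 1)} {s : ℝ} (q : SpaceTime (d + 1))
    (hy : lastC y = 0) (hq : 0 ≤ lastC q.1) (ht : s ≤ q.2) : (‖q.1 - y‖ + (q.2 - s)) ^ α ≤ 2 * wtm d Λ M α y s q := by
  have e : ellT M y s q = lastC q.1 + 3 * M * (q.2 - s) := by rw [ellT, inner_eN, lastC_sub, hy, sub_zero]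
  have hτ : 0 ≤ q.2 - s := by linarith
  have h0 : q.2 - s ≤ ellT M y s q := by rw [e]; nlinarith only [hq, hτ, hM]
  have hn := norm_nonneg (q.1 - y)
  have h1 : (‖q.1 - y‖ + (q.2 - s)) ^ 2 ≤ 2 * (‖q.1 - y‖ ^ 2 + ellT M y s q ^ 2) := by
    nlinarith only [h0, hτ, hn, sq_nonneg (‖q.1 - y‖ - (q.2 - s))]
  have h2 := le_half_rpow (by positivity) h1 a0.le
  have h3 := mul_rpow_le (c := 2) (s := ‖q.1 - y‖ ^ 2 + ellT M y s q ^ 2) (α := α / 2) (by norm_num) (by positivity) (by linarith)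
  have h4 : 0 ≤ cU d Λ M * (ellT M y s q ^ 2) ^ (α / 2) := by
    have := cU_ge (d := d) (Λ := Λ) (M := M)
    positivity
  unfold wtm
  linarith

lemma wtm_le (hM : 1 ≤ M) (a0 : 0 < α) (a1 : α ≤ 1 / 2) {y : Eucl (d + 1)} {s : ℝ} (q : SpaceTime (d + 1))
    (hy : lastC y = 0) (hq : 0 ≤ lastC q.1) (ht : s ≤ q.2) :
    wtm d Λ M α y s q ≤ (1 + cU d Λ M) * (3 * M) * (‖q.1 - y‖ + (q.2 - s)) ^ α := by
  have e : ellT M y s q = lastC q.1 + 3 * M * (q.2 - s) := by rw [ellT, inner_eN, lastC_sub, hy, sub_zero]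
  have hτ : 0 ≤ q.2 - s := by linarith
  have hn := norm_nonneg (q.1 - y)
  have hx : lastC q.1 ≤ ‖q.1 - y‖ := by
    have := (le_abs_self _).trans (abs_lastC_le (q.1 - y))
    rwa [lastC_sub, hy, sub_zero] at this
  have hl0 : 0 ≤ ellT M y s q := by rw [e]; positivity
  have hs : 0 ≤ 3 * M * (‖q.1 - y‖ + (q.2 - s)) := by positivity
  have hl1 : ‖q.1 - y‖ + ellT M y s q ≤ 3 * M * (‖q.1 - y‖ + (q.2 - s)) := by rw [e]; nlinarith only [hx, hτ, hM, hn]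
  have g1 : ‖q.1 - y‖ ^ 2 + ellT M y s q ^ 2 ≤ (3 * M * (‖q.1 - y‖ + (q.2 - s))) ^ 2 := by
    nlinarith only [hl1, hl0, hn, mul_nonneg hn hl0]
  have g2 := half_rpow_le hs (by positivity) g1 a0.le
  have g3 := half_rpow_le hs (sq_nonneg (ellT M y s q)) (by nlinarith only [g1, sq_nonneg ‖q.1 - y‖]) a0.le
  have g4 := mul_rpow_le (c := 3 * M) (s := ‖q.1 - y‖ + (q.2 - s)) (α := α) (by linarith) (by positivity) (by linarith)
  have hK := cU_ge (d := d) (Λ := Λ) (M := M)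
  have g5 := mul_le_mul_of_nonneg_left (g3.trans g4) (by linarith : 0 ≤ cU d Λ M)
  unfold wtm
  nlinarith only [g2, g4, g5]

lemma pdistL_same {lam : ℝ} (hl : 0 < lam) (x : Eucl (d + 1)) (t s : ℝ) (hx : 0 ≤ lastC x) (hts : s ≤ t) :
    pdistL lam (x, t) (x, s) ≤ 2 * lastC x + (t - s) := by
  rw [pdistL_eq hl]
  have : primeDist x x = 0 := by simp [primeDist]
  simp only [this, zero_add]
  refine (min_le_left _ _).trans (le_of_eq ?_)
  rw [abs_of_nonneg hx, abs_of_nonneg (by linarith)]; ring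

/-- flat time constant -/
def cV (d : ℕ) (Λ M : ℝ) : ℝ := 2 * (2 + cS d Λ M) * ((1 + cU d Λ M) * (3 * M))

lemma timeF (h : HB d lam Λ M C₀ α N Q Q' v v' u) (hα : aOK d Λ M α) {x y : Eucl (d + 1)} {t s : ℝ}
    (hX : (x, t) ∈ closure (Kc d 1)) (hY : (y, s) ∈ closure (Kc d 1)) (hy : lastC y = 0) (hts : s ≤ t) :
    u (x, t) - u (y, s) ≤ cV d Λ M * N * (‖x - y‖ + (t - s)) ^ α := by
  have D := h.D
  have hM := D.M_ge_one
  have hN := h.hN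
  have hcS := cS_ge D
  have a0 := h.a0
  have a1 := h.a1
  have hYm := mem_closure_Kc.1 hY
  have hXm := mem_closure_Kc.1 hX
  simp only at hYm hXm
  obtain ⟨L, hL⟩ : ∃ L, L = 2 * (2 + cS d Λ M) * N := ⟨_, rfl⟩
  have hL0 : 0 < L := by rw [hL]; positivity
  have key : u (x, t) ≤ u (y, s) + L * wtm d Λ M α y s (x, t) := by
    have hn3 : ∀ q ∈ closure (Kc d 1), ‖q.1 - y‖ < 3 := fun q hq => by
      have := norm_sub_le q.1 y
      have := (mem_closure_Kc.1 hq).1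
      linarith
    refine comparison2 h.sub h.cont y 3 s 0 (W := fun q => u (y, s) + L * wtm d Λ M α y s q)
      ?_ ?_ ?_ (x, t) hX (hn3 _ hX).le hts hXm.2.2.2
    · exact (continuous_const.add (continuous_const.mul (wtm_cont a0 y s))).continuousOn
    · rintro ⟨a, r⟩ hq h1 h2 h3 h4
      simp only at h1 h2 h3 h4
      have hqm := mem_closure_Kc.1 hq
      simp only at hqm
      have hAs : (a, s) ∈ closure (Kc d 1) := mem_closure_Kc.2 ⟨hqm.1, hqm.2.1, hYm.2.2⟩
      have hn := norm_nonneg (a - y)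
      have hτ : 0 ≤ r - s := by linarith
      have hsp := spatial h hα hAs hY
      have hmono : ‖a - y‖ ^ α ≤ (‖a - y‖ + (r - s)) ^ α := Real.rpow_le_rpow hn (by linarith) a0.le
      have hsp' := hsp.trans (mul_le_mul_of_nonneg_left hmono (by positivity))
      have hge := mul_le_mul_of_nonneg_left (wtm_ge (Λ := Λ) hM a0 a1 (a, r) hy hqm.2.1 h2) (by positivity : 0 ≤ (2 + cS d Λ M) * N)
      simp only at hge
      have hP : 0 ≤ N * (‖a - y‖ + (r - s)) ^ α := by positivity
      have hd : u (a, r) - u (a, s) ≤ 2 * (N * (‖a - y‖ + (r - s)) ^ α) := by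
        rcases eq_or_lt_of_le h2 with e | e
        · rw [← e]; rw [← e] at hP; linarith
        · have hb : ‖a‖ = 1 := by
            rcases h4 with (h4 | h4) | h4 | h4
            · exact h4
            · linarith
            · have := hn3 _ hq; simp only at this; linarith
            · linarith
          have hx : lastC a ≤ ‖a - y‖ := by
            have := (le_abs_self _).trans (abs_lastC_le (a - y))
            rwa [lastC_sub, hy, sub_zero] at this
          have := h.data1 (mem_bdryK hq (Or.inl hb)) (mem_bdryK hAs (Or.inl hb))
            (D0 := 2 * (‖a - y‖ + (r - s))) ((pdistL_same D.lam_pos a r s hqm.2.1 h2).trans (by linarith))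
          have h5 := mul_rpow_le (c := 2) (s := ‖a - y‖ + (r - s)) (α := α) (by norm_num) (by positivity) (by linarith)
          have h6 := mul_le_mul_of_nonneg_left h5 hN.le
          linarith
      rw [hL]
      linarith
    · intro q hq h1 h2 h3 _
      have hqm := mem_closure_Kc.1 hq
      obtain ⟨L', β, p, j, j1, j2⟩ := wtm_jet (Λ := Λ) (y := y) (s := s) D a0 a1 hq (by
        rw [ellT, inner_eN, lastC_sub, hy, sub_zero]
        have : 0 < 3 * M * (q.2 - s) := mul_pos (by linarith) (by linarith)
        linarith [hqm.2.1])
      refine ⟨_, _, _, (GJ.const (u (y, s))).add (j.const_mul L), fun _ => ?_, fun _ => ?_⟩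
      · have := mul_neg_of_pos_of_neg hL0 j1; linarith
      · have := mul_neg_of_pos_of_neg hL0 j2; linarith
  have h1 := mul_le_mul_of_nonneg_left (wtm_le (Λ := Λ) hM a0 a1 (x, t) hy hXm.2.1 hts) hL0.le
  simp only at h1
  have e : cV d Λ M * N * (‖x - y‖ + (t - s)) ^ α = L * ((1 + cU d Λ M) * (3 * M) * (‖x - y‖ + (t - s)) ^ α) := by
    rw [hL, cV]; ring
  linarith

end
end GH

noncomputable section GH

section
variable {d : ℕ} {lam Λ M C₀ α N : ℝ} {Q Q' : ℝ → Matrix (Fin (d + 1)) (Fin (d + 1)) ℝ}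
  {v v' : ℝ → Eucl (d + 1)} {u : SpaceTime (d + 1) → ℝ}

lemma cV_ge (D : ObliqueData d lam Λ M C₀ Q Q' v v') : 1 ≤ cV d Λ M := by
  have h1 := cS_ge D
  have h2 := cU_ge (d := d) (Λ := Λ) (M := M)
  have h3 := D.M_ge_one
  have h4 : 6 ≤ (1 + cU d Λ M) * (3 * M) := by nlinarith only [h2, h3]
  unfold cV
  nlinarith only [h1, h4]

lemma timeA (h : HB d lam Λ M C₀ α N Q Q' v v' u) (hα : aOK d Λ M α) {y : Eucl (d + 1)} {t s : ℝ}
    (hX : (y, t) ∈ closure (Kc d 1)) (hY : (y, s) ∈ closure (Kc d 1)) (hts : s ≤ t) :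
    u (y, t) - u (y, s) ≤ (cV d Λ M + cS d Λ M) * N * (lastC y + (t - s)) ^ α := by
  have D := h.D
  have hN := h.hN
  have hcS := cS_ge D
  have a0 := h.a0
  have hYm := mem_closure_Kc.1 hY
  simp only at hYm
  obtain ⟨c, hc⟩ : ∃ c, c = lastC y := ⟨_, rfl⟩
  obtain ⟨f, hf⟩ : ∃ f, f = y - c • eN d := ⟨_, rfl⟩
  have hf0 : lastC f = 0 := by rw [hf, lastC_sub, lastC_smul, lastC_eN, hc]; ring
  have hyf : ‖y - f‖ = lastC y := by
    rw [hf, sub_sub_cancel, norm_smul, norm_eN, mul_one, hc, Real.norm_eq_abs, abs_of_nonneg hYm.2.1]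
  have hfn : ‖f‖ ≤ 1 := by
    refine le_trans (abs_le_of_sq_le_sq'' ?_ (norm_nonneg y)) hYm.1
    rw [hf, norm_sub_sq_real, real_inner_smul_right, real_inner_comm, inner_eN, norm_smul, norm_eN, ← hc, mul_one,
      Real.norm_eq_abs, sq_abs]
    nlinarith only [sq_nonneg c]
  have hF : (f, s) ∈ closure (Kc d 1) := mem_closure_Kc.2 ⟨hfn, hf0.ge, hYm.2.2⟩
  have h1 := timeF h hα hX hF hf0 hts
  have h2 := spatial h hα hF hY
  rw [hyf] at h1
  rw [← norm_neg, neg_sub, hyf] at h2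
  have h3 := mul_le_mul_of_nonneg_left (Real.rpow_le_rpow hYm.2.1 (by linarith : lastC y ≤ lastC y + (t - s)) a0.le)
    (by positivity : 0 ≤ cS d Λ M * N)
  linarith

/-- interior time constants -/
def cW (d : ℕ) (Λ M : ℝ) : ℝ := 4 * (cV d Λ M + cS d Λ M) + cS d Λ M + 1

def bT (d : ℕ) (Λ M : ℝ) : ℝ := 2 * (Λ * M ^ 2 * (d + 1)) + 1

lemma int_jet (D : ObliqueData d lam Λ M C₀ Q Q' v v') (a0 : 0 < α) (a1 : α ≤ 1 / 2)
    {p₀ : SpaceTime (d + 1)} (hp : p₀ ∈ closure (Kc d 1)) {y : Eucl (d + 1)} {s : ℝ} (hz : s < p₀.2) :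
    ∃ L β p, GJ (PF p₀) (Q p₀.2) lam (v p₀.2) p₀
      (fun q => (‖q.1 - y‖ ^ 2 + bT d Λ M / lam * (q.2 - s)) ^ (α / 2)) L β p ∧ L < 0 := by
  have ht := mem_time hp
  have hl := PF_le p₀
  have hlam := D.lam_pos
  have hk := kap_ge_one D
  have hB : 0 < bT d Λ M := by unfold bT; positivity
  have jf := (GJ.nsq (Qm := Q p₀.2) (lam := lam) (w := v p₀.2) hl y).add
    ((GJ.time (Qm := Q p₀.2) (lam := lam) (w := v p₀.2) hl s).const_mul (bT d Λ M / lam))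
  have hτ : 0 < bT d Λ M / lam * (p₀.2 - s) := mul_pos (by positivity) (by linarith)
  have hf : 0 < ‖p₀.1 - y‖ ^ 2 + bT d Λ M / lam * (p₀.2 - s) := by positivity
  have j := jf.rpow hl hf (α / 2)
  refine ⟨_, _, _, j, ?_⟩
  have hG := Real.rpow_pos_of_pos hf (α / 2 - 1)
  have hG2 := Real.rpow_pos_of_pos hf (α / 2 - 2)
  set G := (‖p₀.1 - y‖ ^ 2 + bT d Λ M / lam * (p₀.2 - s)) ^ (α / 2 - 1)
  set G2 := (‖p₀.1 - y‖ ^ 2 + bT d Λ M / lam * (p₀.2 - s)) ^ (α / 2 - 2)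
  have e : bT d Λ M / lam * -lam = - bT d Λ M := by field_simp
  rw [e]
  have h1 : 2 * (Q p₀.2).trace + -bT d Λ M < 0 := by
    have := Q_trace D ht
    unfold bT; linarith
  have h2 : α / 2 * G * (2 * (Q p₀.2).trace + -bT d Λ M) < 0 := mul_neg_of_pos_of_neg (by positivity) h1
  have h3 := Q_qf_nonneg D ht ((2 : ℝ) • (p₀.1 - y) + (bT d Λ M / lam) • (0 : Eucl (d + 1)))
  have h4 : α / 2 * ((α / 2 - 1) * G2) ≤ 0 :=
    mul_nonpos_of_nonneg_of_nonpos (by linarith) (mul_nonpos_of_nonpos_of_nonneg (by linarith) hG2.le)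
  have := mul_nonpos_of_nonpos_of_nonneg h4 h3
  linarith

lemma timeI (h : HB d lam Λ M C₀ α N Q Q' v v' u) (hα : aOK d Λ M α) {y : Eucl (d + 1)} {t s ρ : ℝ}
    (hX : (y, t) ∈ closure (Kc d 1)) (hY : (y, s) ∈ closure (Kc d 1)) (hts : s ≤ t) (hρ : 0 < ρ)
    (hy : lastC y = 2 * ρ) (hτρ : t - s ≤ lam * ρ ^ 2) :
    u (y, t) ≤ u (y, s) + cW d Λ M * N * (bT d Λ M / lam * (t - s)) ^ (α / 2) := by
  have D := h.D
  have hN := h.hN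
  have hlam := D.lam_pos
  have hlam1 := D.lam_le_one
  have hcS := cS_ge D
  have hcV := cV_ge D
  have a0 := h.a0
  have a1 := h.a1
  have hk := kap_ge_one D
  have hB : 1 ≤ bT d Λ M := by
    unfold bT
    have : 0 ≤ 2 * (Λ * M ^ 2 * ((d : ℝ) + 1)) := by positivity
    linarith
  have hYm := mem_closure_Kc.1 hY
  have hXm := mem_closure_Kc.1 hX
  simp only at hYm hXm
  have hρ1 : ρ ≤ 1 := by
    have := (le_abs_self _).trans (abs_lastC_le y)
    linarith
  obtain ⟨L, hL⟩ : ∃ L, L = cW d Λ M * N := ⟨_, rfl⟩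
  have hL0 : 0 < L := by rw [hL, cW]; positivity
  have key := comparison2 h.sub h.cont y ρ s t
    (W := fun q => u (y, s) + L * (‖q.1 - y‖ ^ 2 + bT d Λ M / lam * (q.2 - s)) ^ (α / 2))
      ?_ ?_ ?_ (y, t) hX (by simpa using hρ.le) hts le_rfl
  · simp only [sub_self, norm_zero] at key
    rw [← hL]
    simpa using key
  · refine (continuous_const.add (continuous_const.mul ?_)).continuousOn
    exact Continuous.rpow_const (by fun_prop) fun x => Or.inr (by linarith)
  · rintro ⟨a, r⟩ hq h1 h2 h3 h4
    simp only at h1 h2 h3 h4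
    have hqm := mem_closure_Kc.1 hq
    simp only at hqm
    have hAs : (a, s) ∈ closure (Kc d 1) := mem_closure_Kc.2 ⟨hqm.1, hqm.2.1, hYm.2.2⟩
    have hn := norm_nonneg (a - y)
    have hτ : 0 ≤ r - s := by linarith
    have hτl : 0 ≤ (r - s) / lam := by positivity
    have hτl' : (r - s) / lam ≤ bT d Λ M / lam * (r - s) := by
      rw [div_mul_eq_mul_div]; gcongr; nlinarith only [hB, hτ]
    obtain ⟨S, hS⟩ : ∃ S, S = ‖a - y‖ ^ 2 + bT d Λ M / lam * (r - s) := ⟨_, rfl⟩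
    have hS1 : ‖a - y‖ ^ 2 ≤ S := by rw [hS]; linarith
    have hS2 : (r - s) / lam ≤ S := by rw [hS]; linarith [sq_nonneg ‖a - y‖]
    have hsp := spatial h hα hAs hY
    have hzS := le_half_rpow hn hS1 a0.le
    have hsp' := hsp.trans (mul_le_mul_of_nonneg_left hzS (by positivity))
    have hP : 0 ≤ N * S ^ (α / 2) := mul_nonneg hN.le (Real.rpow_nonneg (hτl.trans hS2) _)
    have hd : u (a, r) - u (a, s) ≤ (4 * (cV d Λ M + cS d Λ M) + 1) * (N * S ^ (α / 2)) := by
      rcases eq_or_lt_of_le h2 with e | e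
      · rw [← e]; rw [sub_self]; positivity
      · have hcase : ‖a‖ = 1 ∨ ‖a - y‖ = ρ := by
          rcases h4 with (h4 | h4) | h4 | h4
          · exact Or.inl h4
          · linarith
          · exact Or.inr h4
          · linarith
        rcases hcase with hb | hb
        · have e1 := h.data1 (mem_bdryK hq (Or.inl hb)) (mem_bdryK hAs (Or.inl hb))
            (D0 := √((r - s) / lam)) ((pdistL_le2 D.lam_pos _ _).trans (by
              simp [abs_of_nonneg hτ]))
          have e2 := le_half_rpow (Real.sqrt_nonneg _) ((Real.sq_sqrt hτl).trans_le hS2) a0.le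
          have e3 := mul_le_mul_of_nonneg_left e2 hN.le
          nlinarith only [e1, e3, hP, hcV, hcS]
        · have e1 := timeA h hα hq hAs h2
          have hx : lastC a ≤ 3 * ρ := by
            have := (le_abs_self _).trans (abs_lastC_le (a - y))
            rw [lastC_sub, hy] at this
            linarith
          have hr : r - s ≤ ρ := by
            have i1 : lam * ρ ^ 2 ≤ 1 * (ρ * 1) := by
              rw [sq]; gcongr
            linarith
          have e2 := rpow_le_mul (x := lastC a + (r - s)) (c := 4) (s := ‖a - y‖) (by linarith [hqm.2.1]) (by rw [hb]; linarith) (by norm_num) hn a0.le (by linarith)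
          have e3 : (lastC a + (r - s)) ^ α ≤ 4 * S ^ (α / 2) := by linarith
          have e4 := mul_le_mul_of_nonneg_left e3 (by positivity : 0 ≤ (cV d Λ M + cS d Λ M) * N)
          nlinarith only [e1, e4, hP]
    rw [← hS, hL, cW]
    linarith
  · intro q hq h1 h2 h3 _
    obtain ⟨L', β, p, j, j1⟩ := int_jet (Λ := Λ) (y := y) (s := s) D a0 a1 hq h2
    refine ⟨_, _, _, (GJ.const (u (y, s))).add (j.const_mul L), fun _ => ?_, fun hF => ?_⟩
    · have := mul_neg_of_pos_of_neg hL0 j1; linarith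
    · exfalso
      have := (neg_abs_le _).trans' (neg_le_neg (abs_lastC_le (q.1 - y)))
      rw [lastC_sub, hy, hF.2.1] at this
      linarith

/-- final time constant -/
def cT (d : ℕ) (Λ M : ℝ) : ℝ := 3 * (cV d Λ M + cS d Λ M) + cW d Λ M * bT d Λ M

lemma timeT (h : HB d lam Λ M C₀ α N Q Q' v v' u) (hα : aOK d Λ M α) {y : Eucl (d + 1)} {t s : ℝ}
    (hX : (y, t) ∈ closure (Kc d 1)) (hY : (y, s) ∈ closure (Kc d 1)) (hts : s ≤ t) :
    u (y, t) - u (y, s) ≤ cT d Λ M * N * (min (2 * |lastC y| + |t - s|) (√(|t - s| / lam))) ^ α := by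
  have D := h.D
  have hN := h.hN
  have hlam := D.lam_pos
  have hlam1 := D.lam_le_one
  have hcS := cS_ge D
  have hcV := cV_ge D
  have a0 := h.a0
  have a1 := h.a1
  have hk := kap_ge_one D
  have hB : 1 ≤ bT d Λ M := by
    unfold bT
    have : 0 ≤ 2 * (Λ * M ^ 2 * ((d : ℝ) + 1)) := by positivity
    linarith
  have hW : 0 ≤ cW d Λ M * bT d Λ M := by unfold cW; positivity
  have hYm := mem_closure_Kc.1 hY
  have hXm := mem_closure_Kc.1 hX
  simp only at hYm hXm
  have hτ : 0 ≤ t - s := by linarith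
  have hA := timeA h hα hX hY hts
  rw [abs_of_nonneg hτ, abs_of_nonneg hYm.2.1]
  have hτl : 0 ≤ (t - s) / lam := by positivity
  have fin : ∀ R, 0 ≤ R → lastC y + (t - s) ≤ 3 * R → u (y, t) - u (y, s) ≤ cT d Λ M * N * R ^ α := fun R hR hle => by
    have e2 := rpow_le_mul (by linarith [hYm.2.1]) hle (by norm_num) hR a0.le (by linarith : α ≤ 1)
    have e4 := mul_le_mul_of_nonneg_left e2 (by positivity : 0 ≤ (cV d Λ M + cS d Λ M) * N)
    have : 0 ≤ cW d Λ M * bT d Λ M * (N * R ^ α) := by positivity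
    unfold cT
    linarith
  rcases min_choice (2 * lastC y + (t - s)) (√((t - s) / lam)) with hm | hm <;> rw [hm]
  · exact fin _ (by linarith [hYm.2.1]) (by linarith [hYm.2.1])
  · by_cases hc : t - s ≤ lam * (lastC y / 2) ^ 2 ∧ 0 < lastC y / 2
    · have h1 := timeI h hα hX hY hts hc.2 (by ring) hc.1
      have h2 := mul_rpow_le (c := bT d Λ M) (s := (t - s) / lam) (α := α / 2) hB hτl (by linarith)
      rw [← Real.sq_sqrt hτl, sq_rpow_half (Real.sqrt_nonneg _), Real.sq_sqrt hτl] at h2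
      rw [show bT d Λ M * ((t - s) / lam) = bT d Λ M / lam * (t - s) by ring] at h2
      have h3 := mul_le_mul_of_nonneg_left h2 (by unfold cW; positivity : 0 ≤ cW d Λ M * N)
      have : 0 ≤ 3 * (cV d Λ M + cS d Λ M) * (N * √((t - s) / lam) ^ α) := by positivity
      unfold cT
      linarith
    · apply fin _ (Real.sqrt_nonneg _)
      have h1 : t - s ≤ √((t - s) / lam) := Real.le_sqrt_of_sq_le (by
        rw [le_div_iff₀ hlam]
        have i1 : (t - s) * (t - s) ≤ (t - s) * 1 := by gcongr; linarith
        have i2 : (t - s) ^ 2 * lam ≤ (t - s) ^ 2 * 1 := by gcongr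
        nlinarith only [i1, i2])
      have h2 : lastC y / 2 ≤ √((t - s) / lam) := by
        rcases eq_or_lt_of_le hYm.2.1 with e | e
        · rw [← e]; simp
        · apply Real.le_sqrt_of_sq_le
          rw [le_div_iff₀ hlam]
          have : ¬ (t - s ≤ lam * (lastC y / 2) ^ 2) := fun hh => hc ⟨hh, by linarith⟩
          linarith
      linarith

lemma full_est (h : HB d lam Λ M C₀ α N Q Q' v v' u) (hα : aOK d Λ M α) {X Y : SpaceTime (d + 1)}
    (hX : X ∈ closure (Kc d 1)) (hY : Y ∈ closure (Kc d 1)) :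
    u X - u Y ≤ (cS d Λ M + 2 * cT d Λ M) * N * pdistL lam X Y ^ α := by
  have D := h.D
  have hN := h.hN
  have hlam := D.lam_pos
  have hcS := cS_ge D
  have hcV := cV_ge D
  have a0 := h.a0
  have a1 := h.a1
  have hk := kap_ge_one D
  have hT : 0 ≤ cT d Λ M := by unfold cT cW bT; positivity
  obtain ⟨x, t⟩ := X
  obtain ⟨y, s⟩ := Y
  have hYm := mem_closure_Kc.1 hY
  have hXm := mem_closure_Kc.1 hX
  simp only at hYm hXm
  have hYt : (y, t) ∈ closure (Kc d 1) := mem_closure_Kc.2 ⟨hYm.1, hYm.2.1, hXm.2.2⟩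
  have h1 := spatial h hα hX hYt
  have hp := pdistL_nonneg hlam (x, t) (y, s)
  have h2 := Real.rpow_le_rpow (norm_nonneg _) (norm_le_pdistL hlam (x, t) (y, s)) a0.le
  simp only at h2
  have h1' := h1.trans (mul_le_mul_of_nonneg_left h2 (by positivity))
  have h3 : u (y, t) - u (y, s) ≤ cT d Λ M * N * (min (2 * |lastC y| + |t - s|) (√(|t - s| / lam))) ^ α := by
    rcases le_total s t with hst | hst
    · exact timeT h hα hYt hY hst
    · have := timeT h.neg hα hY hYt hst
      rw [abs_sub_comm s t] at this
      linarith
  have h4 := rpow_le_mul (α := α) (le_min (by positivity) (Real.sqrt_nonneg _)) (time_le_pdistL hlam (x, t) (y, s)) (by norm_num) hp a0.le (by linarith)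
  simp only at h4
  have h5 := h3.trans (mul_le_mul_of_nonneg_left h4 (by positivity))
  linarith

lemma exists_alpha (d : ℕ) {Λ M : ℝ} (hΛ : 1 ≤ Λ) (hM : 1 ≤ M) : ∃ α, 0 < α ∧ α ≤ 1 / 2 ∧ aOK d Λ M α := by
  have hmu : 0 < bmu d Λ M := by unfold bmu bH; positivity
  obtain ⟨a, ha⟩ : ∃ a, a = 4 * (Λ * M ^ 2) * bH M := ⟨_, rfl⟩
  obtain ⟨b, hb⟩ : ∃ b, b = 2 * Real.exp (2 * (bmu d Λ M * bH M)) * (Λ * M ^ 2 * (d + 1) + 1) * (M + 1) := ⟨_, rfl⟩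
  have ha0 : 0 < a := by rw [ha, bH]; positivity
  have hb0 : 0 < b := by rw [hb]; positivity
  refine ⟨min (1 / 2) (min (1 / 2 / a) (bmu d Λ M / 4 / b)), by positivity, min_le_left _ _, ?_, ?_⟩
  · have : min (1 / 2) (min (1 / 2 / a) (bmu d Λ M / 4 / b)) ≤ 1 / 2 / a := (min_le_right _ _).trans (min_le_left _ _)
    rw [le_div_iff₀ ha0, ha] at this
    rw [ha] 
    linarith
  · have : min (1 / 2) (min (1 / 2 / a) (bmu d Λ M / 4 / b)) ≤ bmu d Λ M / 4 / b := (min_le_right _ _).trans (min_le_right _ _)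
    rw [le_div_iff₀ hb0] at this
    generalize min (1 / 2) (min (1 / 2 / a) (bmu d Λ M / 4 / b)) = m at *
    rw [hb] at this
    nlinarith only [this, hmu]

end
end GH

/-- **Global Hölder estimate with Hölder boundary data.** There are universal `α ∈ (0,1)`
and `C > 0`, depending only on `n, Λ, M, C₀`, such that: if `η` is a continuous viscosity
solution of the linearized oblique problem on `K₁⁺` with `η = ψ` on `∂_bK₁` and
`‖ψ‖_{C^{0,α}_{x,t}(∂_bK₁)} < ∞`, then `‖η‖_{C^{0,α}_{x,t}(K̄₁)} ≤ C‖ψ‖_{C^{0,α}_{x,t}(∂_bK₁)}`. -/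
theorem global_holder_estimate (d : ℕ) (hd : 1 ≤ d) (Λ M C₀ : ℝ)
    (hΛ : 1 ≤ Λ) (hM : 1 ≤ M) (hC₀ : 0 < C₀) :
    ∃ α C : ℝ, 0 < α ∧ α < 1 ∧ 0 < C ∧
      ∀ (lam : ℝ) (Q Q' : ℝ → Matrix (Fin (d + 1)) (Fin (d + 1)) ℝ)
        (v v' : ℝ → Eucl (d + 1)) (η ψ : SpaceTime (d + 1) → ℝ),
        ObliqueData d lam Λ M C₀ Q Q' v v' →
        ContinuousOn η (closure (Kc d 1)) →
        ObliqueSolution d lam Q v η →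
        EqOn η ψ (bdryK d) →
        ∀ N : ℝ,
          (∀ X ∈ bdryK d, |ψ X| ≤ N) →
          (∀ X ∈ bdryK d, ∀ Y ∈ bdryK d, |ψ X - ψ Y| ≤ N * pdistL lam X Y ^ α) →
          (∀ X ∈ closure (Kc d 1), |η X| ≤ C * N) ∧
          (∀ X ∈ closure (Kc d 1), ∀ Y ∈ closure (Kc d 1),
            |η X - η Y| ≤ C * N * pdistL lam X Y ^ α) := by
  obtain ⟨α, a0, a1, hα⟩ := exists_alpha d hΛ hM
  refine ⟨α, max 1 (cS d Λ M + 2 * cT d Λ M), a0, by linarith, lt_of_lt_of_le one_pos (le_max_left _ _), ?_⟩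
  intro lam Q Q' v v' η ψ D hc hs hE N h1 h2
  have hlam := D.lam_pos
  have hs' := sub_of_neg hs.2
  have hN : 0 ≤ N := by
    have : ((0 : Eucl (d + 1)), (-1 : ℝ)) ∈ bdryK d := mem_bdryK (mem_closure_Kc.2 (by simp [lastC])) (Or.inr rfl)
    exact (abs_nonneg _).trans (h1 _ this)
  have e1 : ∀ X ∈ bdryK d, |η X| ≤ N := fun X hX => by rw [hE hX]; exact h1 X hX
  have e2 : ∀ X ∈ bdryK d, ∀ Y ∈ bdryK d, |η X - η Y| ≤ N * pdistL lam X Y ^ α := fun X hX Y hY => by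
    rw [hE hX, hE hY]; exact h2 X hX Y hY
  have hb : ∀ X ∈ closure (Kc d 1), |η X| ≤ N := fun X hX => by
    rw [abs_le']
    exact ⟨max_principle D hs.1 hc (fun Z hZ => (le_abs_self _).trans (e1 Z hZ)) X hX,
      max_principle D hs' hc.neg (fun Z hZ => (neg_le_abs _).trans (e1 Z hZ)) X hX⟩
  have hC := le_max_left 1 (cS d Λ M + 2 * cT d Λ M)
  have hC2 := le_max_right 1 (cS d Λ M + 2 * cT d Λ M)
  have key : ∀ X ∈ closure (Kc d 1), ∀ Y ∈ closure (Kc d 1),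
      η X - η Y ≤ max 1 (cS d Λ M + 2 * cT d Λ M) * N * pdistL lam X Y ^ α := fun X hX Y hY => by
    have hP : 0 ≤ pdistL lam X Y ^ α := Real.rpow_nonneg (pdistL_nonneg hlam _ _) _
    have hε : ∀ ε : ℝ, 0 < ε → η X - η Y ≤ max 1 (cS d Λ M + 2 * cT d Λ M) * (N + ε) * pdistL lam X Y ^ α := fun ε he => by
      have h : HB d lam Λ M C₀ α (N + ε) Q Q' v v' η :=
        ⟨D, a0, a1, by linarith, hs.1, hs', hc, fun Z hZ => (hb Z hZ).trans (by linarith), fun Z hZ Z' hZ' =>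
          (e2 Z hZ Z' hZ').trans (mul_le_mul_of_nonneg_right (by linarith)
            (Real.rpow_nonneg (pdistL_nonneg hlam _ _) _))⟩
      exact (full_est h hα hX hY).trans (by gcongr)
    have ht : Tendsto (fun ε : ℝ => max 1 (cS d Λ M + 2 * cT d Λ M) * (N + ε) * pdistL lam X Y ^ α) (𝓝[>] 0)
        (𝓝 (max 1 (cS d Λ M + 2 * cT d Λ M) * N * pdistL lam X Y ^ α)) := by
      have : Continuous (fun ε : ℝ => max 1 (cS d Λ M + 2 * cT d Λ M) * (N + ε) * pdistL lam X Y ^ α) := by fun_prop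
      simpa using this.continuousWithinAt.tendsto (x := 0) (s := Ioi 0)
    exact ge_of_tendsto ht (eventually_nhdsWithin_of_forall hε)
  have hsym : ∀ X Y : SpaceTime (d + 1), pdistL lam X Y = pdistL lam Y X := fun X Y => by
    have : primeDist X.1 Y.1 = primeDist Y.1 X.1 := by
      unfold primeDist; congr 1; exact Finset.sum_congr rfl fun i _ => by ring
    rw [pdistL_eq hlam, pdistL_eq hlam, this, abs_sub_comm X.2, abs_sub_comm (lastC X.1), add_comm |lastC X.1|]
  refine ⟨fun X hX => (hb X hX).trans (by nlinarith only [hC, hN]), fun X hX Y hY => abs_le'.2 ⟨key X hX Y hY, ?_⟩⟩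
  rw [neg_sub, hsym]
  exact key Y hY X hX
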